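/- Let n > p ≥ 1, let Σ ⊆ ℝⁿ be a coherent closed set with 0 ∈ Σ, and let φ = (φ₁,…,φ_p) : ℝⁿ → ℝᵖ be a C^∞ map near 0 with φ(0)=0. Then φ is finitely Σ-SV-determined if and only if the ideal I_K(φ) is Σ-elliptic. Here φ is finitely Σ-SV-determined means: there exists a positive integer k such that for every C^∞ map g : ℝⁿ → ℝᵖ near 0 with g(0)=0 whose partial derivatives of order ≤ k agree with those of φ at every point of Σ in some neighbourhood of 0, there exist neighbourhoods U, V of 0 and a homeomorphism σ : U → V with σ(0)=0, σ(x)=x for all x ∈ Σ ∩ U, and σ(φ⁻¹(0) ∩ U) = g⁻¹(0) ∩ V. -/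

import Mathlib

/-- The `p × p` Jacobian minor of `φ` with columns `ι` (a generator of `I_K(φ)`). -/
noncomputable def kGen (n p : ℕ) (φ : EuclideanSpace ℝ (Fin n) → EuclideanSpace ℝ (Fin p))
    (ι : Fin p → Fin n) (x : EuclideanSpace ℝ (Fin n)) : ℝ :=
  Matrix.det fun j k : Fin p => fderiv ℝ φ x (EuclideanSpace.single (ι k) 1) j

/-- The `(p+1) × (p+1)` Jacobian minor of `(φ, ρ)`, `ρ(x) = ‖x‖²`, with columns `ι`
(a generator of `I_T(φ)`). -/
noncomputable def tGen (n p : ℕ) (φ : EuclideanSpace ℝ (Fin n) → EuclideanSpace ℝ (Fin p))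
    (ι : Fin (p + 1) → Fin n) (x : EuclideanSpace ℝ (Fin n)) : ℝ :=
  Matrix.det fun j k : Fin (p + 1) =>
    if h : (j : ℕ) < p then fderiv ℝ φ x (EuclideanSpace.single (ι k) 1) ⟨j, h⟩
    else 2 * x (ι k)

open scoped Classical in
/-- `h` belongs to the ideal `I_K(φ)` of germs at `0` of `C^∞` functions: near `0`,
`h` is a combination with `C^∞` coefficients of `φ₁, …, φ_p` and the `p × p`
Jacobian minors of `φ`. -/
def MemIK (n p : ℕ) (φ : EuclideanSpace ℝ (Fin n) → EuclideanSpace ℝ (Fin p))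
    (h : EuclideanSpace ℝ (Fin n) → ℝ) : Prop :=
  ∃ U ∈ nhds (0 : EuclideanSpace ℝ (Fin n)),
    ∃ a : Fin p → EuclideanSpace ℝ (Fin n) → ℝ,
      ∃ b : (Fin p → Fin n) → EuclideanSpace ℝ (Fin n) → ℝ,
        (∀ j, ContDiffOn ℝ (⊤ : ℕ∞) (a j) U) ∧ (∀ ι, ContDiffOn ℝ (⊤ : ℕ∞) (b ι) U) ∧
          ∀ x ∈ U, h x = (∑ j, a j x * φ x j) +
            ∑ ι : Fin p → Fin n, if StrictMono ι then b ι x * kGen n p φ ι x else 0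

open scoped Classical in
/-- `h` belongs to the ideal `I_T(φ)` of germs at `0` of `C^∞` functions: near `0`,
`h` is a combination with `C^∞` coefficients of `φ₁, …, φ_p` and the
`(p+1) × (p+1)` Jacobian minors of `(φ, ρ)`, `ρ(x) = ‖x‖²`. -/
def MemIT (n p : ℕ) (φ : EuclideanSpace ℝ (Fin n) → EuclideanSpace ℝ (Fin p))
    (h : EuclideanSpace ℝ (Fin n) → ℝ) : Prop :=
  ∃ U ∈ nhds (0 : EuclideanSpace ℝ (Fin n)),
    ∃ a : Fin p → EuclideanSpace ℝ (Fin n) → ℝ,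
      ∃ b : (Fin (p + 1) → Fin n) → EuclideanSpace ℝ (Fin n) → ℝ,
        (∀ j, ContDiffOn ℝ (⊤ : ℕ∞) (a j) U) ∧ (∀ ι, ContDiffOn ℝ (⊤ : ℕ∞) (b ι) U) ∧
          ∀ x ∈ U, h x = (∑ j, a j x * φ x j) +
            ∑ ι : Fin (p + 1) → Fin n, if StrictMono ι then b ι x * tGen n p φ ι x else 0

/-- `h` belongs to `m_Σ^∞`: `h` is `C^∞` near `0` and all its partial derivatives of
every order vanish at all points of `S` near `0`. -/
def FlatOnSet (n : ℕ) (S : Set (EuclideanSpace ℝ (Fin n)))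
    (h : EuclideanSpace ℝ (Fin n) → ℝ) : Prop :=
  ∃ U ∈ nhds (0 : EuclideanSpace ℝ (Fin n)), ContDiffOn ℝ (⊤ : ℕ∞) h U ∧
    ∀ k : ℕ, ∀ x ∈ S ∩ U, iteratedFDeriv ℝ k h x = 0

/-- The closed set `S` is coherent: there are finitely many `C^∞` functions vanishing
on `S` near `0` such that every `C^∞` function vanishing on `S` near `0` is, near `0`,
a combination of them with `C^∞` coefficients. -/
def CoherentSet (n : ℕ) (S : Set (EuclideanSpace ℝ (Fin n))) : Prop :=
  ∃ N : ℕ, ∃ q : Fin N → EuclideanSpace ℝ (Fin n) → ℝ,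
    (∃ U ∈ nhds (0 : EuclideanSpace ℝ (Fin n)),
      (∀ i, ContDiffOn ℝ (⊤ : ℕ∞) (q i) U) ∧ ∀ i, ∀ x ∈ S ∩ U, q i x = 0) ∧
    ∀ h : EuclideanSpace ℝ (Fin n) → ℝ,
      (∃ V ∈ nhds (0 : EuclideanSpace ℝ (Fin n)),
        ContDiffOn ℝ (⊤ : ℕ∞) h V ∧ ∀ x ∈ S ∩ V, h x = 0) →
      ∃ W ∈ nhds (0 : EuclideanSpace ℝ (Fin n)),
        ∃ a : Fin N → EuclideanSpace ℝ (Fin n) → ℝ,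
          (∀ i, ContDiffOn ℝ (⊤ : ℕ∞) (a i) W) ∧ ∀ x ∈ W, h x = ∑ i, a i x * q i x

open scoped Classical in
/-- The ideal `I_K(φ)` is `Σ`-elliptic: some combination `F` of its generators with
`C^∞` coefficients satisfies `|F(x)| ≥ C · d(x, S)^α` near `0`. -/
def IKElliptic (n p : ℕ) (S : Set (EuclideanSpace ℝ (Fin n)))
    (φ : EuclideanSpace ℝ (Fin n) → EuclideanSpace ℝ (Fin p)) : Prop :=
  ∃ U ∈ nhds (0 : EuclideanSpace ℝ (Fin n)),
    ∃ a : Fin p → EuclideanSpace ℝ (Fin n) → ℝ,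
      ∃ b : (Fin p → Fin n) → EuclideanSpace ℝ (Fin n) → ℝ,
        (∀ j, ContDiffOn ℝ (⊤ : ℕ∞) (a j) U) ∧ (∀ ι, ContDiffOn ℝ (⊤ : ℕ∞) (b ι) U) ∧
          ∃ C > (0 : ℝ), ∃ α > (0 : ℝ), ∀ x ∈ U,
            C * Metric.infDist x S ^ α ≤
              |(∑ j, a j x * φ x j) +
                ∑ ι : Fin p → Fin n, if StrictMono ι then b ι x * kGen n p φ ι x else 0|

/-- `φ` is finitely `Σ`-SV-determined: for some positive integer `k`, every `C^∞` map
`g` near `0` with `g 0 = 0` whose partial derivatives of order `≤ k` agree with those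
of `φ` at every point of `S` near `0` can be obtained from `φ` by a homeomorphism
`σ : U → V` between neighbourhoods of `0` fixing `S ∩ U` (hence `0`) and sending
`φ⁻¹(0) ∩ U` onto `g⁻¹(0) ∩ V`. -/
def FinitelySVDetermined (n p : ℕ) (S : Set (EuclideanSpace ℝ (Fin n)))
    (φ : EuclideanSpace ℝ (Fin n) → EuclideanSpace ℝ (Fin p)) : Prop :=
  ∃ k : ℕ, 0 < k ∧
    ∀ g : EuclideanSpace ℝ (Fin n) → EuclideanSpace ℝ (Fin p),
      (∃ W ∈ nhds (0 : EuclideanSpace ℝ (Fin n)), ContDiffOn ℝ (⊤ : ℕ∞) g W) →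
      g 0 = 0 →
      (∃ W ∈ nhds (0 : EuclideanSpace ℝ (Fin n)), ∀ j : ℕ, j ≤ k → ∀ x ∈ S ∩ W,
        iteratedFDeriv ℝ j (fun y => φ y - g y) x = 0) →
      ∃ U ∈ nhds (0 : EuclideanSpace ℝ (Fin n)),
        ∃ V ∈ nhds (0 : EuclideanSpace ℝ (Fin n)),
          ∃ σ τ : EuclideanSpace ℝ (Fin n) → EuclideanSpace ℝ (Fin n),
            ContinuousOn σ U ∧ ContinuousOn τ V ∧ Set.BijOn σ U V ∧
              (∀ x ∈ U, τ (σ x) = x) ∧ (∀ y ∈ V, σ (τ y) = y) ∧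
              σ 0 = 0 ∧ (∀ x ∈ S ∩ U, σ x = x) ∧
              σ '' (φ ⁻¹' {0} ∩ U) = g ⁻¹' {0} ∩ V

section

open scoped ContDiff RealInnerProductSpace

/-- Extrapolation to `1` of polynomials of bounded degree from nodes close to `0`. -/
lemma Polynomial.exists_extrapolation (d : ℕ) {t₀ : ℝ} (ht₀ : 0 < t₀) :
    ∃ (T : Finset ℝ) (w : ℝ → ℝ), (∀ t ∈ T, 0 < t ∧ t < t₀) ∧
      ∀ P : Polynomial ℝ, P.natDegree ≤ d → P.eval 1 = ∑ t ∈ T, w t * P.eval t := by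
  obtain ⟨T, hT, hcard⟩ := (Set.Ioo_infinite ht₀).exists_subset_card_eq (d + 1)
  refine ⟨T, fun t => (Lagrange.basis T id t).eval 1, fun t ht => hT ht, fun P hP => ?_⟩
  have h := Lagrange.eq_interpolate (s := T) (v := id) (f := P) (Set.injOn_id _) (by
    rw [hcard]
    exact lt_of_le_of_lt Polynomial.degree_le_natDegree (by exact_mod_cast Nat.lt_succ_of_le hP))
  conv_lhs => rw [h, Lagrange.interpolate_apply, Polynomial.eval_finsetSum]
  refine Finset.sum_congr rfl fun t _ => ?_
  simp [mul_comm]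

section

variable {V : Type*} [NormedAddCommGroup V] [InnerProductSpace ℝ V] [FiniteDimensional ℝ V]

/-- `det (L + t M)` is polynomial in `t`. -/
lemma ContinuousLinearMap.exists_polynomial_det (L M : V →L[ℝ] V) :
    ∃ P : Polynomial ℝ, P.natDegree ≤ Module.finrank ℝ V ∧
      ∀ t : ℝ, P.eval t = (L + t • M).det := by
  classical
  let b := Module.finBasis ℝ V
  refine ⟨((Polynomial.X : Polynomial ℝ) • (LinearMap.toMatrix b b M.toLinearMap).map Polynomial.C +
    (LinearMap.toMatrix b b L.toLinearMap).map Polynomial.C).det, ?_, fun t => ?_⟩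
  · simpa using Polynomial.natDegree_det_X_add_C_le (LinearMap.toMatrix b b M.toLinearMap)
      (LinearMap.toMatrix b b L.toLinearMap)
  · rw [ContinuousLinearMap.det, ← LinearMap.det_toMatrix b, ← Polynomial.coe_evalRingHom,
      RingHom.map_det]
    congr 1
    ext i j
    simp [LinearMap.toMatrix_apply, add_comm]
    ring

/-- There is no `C¹` retraction of a ball onto its boundary sphere. -/
theorem no_smooth_retraction {r : V → V} (hr : ContDiff ℝ 1 r) {R : ℝ} (hR : 0 < R)
    (hnorm : ∀ x, ‖r x‖ = R) (hid : ∀ x, ‖x‖ = R → r x = x) : False := by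
  let _ : MeasurableSpace V := borel V
  have : BorelSpace V := ⟨rfl⟩
  let B := Metric.closedBall (0 : V) R
  let b := Metric.ball (0 : V) R
  have hrd : Differentiable ℝ r := hr.differentiable one_ne_zero
  have hA : Continuous fun x => fderiv ℝ r x - ContinuousLinearMap.id ℝ V :=
    (hr.continuous_fderiv one_ne_zero).sub continuous_const
  set A : V → V →L[ℝ] V := fun x => fderiv ℝ r x - ContinuousLinearMap.id ℝ V with hAdef
  have hder : ∀ (t : ℝ) x, HasStrictFDerivAt (fun x => x + t • (r x - x))
      (ContinuousLinearMap.id ℝ V + t • A x) x := fun t x =>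
    (hasStrictFDerivAt_id x).add
      (((hr.contDiffAt.hasStrictFDerivAt one_ne_zero).sub (hasStrictFDerivAt_id x)).const_smul t)
  obtain ⟨C, hC⟩ := (isCompact_closedBall (0 : V) R).exists_bound_of_continuousOn hA.continuousOn
  have hC0 : 0 ≤ C := (norm_nonneg _).trans (hC 0 (by simp [hR.le]))
  have hlip : ∀ x ∈ B, ∀ y ∈ B, ‖(r y - y) - (r x - x)‖ ≤ C * ‖y - x‖ := fun x hx y hy =>
    Convex.norm_image_sub_le_of_norm_hasFDerivWithin_le (f := fun x => r x - x) (f' := A)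
      (fun z _ => ((hrd z).hasFDerivAt.sub (hasFDerivAt_id z)).hasFDerivWithinAt)
      hC (convex_closedBall 0 R) hx hy
  have key : ∀ t : ℝ, 0 < t → t < 1 / (C + 1) →
      ∫ x in b, (ContinuousLinearMap.id ℝ V + t • A x).det = MeasureTheory.volume.real b := by
    intro t ht0 ht
    have htC : t * (C + 1) < 1 := by rwa [lt_div_iff₀ (by linarith)] at ht
    have ht1 : t < 1 := by nlinarith
    have htC' : t * C < 1 := by nlinarith
    set f : V → V := fun x => x + t • (r x - x) with hf
    have hinj : Set.InjOn f B := by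
      intro x hx y hy hxy
      have h1 : y - x = -(t • ((r y - y) - (r x - x))) := by
        have : x + t • (r x - x) = y + t • (r y - y) := hxy
        rw [eq_neg_iff_add_eq_zero, ← sub_eq_zero.2 this.symm]
        module
      have h2 : ‖y - x‖ ≤ t * (C * ‖y - x‖) := by
        calc ‖y - x‖ = t * ‖(r y - y) - (r x - x)‖ := by
              conv_lhs => rw [h1]
              rw [norm_neg, norm_smul, Real.norm_of_nonneg ht0.le]
          _ ≤ _ := by gcongr; exact hlip x hx y hy
      have h3 : ‖y - x‖ = 0 := by
        have := norm_nonneg (y - x)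
        nlinarith
      exact (sub_eq_zero.1 (norm_eq_zero.1 h3)).symm
    have hunit : ∀ x ∈ B, ∀ s ∈ Set.Icc (0 : ℝ) t,
        IsUnit (ContinuousLinearMap.id ℝ V + s • A x) := by
      intro x hx s hs
      have : IsUnit (1 - (-(s • A x))) := by
        apply isUnit_one_sub_of_norm_lt_one
        rw [norm_neg, norm_smul, Real.norm_of_nonneg hs.1]
        calc s * ‖A x‖ ≤ t * C := by gcongr; exacts [hs.2, hC x hx]
          _ < 1 := htC'
      rwa [sub_neg_eq_add] at this
    have hdetne : ∀ x ∈ B, ∀ s ∈ Set.Icc (0 : ℝ) t,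
        (ContinuousLinearMap.id ℝ V + s • A x).det ≠ 0 := by
      intro x hx s hs
      have h1 := (hunit x hx s hs).map (ContinuousLinearMap.toLinearMapRingHom (R₁ := ℝ) (M₁ := V))
      have h2 := LinearMap.isUnit_det _ h1
      exact h2.ne_zero
    have hdetpos : ∀ x ∈ B, 0 < (ContinuousLinearMap.id ℝ V + t • A x).det := by
      intro x hx
      by_contra! hneg
      have hcont : ContinuousOn (fun s : ℝ => (ContinuousLinearMap.id ℝ V + s • A x).det)
          (Set.Icc 0 t) := by
        apply Continuous.continuousOn
        exact ContinuousLinearMap.continuous_det.comp (by fun_prop)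
      obtain ⟨s, hs, hs0⟩ := intermediate_value_Icc' ht0.le hcont
        (show (0 : ℝ) ∈ Set.Icc _ _ from ⟨hneg, by simp [ContinuousLinearMap.det]⟩)
      exact hdetne x hx s hs hs0
    have hmaps : ∀ x ∈ b, f x ∈ b := by
      intro x hx
      rw [mem_ball_zero_iff] at hx ⊢
      have : f x = (1 - t) • x + t • r x := by simp only [hf]; module
      rw [this]
      calc ‖(1 - t) • x + t • r x‖ ≤ (1 - t) * ‖x‖ + t * ‖r x‖ := by
            refine (norm_add_le _ _).trans ?_
            rw [norm_smul, norm_smul, Real.norm_of_nonneg ht0.le,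
              Real.norm_of_nonneg (by linarith)]
        _ < R := by rw [hnorm]; nlinarith
    have hfc : Continuous f := by
      have := hr.continuous
      fun_prop
    have himage : f '' b = b := by
      have hopen : IsOpen (f '' b) := by
        rw [isOpen_iff_mem_nhds]
        rintro _ ⟨x, hx, rfl⟩
        have hsurj : ((ContinuousLinearMap.id ℝ V + t • A x : V →L[ℝ] V) : V →ₗ[ℝ] V).range = ⊤ :=
          LinearMap.range_eq_top.2 (by
            have := ContinuousLinearMap.isUnit_iff_bijective.1
              (hunit x (Metric.ball_subset_closedBall hx) t ⟨ht0.le, le_rfl⟩)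
            exact this.2)
        rw [← (hder t x).map_nhds_eq_of_surj hsurj]
        exact Filter.image_mem_map (Metric.isOpen_ball.mem_nhds hx)
      apply Set.Subset.antisymm
      · rintro _ ⟨x, hx, rfl⟩
        exact hmaps x hx
      · have hpre : IsPreconnected b := (convex_ball (0 : V) R).isPreconnected
        refine hpre.subset_of_closure_inter_subset hopen
          ⟨f 0, hmaps 0 (by simp [b, hR]), 0, by simp [b, hR], rfl⟩ ?_
        rintro y ⟨hy, hyb⟩
        have hcl : IsClosed (f '' B) := ((isCompact_closedBall 0 R).image hfc).isClosed
        have : y ∈ f '' B :=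
          closure_minimal (Set.image_mono Metric.ball_subset_closedBall) hcl hy
        obtain ⟨x, hx, rfl⟩ := this
        refine ⟨x, ?_, rfl⟩
        rcases (mem_closedBall_zero_iff.1 hx).lt_or_eq with h | h
        · exact mem_ball_zero_iff.2 h
        · exfalso
          have : f x = x := by simp [hf, hid x h]
          rw [this, mem_ball_zero_iff] at hyb
          exact hyb.ne h
    have hintegral := MeasureTheory.integral_image_eq_integral_abs_det_fderiv_smul
      MeasureTheory.volume (s := b) Metric.isOpen_ball.measurableSet
      (fun x _ => (hder t x).hasFDerivAt.hasFDerivWithinAt)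
      (hinj.mono Metric.ball_subset_closedBall) (fun _ => (1 : ℝ))
    have himage' : (fun x => x + t • (r x - x)) '' b = b := himage
    rw [himage'] at hintegral
    simp only [MeasureTheory.integral_const, smul_eq_mul, mul_one,
      MeasureTheory.measureReal_restrict_apply_univ] at hintegral
    rw [hintegral]
    refine MeasureTheory.setIntegral_congr_fun Metric.isOpen_ball.measurableSet fun x hx => ?_
    exact (abs_of_pos (hdetpos x (Metric.ball_subset_closedBall hx))).symm
  obtain ⟨T, w, hT, hw⟩ := Polynomial.exists_extrapolation (Module.finrank ℝ V)
    (show (0 : ℝ) < 1 / (C + 1) by positivity)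
  have hw1 : ∑ t ∈ T, w t = 1 := by
    have := hw 1 (by simp)
    simpa using this.symm
  have hdet1 : ∀ x, (ContinuousLinearMap.id ℝ V + (1 : ℝ) • A x).det = 0 := by
    intro x
    have h1 : ContinuousLinearMap.id ℝ V + (1 : ℝ) • A x = fderiv ℝ r x := by
      simp [hAdef]
    rw [h1]
    by_contra hne
    have hsurj : Function.Surjective (fderiv ℝ r x) := by
      have := (LinearMap.equivOfDetNeZero (fderiv ℝ r x : V →ₗ[ℝ] V) hne).surjective
      exact this
    obtain ⟨v, hv⟩ := hsurj (r x)
    have hconst : HasFDerivAt (fun y => ⟪r y, r y⟫) (0 : V →L[ℝ] ℝ) x := by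
      have : (fun y => ⟪r y, r y⟫) = fun _ => R ^ 2 := by
        ext y
        rw [real_inner_self_eq_norm_sq, hnorm]
      rw [this]
      exact hasFDerivAt_const _ _
    have h2 := hconst.unique ((hrd x).hasFDerivAt.inner ℝ (hrd x).hasFDerivAt)
    have h3 := congrArg (fun L : V →L[ℝ] ℝ => L v) h2
    simp [hv, hnorm] at h3
    nlinarith
  have hintble : ∀ t : ℝ, MeasureTheory.IntegrableOn
      (fun x => (ContinuousLinearMap.id ℝ V + t • A x).det) b := by
    intro t
    have hc : Continuous fun x => (ContinuousLinearMap.id ℝ V + t • A x).det :=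
      ContinuousLinearMap.continuous_det.comp (by fun_prop)
    exact (hc.continuousOn.integrableOn_compact (isCompact_closedBall (0 : V) R)).mono_set
      Metric.ball_subset_closedBall
  have hfinal : (0 : ℝ) = MeasureTheory.volume.real b := by
    calc (0 : ℝ) = ∫ x in b, (ContinuousLinearMap.id ℝ V + (1 : ℝ) • A x).det := by
          simp only [hdet1, MeasureTheory.integral_zero]
      _ = ∫ x in b, ∑ t ∈ T, w t * (ContinuousLinearMap.id ℝ V + t • A x).det := by
          congr 1
          ext x
          obtain ⟨P, hP, hPe⟩ :=
            ContinuousLinearMap.exists_polynomial_det (ContinuousLinearMap.id ℝ V) (A x)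
          have := hw P hP
          simpa only [hPe] using this
      _ = ∑ t ∈ T, w t * ∫ x in b, (ContinuousLinearMap.id ℝ V + t • A x).det := by
          rw [MeasureTheory.integral_finsetSum _ fun t _ => (hintble t).const_mul (w t)]
          simp [MeasureTheory.integral_const_mul]
      _ = ∑ t ∈ T, w t * MeasureTheory.volume.real b :=
          Finset.sum_congr rfl fun t ht => by rw [key t (hT t ht).1 (hT t ht).2]
      _ = MeasureTheory.volume.real b := by rw [← Finset.sum_mul, hw1, one_mul]
  have hpos : 0 < MeasureTheory.volume.real b :=
    ENNReal.toReal_pos (Metric.measure_ball_pos _ _ hR).ne' MeasureTheory.measure_ball_lt_top.ne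
  exact hpos.ne hfinal

/-- **Poincaré–Bohl theorem**: a continuous vector field on a ball which points outward along the
boundary has a zero. -/
theorem exists_zero_of_inner_pos {F : V → V} {ε : ℝ} (hε : 0 < ε)
    (hF : ContinuousOn F (Metric.closedBall 0 ε))
    (hpos : ∀ x, ‖x‖ = ε → 0 < ⟪F x, x⟫) : ∃ x ∈ Metric.closedBall 0 ε, F x = 0 := by
  by_contra! hne
  -- extend `F` continuously to the whole space
  obtain ⟨F', hF'⟩ := ContinuousMap.exists_restrict_eq (Y := V)
    (Metric.isClosed_closedBall (x := (0 : V)) (ε := ε)) ⟨_, hF.domRestrict⟩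
  have hFF' : ∀ x ∈ Metric.closedBall (0 : V) ε, F' x = F x := fun x hx => by
    have := congrArg (fun g => g ⟨x, hx⟩) hF'
    simpa using this
  have hcl1 : IsClosed {x : V | ε ≤ ‖x‖} := isClosed_le continuous_const continuous_norm
  have hcl2 : IsClosed {x : V | ‖x‖ ≤ ε ∧ ⟪F' x, x⟫ ≤ 0} :=
    (isClosed_le continuous_norm continuous_const).inter
      (isClosed_le (F'.continuous.inner (𝕜 := ℝ) continuous_id) continuous_const)
  obtain ⟨χ, hχ0, hχ1, hχ⟩ := exists_continuous_zero_one_of_isClosed hcl1 hcl2 (by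
    rw [Set.disjoint_left]
    rintro x hx ⟨hx1, hx2⟩
    have h : ‖x‖ = ε := le_antisymm hx1 hx
    rw [hFF' x (by simpa using hx1)] at hx2
    exact absurd (hpos x h) (not_lt.2 hx2))
  set G : V → V := fun x => χ x • F' x + (1 - χ x) • x with hG
  have hGc : Continuous G := by fun_prop
  have hGid : ∀ x : V, ε ≤ ‖x‖ → G x = x := fun x hx => by
    simp [hG, show χ x = 0 from hχ0 hx]
  have hGne : ∀ x, G x ≠ 0 := by
    intro x
    rcases le_or_gt ε ‖x‖ with hx | hx
    · rw [hGid x hx]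
      exact norm_pos_iff.1 (hε.trans_le hx)
    · have hxB : x ∈ Metric.closedBall (0 : V) ε := by simpa using hx.le
      by_cases h : ⟪F' x, x⟫ ≤ 0
      · have : G x = F x := by
          simp [hG, show χ x = 1 from hχ1 ⟨hx.le, h⟩, hFF' x hxB]
        rw [this]
        exact hne x hxB
      · push Not at h
        intro h0
        have hx0 : x ≠ 0 := by
          rintro rfl
          simp at h
        have h1 : ⟪G x, x⟫ = χ x * ⟪F' x, x⟫ + (1 - χ x) * ‖x‖ ^ 2 := by
          simp [hG, inner_add_left, real_inner_smul_left]
        rw [h0, inner_zero_left] at h1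
        have h2 : 0 < ‖x‖ ^ 2 := by positivity
        have h3 := (hχ x).1
        have h4 := (hχ x).2
        rcases h3.eq_or_lt with h5 | h5
        · rw [← h5] at h1
          nlinarith
        · nlinarith [mul_pos h5 h, mul_nonneg (sub_nonneg.2 h4) h2.le]
  obtain ⟨g, hg, hgd, hgeq, -⟩ := hGc.exists_contDiff_approx_and_eqOn 1
    (ε := fun x => ‖G x‖) hGc.norm (fun x => norm_pos_iff.2 (hGne x))
    (S := {x : V | 2 * ε ≤ ‖x‖}) (U := {x : V | ε < ‖x‖})
    (isClosed_le continuous_const continuous_norm)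
    ((isOpen_lt continuous_const continuous_norm).mem_nhdsSet.2 fun x hx => by
      simp only [Set.mem_ofPred_eq] at hx ⊢
      linarith)
    (contDiffOn_id.congr fun x hx => hGid x (le_of_lt hx))
  have hgne : ∀ x, g x ≠ 0 := fun x h => by
    have := hgd x
    rw [h, dist_zero_left] at this
    exact lt_irrefl _ this
  refine no_smooth_retraction (r := fun x => (2 * ε * ‖g x‖⁻¹) • g x) (R := 2 * ε) ?_
    (by positivity) (fun x => ?_) (fun x hx => ?_)
  · have h1 : ContDiff ℝ 1 g := by exact_mod_cast hg
    exact (contDiff_const.mul ((h1.norm ℝ hgne).inv fun x => norm_ne_zero_iff.2 (hgne x))).smul h1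
  · have := norm_ne_zero_iff.2 (hgne x)
    rw [norm_smul, norm_mul, norm_inv, norm_norm, Real.norm_of_nonneg (by positivity)]
    field_simp
  · have h1 : g x = x := by rw [hgeq (show 2 * ε ≤ ‖x‖ from hx.ge), hGid x (by linarith)]
    simp only [h1, hx]
    rw [mul_inv_cancel₀ (by positivity), one_smul]

end

/-- A `C¹` map on an open set does not raise the dimension. -/
lemma ContDiffOn.dimH_image_le_finrank {A B : Type*} [NormedAddCommGroup A] [NormedSpace ℝ A]
    [FiniteDimensional ℝ A] [NormedAddCommGroup B] [NormedSpace ℝ B] {f : A → B} {s : Set A}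
    (hs : IsOpen s) (hf : ContDiffOn ℝ 1 f s) : dimH (f '' s) ≤ Module.finrank ℝ A := by
  calc dimH (f '' s) ≤ dimH s := dimH_image_le_of_locally_lipschitzOn fun x hx => by
        obtain ⟨K, t, ht, h⟩ := (hf.contDiffAt (hs.mem_nhds hx)).exists_lipschitzOnWith
        exact ⟨K, t, mem_nhdsWithin_of_mem_nhds ht, h⟩
    _ ≤ dimH (Set.univ : Set A) := dimH_mono (Set.subset_univ s)
    _ = Module.finrank ℝ A := Real.dimH_univ_eq_finrank A

section

variable {P N : Type*} [NormedAddCommGroup P] [InnerProductSpace ℝ P]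
  [NormedAddCommGroup N] [InnerProductSpace ℝ N]

/-- `f` is close, to first order at the origin, to the quadratic form `‖u‖² - ‖v‖²`. -/
def NearCone (f : P × N → ℝ) (δ : ℝ) : Prop :=
  f 0 = 0 ∧ ∀ z : P × N, ‖z‖ ≤ δ → ∃ f' : P × N →L[ℝ] ℝ, HasFDerivAt f f' z ∧
    ∀ w : P × N, |f' w - (2 * ⟪z.1, w.1⟫ - 2 * ⟪z.2, w.2⟫)| ≤ 1 / 8 * ‖z‖ * ‖w‖

lemma NearCone.mono {f : P × N → ℝ} {δ δ' : ℝ} (h : NearCone f δ) (hδ : δ' ≤ δ) :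
    NearCone f δ' :=
  ⟨h.1, fun z hz => h.2 z (hz.trans hδ)⟩

lemma NearCone.swap {f : P × N → ℝ} {δ : ℝ} (h : NearCone f δ) :
    NearCone (fun z : N × P => -f z.swap) δ := by
  refine ⟨by simpa using h.1, fun z hz => ?_⟩
  have hz' : ‖z.swap‖ ≤ δ := by simpa [Prod.norm_def, max_comm] using hz
  obtain ⟨f', hf', hb⟩ := h.2 z.swap hz'
  refine ⟨-(f'.comp (ContinuousLinearEquiv.prodComm ℝ N P : N × P →L[ℝ] P × N)), ?_, fun w => ?_⟩
  · exact (HasFDerivAt.comp (g := f) z hf'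
      (ContinuousLinearEquiv.prodComm ℝ N P : N × P →L[ℝ] P × N).hasFDerivAt).neg
  · have := hb w.swap
    have e1 : ‖z.swap‖ = ‖z‖ := by simp [Prod.norm_def, max_comm]
    have e2 : ‖w.swap‖ = ‖w‖ := by simp [Prod.norm_def, max_comm]
    rw [e1, e2, ← abs_neg] at this
    convert this using 2
    simp
    ring

lemma NearCone.abs_sub_le {f : P × N → ℝ} {δ : ℝ} (h : NearCone f δ) {z : P × N} (hz : ‖z‖ ≤ δ) :
    |f z - (‖z.1‖ ^ 2 - ‖z.2‖ ^ 2)| ≤ 1 / 8 * ‖z‖ ^ 2 := by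
  choose! f' hf' hb using h.2
  have hq : ∀ x : P × N, HasFDerivAt (fun z : P × N => ‖z.1‖ ^ 2 - ‖z.2‖ ^ 2)
      ((2 • (innerSL ℝ x.1)).comp (ContinuousLinearMap.fst ℝ P N) -
        (2 • (innerSL ℝ x.2)).comp (ContinuousLinearMap.snd ℝ P N)) x := fun x =>
    ((hasStrictFDerivAt_norm_sq x.1).hasFDerivAt.comp x hasFDerivAt_fst).sub
      ((hasStrictFDerivAt_norm_sq x.2).hasFDerivAt.comp x hasFDerivAt_snd)
  have := Convex.norm_image_sub_le_of_norm_hasFDerivWithin_le (C := 1 / 8 * ‖z‖)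
    (s := Metric.closedBall (0 : P × N) ‖z‖) (x := 0) (y := z)
    (f := fun z : P × N => f z - (‖z.1‖ ^ 2 - ‖z.2‖ ^ 2))
    (fun x hx => ((hf' x ((mem_closedBall_zero_iff.1 hx).trans hz)).sub (hq x)).hasFDerivWithinAt)
    (fun x hx => by
      refine ContinuousLinearMap.opNorm_le_bound _ (by positivity) fun w => ?_
      have h1 := hb x ((mem_closedBall_zero_iff.1 hx).trans hz) w
      have h2 : ‖x‖ ≤ ‖z‖ := mem_closedBall_zero_iff.1 hx
      calc _ = |f' x w - (2 * ⟪x.1, w.1⟫ - 2 * ⟪x.2, w.2⟫)| := by simp [Real.norm_eq_abs]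
        _ ≤ _ := h1
        _ ≤ _ := by gcongr)
    (convex_closedBall _ _) (by simp) (by simp)
  simp only [h.1, Prod.fst_zero, norm_zero, Prod.snd_zero] at this
  calc _ = _ := by rw [Real.norm_eq_abs]; congr 1; ring
    _ ≤ _ := this
    _ = _ := by rw [sub_zero]; ring

lemma NearCone.fst_ne {f : P × N → ℝ} {δ : ℝ} (h : NearCone f δ) {z : P × N} (hz : ‖z‖ ≤ δ)
    (hf : f z = 0) (hz0 : z ≠ 0) : z.1 ≠ 0 := by
  intro h0
  have h1 := h.abs_sub_le hz
  have h2 : ‖z‖ = ‖z.2‖ := by simp [Prod.norm_def, h0]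
  have h3 : 0 < ‖z‖ := norm_pos_iff.2 hz0
  rw [hf, h0, ← h2] at h1
  simp only [norm_zero] at h1
  have := (abs_le.1 h1).2
  nlinarith

lemma NearCone.snd_ne {f : P × N → ℝ} {δ : ℝ} (h : NearCone f δ) {z : P × N} (hz : ‖z‖ ≤ δ)
    (hf : f z = 0) (hz0 : z ≠ 0) : z.2 ≠ 0 := by
  refine h.swap.fst_ne (z := z.swap) (by simpa [Prod.norm_def, max_comm] using hz)
    (by simpa using hf) ?_
  intro h0
  apply hz0
  rw [← Prod.swap_swap z, h0, Prod.swap_zero]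

/-- Over every small sphere in `N` the zero set of `f` has a unique point in direction `u₀`. -/
lemma NearCone.existsUnique {f : P × N → ℝ} {δ : ℝ} (h : NearCone f δ) {u₀ : P} (hu₀ : ‖u₀‖ = 1)
    {ε : ℝ} (hε : 0 < ε) (hεδ : 2 * ε ≤ δ) {v : N} (hv : ‖v‖ = ε) :
    ∃! τ : ℝ, τ ∈ Set.Icc (ε / 2) (2 * ε) ∧ f (τ • u₀, v) = 0 := by
  have hnorm : ∀ τ ∈ Set.Icc (ε / 2) (2 * ε), ‖((τ • u₀, v) : P × N)‖ ≤ 2 * ε := fun τ hτ => by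
    have : 0 ≤ τ := by linarith [hτ.1]
    simp only [Prod.norm_def, norm_smul, hu₀, hv, Real.norm_of_nonneg this]
    exact max_le (by linarith [hτ.2]) (by linarith)
  choose! f' hf' hb using h.2
  have hder : ∀ τ ∈ Set.Icc (ε / 2) (2 * ε),
      HasDerivAt (fun τ : ℝ => f (τ • u₀, v)) (f' (τ • u₀, v) (u₀, 0)) τ := fun τ hτ => by
    have h1 : HasDerivAt (fun τ : ℝ => ((τ • u₀, v) : P × N)) (u₀, 0) τ := by
      have h2 := (hasDerivAt_id τ).smul_const u₀
      rw [one_smul] at h2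
      exact h2.prodMk (hasDerivAt_const τ v)
    exact (hf' _ ((hnorm τ hτ).trans hεδ)).comp_hasDerivAt τ h1
  have hc : ContinuousOn (fun τ : ℝ => f (τ • u₀, v)) (Set.Icc (ε / 2) (2 * ε)) :=
    fun τ hτ => (hder τ hτ).continuousAt.continuousWithinAt
  have hmono : StrictMonoOn (fun τ : ℝ => f (τ • u₀, v)) (Set.Icc (ε / 2) (2 * ε)) := by
    refine strictMonoOn_of_hasDerivWithinAt_pos (convex_Icc _ _) hc
      (fun τ hτ => (hder τ (interior_subset hτ)).hasDerivWithinAt) fun τ hτ => ?_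
    have hτ' := interior_subset hτ
    have h1 := hb (τ • u₀, v) ((hnorm τ hτ').trans hεδ) (u₀, 0)
    have h2 := hnorm τ hτ'
    have h3 : ‖((u₀, 0) : P × N)‖ = 1 := by simp [hu₀]
    rw [h3] at h1
    simp only [real_inner_smul_left, real_inner_self_eq_norm_sq, hu₀, inner_zero_right] at h1
    have := (abs_le.1 h1).1
    linarith [hτ'.1]
  have h1 : f ((ε / 2) • u₀, v) < 0 := by
    have h2 := h.abs_sub_le ((hnorm (ε / 2) ⟨le_rfl, by linarith⟩).trans hεδ)
    have h3 : ‖(((ε / 2) • u₀, v) : P × N)‖ = ε := by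
      simp only [Prod.norm_def, norm_smul, hu₀, hv, Real.norm_of_nonneg (half_pos hε).le]
      exact max_eq_right (by linarith)
    rw [h3] at h2
    simp only [norm_smul, hu₀, hv, Real.norm_of_nonneg (half_pos hε).le] at h2
    have := (abs_le.1 h2).2
    nlinarith
  have h2 : 0 < f ((2 * ε) • u₀, v) := by
    have h2 := h.abs_sub_le ((hnorm (2 * ε) ⟨by linarith, le_rfl⟩).trans hεδ)
    have h3 : ‖(((2 * ε) • u₀, v) : P × N)‖ = 2 * ε := by
      simp only [Prod.norm_def, norm_smul, hu₀, hv,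
        Real.norm_of_nonneg (mul_pos two_pos hε).le]
      exact (max_eq_left (by linarith)).trans (mul_one _)
    rw [h3] at h2
    simp only [norm_smul, hu₀, hv, Real.norm_of_nonneg (mul_pos two_pos hε).le] at h2
    have := (abs_le.1 h2).1
    nlinarith
  obtain ⟨τ, hτ, h0⟩ := intermediate_value_Icc (by linarith) hc
    (show (0 : ℝ) ∈ Set.Icc _ _ from ⟨h1.le, h2.le⟩)
  exact ⟨τ, ⟨hτ, h0⟩, fun τ' h' => hmono.injOn h'.1 hτ (h'.2.trans h0.symm)⟩

/-- A continuous section of the projection of the zero set of `f` over a small sphere. -/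
lemma NearCone.exists_section [FiniteDimensional ℝ N] {f : P × N → ℝ} {δ : ℝ} (h : NearCone f δ)
    {u₀ : P} (hu₀ : ‖u₀‖ = 1) {ε : ℝ} (hε : 0 < ε) (hεδ : 2 * ε ≤ δ) :
    ∃ s : N → P × N, ContinuousOn s (Metric.sphere 0 ε) ∧
      ∀ v, ‖v‖ = ε → f (s v) = 0 ∧ (s v).2 = v ∧ ‖s v‖ ≤ 2 * ε := by
  choose! τ hτ hτu using fun v (hv : ‖v‖ = ε) => h.existsUnique hu₀ hε hεδ hv
  have hnorm : ∀ t ∈ Set.Icc (ε / 2) (2 * ε), ∀ v, ‖v‖ = ε → ‖((t • u₀, v) : P × N)‖ ≤ 2 * ε :=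
    fun t ht v hv => by
    have : 0 ≤ t := by linarith [ht.1]
    simp only [Prod.norm_def, norm_smul, hu₀, hv, Real.norm_of_nonneg this]
    exact max_le (by linarith [ht.2]) (by linarith)
  refine ⟨fun v => (τ v • u₀, v), ?_, fun v hv => ⟨(hτ v hv).2, rfl, hnorm _ (hτ v hv).1 v hv⟩⟩
  suffices hτc : ContinuousOn τ (Metric.sphere 0 ε) from
    (hτc.smul continuousOn_const).prodMk continuousOn_id
  intro v hv
  have hv' : ‖v‖ = ε := by simpa using hv
  -- cluster points of `τ` at `v` are zeros of `f` over `v`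
  have hmem : ∀ᶠ w in nhdsWithin v (Metric.sphere 0 ε), τ w ∈ Set.Icc (ε / 2) (2 * ε) :=
    eventually_mem_nhdsWithin.mono fun w hw => (hτ w (by simpa using hw)).1
  refine isCompact_Icc.tendsto_nhds_of_unique_mapClusterPt hmem fun t ht hcl => ?_
  refine hτu v hv' t ⟨ht, ?_⟩
  have hfc : ContinuousAt f (t • u₀, v) := by
    obtain ⟨f', hf', -⟩ := h.2 _ ((hnorm t ht v hv').trans hεδ)
    exact hf'.continuousAt
  obtain ⟨U, hUle, hU⟩ := mapClusterPt_iff_ultrafilter.1 hcl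
  have hUv : Filter.Tendsto id (U : Filter N) (nhds v) := hUle.trans nhdsWithin_le_nhds
  have h1 : Filter.Tendsto (fun w => f (τ w • u₀, w)) U (nhds (f (t • u₀, v))) :=
    hfc.tendsto.comp ((hU.smul_const u₀).prodMk_nhds hUv)
  have h2 : Filter.Tendsto (fun w => f (τ w • u₀, w)) U (nhds 0) :=
    tendsto_const_nhds.congr' ((Filter.Eventually.filter_mono hUle eventually_mem_nhdsWithin).mono fun w hw =>
      ((hτ w (by simpa using hw)).2).symm)
  exact tendsto_nhds_unique h1 h2

end

/-- A generic vector is not a positive multiple of a value of `G` on the sphere. -/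
lemma exists_not_mem_cone {N D : Type*} [NormedAddCommGroup N] [InnerProductSpace ℝ N]
    [FiniteDimensional ℝ N] [NormedAddCommGroup D] [NormedSpace ℝ D] [FiniteDimensional ℝ D]
    (hdim : Module.finrank ℝ N < Module.finrank ℝ D) {G : N → D} (hG : ContDiff ℝ 1 G)
    (ε : ℝ) {ρ : ℝ} (hρ : 0 < ρ) :
    ∃ c : D, c ≠ 0 ∧ ‖c‖ < ρ ∧ ∀ t : ℝ, 0 < t → ∀ v : N, v ≠ 0 → c ≠ t • G ((ε / ‖v‖) • v) := by
  have : Nontrivial D := Module.nontrivial_of_finrank_pos (R := ℝ) (by omega)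
  let Φ : N → D := fun v => ‖v‖ • G ((ε / ‖v‖) • v)
  have hopen : IsOpen ({0}ᶜ : Set N) := isOpen_compl_singleton
  have hn : ContDiffOn ℝ 1 (fun v : N => ‖v‖) {0}ᶜ := fun v hv =>
    (contDiffAt_norm ℝ hv).contDiffWithinAt
  have hΦ : ContDiffOn ℝ 1 Φ {0}ᶜ :=
    hn.smul (hG.comp_contDiffOn
      ((contDiffOn_const.div hn fun v hv => norm_ne_zero_iff.2 hv).smul contDiffOn_id))
  have hdense : Dense (Φ '' {0}ᶜ)ᶜ := dense_compl_of_dimH_lt_finrank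
    ((hΦ.dimH_image_le_finrank hopen).trans_lt (by exact_mod_cast hdim))
  obtain ⟨x₀, hx₀⟩ := exists_norm_eq D (show 0 ≤ ρ / 2 by positivity)
  obtain ⟨c, hc, hcΦ⟩ := hdense.inter_open_nonempty (Metric.ball 0 ρ ∩ {0}ᶜ)
    (Metric.isOpen_ball.inter isOpen_compl_singleton)
    ⟨x₀, by simp [hx₀, hρ], by
      intro h
      rw [Set.mem_singleton_iff.1 h, norm_zero] at hx₀
      linarith⟩
  refine ⟨c, hc.2, by simpa using hc.1, fun t ht v hv h => hcΦ ?_⟩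
  have hv' : 0 < ‖v‖ := norm_pos_iff.2 hv
  refine ⟨(t / ‖v‖) • v, smul_ne_zero (by positivity) hv, ?_⟩
  have h1 : ‖(t / ‖v‖) • v‖ = t := by
    rw [norm_smul, Real.norm_of_nonneg (by positivity)]
    field_simp
  simp only [Φ, h1, smul_smul, h]
  congr 3
  field_simp

/-- Near the origin `e` parametrizes the zero set of `f`, with inverse `e'`. -/
structure LocalParam {D X : Type*} [TopologicalSpace D] [Zero D]
    [TopologicalSpace X] [Zero X] (f : X → ℝ)
    (e : D → X) (e' : X → D) : Prop where
  map_zero : e 0 = 0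
  map_zero' : e' 0 = 0
  cont : ∀ᶠ w in nhds (0 : D), ContinuousAt e w
  zero : ∀ᶠ w in nhds (0 : D), f (e w) = 0
  left : ∀ᶠ w in nhds (0 : D), e' (e w) = w
  cont' : ∀ᶠ z in nhds (0 : X), f z = 0 → ContinuousWithinAt e' {z | f z = 0} z
  right : ∀ᶠ z in nhds (0 : X), f z = 0 → e (e' z) = z

/-- The concrete form of `LocalParam` on balls. -/
lemma LocalParam.exists_radii {P N D : Type*} [NormedAddCommGroup P] [NormedAddCommGroup N]
    [NormedAddCommGroup D] {f : P × N → ℝ} {e : D → P × N} {e' : P × N → D}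
    {δ : ℝ} (hδ : 0 < δ) (hf : f 0 = 0) (he : LocalParam f e e') :
    ∃ ρ > 0, (∀ w, ‖w‖ ≤ ρ → ContinuousAt e w ∧ f (e w) = 0 ∧ e' (e w) = w ∧ ‖e w‖ ≤ δ) ∧
      ∃ δ' > 0, δ' ≤ δ ∧ ∀ z, ‖z‖ ≤ δ' → f z = 0 →
        ContinuousWithinAt e' {z | f z = 0} z ∧ e (e' z) = z ∧ ‖e' z‖ < ρ / 4 := by
  have hsmall : ∀ᶠ w in nhds (0 : D), ‖e w‖ ≤ δ := by
    have h1 : ContinuousAt e 0 := he.cont.self_of_nhds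
    have h2 := h1.norm
    rw [ContinuousAt, he.map_zero, norm_zero] at h2
    exact (h2.eventually (gt_mem_nhds hδ)).mono fun w hw => le_of_lt hw
  obtain ⟨ρ, hρ, h⟩ := Metric.nhds_basis_closedBall.eventually_iff.1
    (he.cont.and (he.zero.and (he.left.and hsmall)))
  have hsmall' : ∀ᶠ z in nhds (0 : P × N), f z = 0 → ‖e' z‖ < ρ / 4 := by
    have h1 := (he.cont'.self_of_nhds hf).norm
    rw [ContinuousWithinAt, he.map_zero', norm_zero] at h1
    exact eventually_nhdsWithin_iff.1 (h1.eventually (gt_mem_nhds (show 0 < ρ / 4 by positivity)))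
  obtain ⟨δ', hδ', h'⟩ := Metric.nhds_basis_closedBall.eventually_iff.1
    (he.cont'.and (he.right.and hsmall'))
  refine ⟨ρ, hρ, fun w hw => h (by simpa using hw), min δ' δ, lt_min hδ' hδ, min_le_right _ _,
    fun z hz hz0 => ?_⟩
  have := h' (x := z) (by simpa using hz.trans (min_le_left _ _))
  exact ⟨this.1 hz0, this.2.1 hz0, this.2.2 hz0⟩

section

variable {P N D : Type*} [NormedAddCommGroup P] [InnerProductSpace ℝ P]
  [NormedAddCommGroup N] [InnerProductSpace ℝ N]
  [NormedAddCommGroup D] [NormedSpace ℝ D] [FiniteDimensional ℝ D]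

/-- If the negative part has dimension smaller than `D`, the cone is not parametrized by `D`. -/
lemma NearCone.not_localParam_of_lt [FiniteDimensional ℝ N] [Nontrivial P] {f : P × N → ℝ} {δ : ℝ} (hδ : 0 < δ)
    (h : NearCone f δ) (hdim : Module.finrank ℝ N < Module.finrank ℝ D)
    {e : D → P × N} {e' : P × N → D} : ¬ LocalParam f e e' := by
  intro he
  obtain ⟨ρ, hρ, hball, δ', hδ', hδδ', hball'⟩ := he.exists_radii hδ h.1
  obtain ⟨u₀, hu₀⟩ := exists_norm_eq P zero_le_one
  set ε := δ' / 2 with hεdef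
  have hε : 0 < ε := by positivity
  obtain ⟨s, hsc, hs⟩ := h.exists_section hu₀ hε (by linarith)
  have hs' : ∀ v, ‖v‖ = ε → ‖s v‖ ≤ δ' := fun v hv => (hs v hv).2.2.trans (by linarith)
  -- the section read in the parameter space
  have hhc : ContinuousOn (fun v => e' (s v)) (Metric.sphere 0 ε) := fun v hv => by
    have hv' : ‖v‖ = ε := by simpa using hv
    exact (hball' _ (hs' v hv') (hs v hv').1).1.comp (hsc v hv)
      fun w hw => (hs w (by simpa using hw)).1
  have : TietzeExtension D :=
    TietzeExtension.of_homeo (ContinuousLinearEquiv.ofFinrankEq (𝕜 := ℝ) (E := D)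
      (F := Fin (Module.finrank ℝ D) → ℝ) (by simp)).toHomeomorph
  obtain ⟨g, hg⟩ := ContinuousMap.exists_restrict_eq (Y := D)
    (Metric.isClosed_sphere (x := (0 : N)) (ε := ε)) ⟨_, hhc.domRestrict⟩
  have hgs : ∀ v, ‖v‖ = ε → g v = e' (s v) := fun v hv => by
    have := congrArg (fun k => k ⟨v, by simpa using hv⟩) hg
    simpa using this
  have heu : UniformContinuousOn e (Metric.closedBall 0 (ρ / 2)) :=
    (isCompact_closedBall _ _).uniformContinuousOn_of_continuous fun w hw =>
      (hball w (by have := mem_closedBall_zero_iff.1 hw; linarith)).1.continuousWithinAt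
  obtain ⟨η, hη, heη⟩ := Metric.uniformContinuousOn_iff.1 heu (ε / 2) (by positivity)
  obtain ⟨G, hG, hGg, -⟩ := g.continuous.exists_contDiff_approx 1
    (ε := fun _ => min η (ρ / 4)) continuous_const (fun _ => lt_min hη (by positivity))
  have hG1 : ContDiff ℝ 1 G := by exact_mod_cast hG
  have hgb : ∀ v, ‖v‖ = ε → ‖g v‖ < ρ / 4 := fun v hv => by
    rw [hgs v hv]
    exact (hball' _ (hs' v hv) (hs v hv).1).2.2
  have hGb : ∀ v, ‖v‖ = ε → ‖G v‖ < ρ / 2 := fun v hv => by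
    have h1 := (hGg v).trans_le (min_le_right _ _)
    rw [dist_eq_norm] at h1
    have h2 := norm_add_le (G v - g v) (g v)
    rw [sub_add_cancel] at h2
    linarith [hgb v hv]
  have hGs : ∀ v, ‖v‖ = ε → ‖(e (G v)).2 - v‖ < ε / 2 := fun v hv => by
    have h1 := heη (G v) (by simpa using (hGb v hv).le) (g v)
      (by have := hgb v hv; simp only [mem_closedBall_zero_iff]; linarith)
      ((hGg v).trans_le (min_le_left _ _))
    rw [hgs v hv, (hball' _ (hs' v hv) (hs v hv).1).2.1, dist_eq_norm] at h1
    have h2 := (norm_snd_le (e (G v) - s v)).trans_lt h1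
    rwa [Prod.snd_sub, (hs v hv).2.1] at h2
  obtain ⟨c, hc0, hcρ, hc⟩ := exists_not_mem_cone hdim hG1 ε (half_pos hρ)
  -- a nowhere zero extension of `G` from the sphere to the ball
  let H : N → D := fun v => (‖v‖ / ε) • G ((ε / ‖v‖) • v) - (1 - ‖v‖ / ε) • c
  have hproj : ∀ v : N, v ≠ 0 → ‖(ε / ‖v‖) • v‖ = ε := fun v hv => by
    have : 0 < ‖v‖ := norm_pos_iff.2 hv
    rw [norm_smul, Real.norm_of_nonneg (by positivity)]
    field_simp
  have hterm : Continuous fun v : N => (‖v‖ / ε) • G ((ε / ‖v‖) • v) := by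
    rw [continuous_iff_continuousAt]
    intro v
    by_cases hv : v = 0
    · subst hv
      have h1 : Filter.Tendsto (fun v : N => ‖v‖ / ε * (ρ / 2)) (nhds 0) (nhds 0) := by
        have : Continuous fun v : N => ‖v‖ / ε * (ρ / 2) := by fun_prop
        simpa using this.tendsto 0
      rw [ContinuousAt]
      simp only [norm_zero, zero_div, zero_smul]
      refine squeeze_zero_norm (fun v => ?_) h1
      by_cases hv : v = 0
      · simp [hv]
      · rw [norm_smul, Real.norm_of_nonneg (by positivity)]
        gcongr
        exact (hGb _ (hproj v hv)).le
    · have hn : ‖v‖ ≠ 0 := norm_ne_zero_iff.2 hv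
      have h1 : ContinuousAt (fun v : N => (ε / ‖v‖) • v) v :=
        (continuousAt_const.div continuous_norm.continuousAt hn).smul continuousAt_id
      exact (continuous_norm.continuousAt.div_const ε).smul
        (ContinuousAt.comp (g := G) hG.continuous.continuousAt h1)
  have hHc : Continuous H := by
    have : Continuous fun v : N => (1 - ‖v‖ / ε) • c := by fun_prop
    exact hterm.sub this
  have hHb : ∀ v, ‖v‖ ≤ ε → ‖H v‖ ≤ ρ / 2 := fun v hv => by
    have hr : ‖v‖ / ε ≤ 1 := (div_le_one hε).2 hv
    have hr0 : 0 ≤ ‖v‖ / ε := by positivity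
    have h1 : ‖(‖v‖ / ε) • G ((ε / ‖v‖) • v)‖ ≤ ‖v‖ / ε * (ρ / 2) := by
      by_cases hv0 : v = 0
      · simp [hv0]
      · rw [norm_smul, Real.norm_of_nonneg hr0]
        gcongr
        exact (hGb _ (hproj v hv0)).le
    have h2 : ‖(1 - ‖v‖ / ε) • c‖ ≤ (1 - ‖v‖ / ε) * (ρ / 2) := by
      rw [norm_smul, Real.norm_of_nonneg (by linarith)]
      exact mul_le_mul_of_nonneg_left hcρ.le (by linarith)
    calc ‖H v‖ ≤ _ := norm_sub_le _ _
      _ ≤ _ := add_le_add h1 h2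
      _ = ρ / 2 := by ring
  have hH0 : ∀ v, ‖v‖ < ε → H v ≠ 0 := fun v hv h0 => by
    by_cases hv0 : v = 0
    · simp only [H, hv0, norm_zero, zero_div, zero_smul, sub_zero, one_smul, zero_sub,
        neg_eq_zero] at h0
      exact hc0 h0
    · have hp : 0 < ‖v‖ := norm_pos_iff.2 hv0
      have hr : ‖v‖ / ε < 1 := (div_lt_one hε).2 hv
      have hr' : 0 < 1 - ‖v‖ / ε := by linarith
      refine hc ((1 - ‖v‖ / ε)⁻¹ * (‖v‖ / ε)) (by positivity) v hv0 ?_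
      rw [mul_smul, eq_inv_smul_iff₀ hr'.ne']
      exact (sub_eq_zero.1 h0).symm
  obtain ⟨v, hv, hv0⟩ := exists_zero_of_inner_pos (F := fun v => (e (H v)).2) hε
    (fun v hv => by
      have hv' := mem_closedBall_zero_iff.1 hv
      have h1 := (hball (H v) ((hHb v hv').trans (by linarith))).1
      exact (continuous_snd.continuousAt.comp
        (ContinuousAt.comp (f := H) h1 hHc.continuousAt)).continuousWithinAt)
    (fun v hv => by
      have hv0 : v ≠ 0 := by
        rintro rfl
        simp only [norm_zero] at hv
        linarith
      have h1 : H v = G v := by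
        simp [H, hv, hε.ne']
      have h2 := hGs v hv
      simp only [h1]
      have h3 : ⟪(e (G v)).2, v⟫ = ⟪(e (G v)).2 - v, v⟫ + ‖v‖ ^ 2 := by
        rw [inner_sub_left, real_inner_self_eq_norm_sq]
        ring
      have h4 := (abs_le.1 (abs_real_inner_le_norm ((e (G v)).2 - v) v)).1
      rw [h3]
      rw [hv] at h4 ⊢
      nlinarith)
  have hv' := mem_closedBall_zero_iff.1 hv
  obtain ⟨-, hw1, hw2, hw3⟩ := hball (H v) ((hHb v hv').trans (by linarith))
  by_cases hz : e (H v) = 0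
  · have hHv : H v = 0 := by rw [← hw2, hz, he.map_zero']
    rcases hv'.lt_or_eq with h1 | h1
    · exact hH0 v h1 hHv
    · have h2 := hGs v h1
      have h3 : H v = G v := by simp [H, h1, hε.ne']
      rw [← h3, hv0, zero_sub, norm_neg, h1] at h2
      linarith
  · exact h.snd_ne hw3 hw1 hz hv0

/-- The cone over two points and two points is not parametrized by a line. -/
lemma NearCone.not_localParam_of_one {f : P × N → ℝ} {δ : ℝ} (hδ : 0 < δ)
    (h : NearCone f δ) (hP : Module.finrank ℝ P = 1) (hN : Module.finrank ℝ N = 1)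
    (hD : Module.finrank ℝ D = 1)
    {e : D → P × N} {e' : P × N → D} : ¬ LocalParam f e e' := by
  intro he
  obtain ⟨ρ, hρ, hball, δ', hδ', hδδ', hball'⟩ := he.exists_radii hδ h.1
  have : Nontrivial P := Module.nontrivial_of_finrank_pos (R := ℝ) (by omega)
  have : Nontrivial N := Module.nontrivial_of_finrank_pos (R := ℝ) (by omega)
  obtain ⟨u₀, hu₀⟩ := exists_norm_eq P zero_le_one
  obtain ⟨v₀, hv₀⟩ := exists_norm_eq N zero_le_one
  let L : D ≃L[ℝ] ℝ := ContinuousLinearEquiv.ofFinrankEq (by simp [hD])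
  set ε := δ' / 2 with hεdef
  have hε : 0 < ε := by positivity
  have hPne : ∀ u : P, u ≠ 0 → ⟪u₀, u⟫ ≠ 0 := fun u hu => by
    obtain ⟨t, rfl⟩ := exists_smul_eq_of_finrank_eq_one hP (x := u₀)
      (by rw [← norm_ne_zero_iff, hu₀]; exact one_ne_zero) u
    rw [real_inner_smul_right, real_inner_self_eq_norm_sq, hu₀]
    intro h0
    apply hu
    simp at h0
    simp [h0]
  have hNne : ∀ u : N, u ≠ 0 → ⟪v₀, u⟫ ≠ 0 := fun u hu => by
    obtain ⟨t, rfl⟩ := exists_smul_eq_of_finrank_eq_one hN (x := v₀)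
      (by rw [← norm_ne_zero_iff, hv₀]; exact one_ne_zero) u
    rw [real_inner_smul_right, real_inner_self_eq_norm_sq, hv₀]
    intro h0
    apply hu
    simp at h0
    simp [h0]
  have hsame : ∀ g : P × N → ℝ, Continuous g → (∀ z, z ≠ 0 → ‖z‖ ≤ δ → f z = 0 → g z ≠ 0) →
      ∀ w₁ w₂, ‖w₁‖ < ρ → ‖w₂‖ < ρ → 0 < L w₁ * L w₂ → 0 < g (e w₁) * g (e w₂) := by
    intro g hg hg0 w₁ w₂ h1 h2 hL
    let γ : ℝ → D := fun t => w₁ + t • (w₂ - w₁)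
    have hγc : Continuous γ := by fun_prop
    have hγb : ∀ t ∈ Set.Icc (0 : ℝ) 1, ‖γ t‖ ≤ ρ := fun t ht => by
      have : γ t = (1 - t) • w₁ + t • w₂ := by simp only [γ]; module
      rw [this]
      refine (norm_add_le _ _).trans ?_
      rw [norm_smul, norm_smul, Real.norm_of_nonneg ht.1,
        Real.norm_of_nonneg (sub_nonneg.2 ht.2)]
      nlinarith [ht.1, ht.2]
    have hγ0 : ∀ t ∈ Set.Icc (0 : ℝ) 1, γ t ≠ 0 := fun t ht h0 => by
      have h3 := congrArg L h0
      simp only [γ, map_add, map_smul, map_sub, smul_eq_mul, map_zero] at h3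
      have h4 : (1 - t) * (L w₁ * L w₁) + t * (L w₁ * L w₂) = 0 := by linear_combination L w₁ * h3
      have h5 : 0 < L w₁ * L w₁ := mul_self_pos.2 fun h => by simp [h] at hL
      rcases ht.1.eq_or_lt with h6 | h6
      · rw [← h6] at h4
        linarith
      · nlinarith [mul_pos h6 hL, mul_nonneg (sub_nonneg.2 ht.2) h5.le]
    have hc : ContinuousOn (fun t => g (e (γ t))) (Set.Icc 0 1) := fun t ht =>
      (hg.continuousAt.comp (ContinuousAt.comp (f := γ) (hball _ (hγb t ht)).1
        hγc.continuousAt)).continuousWithinAt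
    have hne : ∀ t ∈ Set.Icc (0 : ℝ) 1, g (e (γ t)) ≠ 0 := fun t ht => by
      obtain ⟨-, h3, h4, h5⟩ := hball _ (hγb t ht)
      refine hg0 _ (fun h0 => hγ0 t ht ?_) h5 h3
      rw [← h4, h0, he.map_zero']
    have e0 : γ 0 = w₁ := by simp [γ]
    have e1 : γ 1 = w₂ := by simp [γ]
    by_contra! hle
    have hmem : (0 : ℝ) ∈ Set.uIcc (g (e (γ 0))) (g (e (γ 1))) := by
      rw [e0, e1, Set.mem_uIcc]
      rcases mul_nonpos_iff.1 hle with h | h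
      · exact Or.inr ⟨h.2, h.1⟩
      · exact Or.inl ⟨h.1, h.2⟩
    obtain ⟨t, ht, ht0⟩ := intermediate_value_uIcc (a := (0 : ℝ)) (b := 1)
      (f := fun t => g (e (γ t))) (by rwa [Set.uIcc_of_le zero_le_one]) hmem
    rw [Set.uIcc_of_le zero_le_one] at ht
    exact hne t ht ht0
  -- points of the zero set with prescribed signs
  have hpt : ∀ a b : ℝ, |a| = 1 → |b| = 1 → ∃ w : D, ‖w‖ < ρ ∧ L w ≠ 0 ∧
      0 < a * ⟪u₀, (e w).1⟫ ∧ 0 < b * ⟪v₀, (e w).2⟫ := by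
    intro a b ha hb
    have hn : ‖a • u₀‖ = 1 := by rw [norm_smul, hu₀, Real.norm_eq_abs, ha, one_mul]
    have ha2 : a * a = 1 := by rw [← abs_mul_abs_self, ha, one_mul]
    have hb2 : b * b = 1 := by rw [← abs_mul_abs_self, hb, one_mul]
    have hv : ‖(ε * b) • v₀‖ = ε := by
      rw [norm_smul, hv₀, Real.norm_eq_abs, abs_mul, hb, abs_of_pos hε]
      ring
    obtain ⟨τ, ⟨hτ, hτ0⟩, -⟩ := h.existsUnique hn hε (by linarith) hv
    have hτp : 0 < τ := by linarith [hτ.1]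
    set z : P × N := (τ • a • u₀, (ε * b) • v₀) with hz
    have hzn : ‖z‖ ≤ δ' := by
      simp only [hz, Prod.norm_def, hv]
      rw [norm_smul, hn, Real.norm_of_nonneg hτp.le]
      exact max_le (by linarith [hτ.2]) (by linarith)
    obtain ⟨-, h1, h2⟩ := hball' z hzn hτ0
    refine ⟨e' z, by linarith, ?_, ?_, ?_⟩
    · intro h0
      have h3 : e' z = 0 := by simpa using h0
      rw [h3, he.map_zero] at h1
      have h4 : z.2 = 0 := by rw [← h1]; rfl
      have h5 : ‖z.2‖ = ε := hv
      rw [h4, norm_zero] at h5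
      exact hε.ne h5
    · rw [h1]
      simp only [hz, real_inner_smul_right, real_inner_self_eq_norm_sq, hu₀]
      nlinarith
    · rw [h1]
      simp only [hz, real_inner_smul_right, real_inner_self_eq_norm_sq, hv₀]
      nlinarith
  have hfst := hsame (fun z => ⟪u₀, z.1⟫) (by fun_prop)
    fun z hz hzδ hz0 => hPne _ (h.fst_ne hzδ hz0 hz)
  have hsnd := hsame (fun z => ⟪v₀, z.2⟫) (by fun_prop)
    fun z hz hzδ hz0 => hNne _ (h.snd_ne hzδ hz0 hz)
  obtain ⟨w₁, hw₁, hL₁, ha₁, hb₁⟩ := hpt 1 1 (by simp) (by simp)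
  obtain ⟨w₂, hw₂, hL₂, ha₂, hb₂⟩ := hpt 1 (-1) (by simp) (by simp)
  obtain ⟨w₃, hw₃, hL₃, ha₃, hb₃⟩ := hpt (-1) 1 (by simp) (by simp)
  have h12 : ¬ 0 < L w₁ * L w₂ := fun hL => by
    have := hsnd w₁ w₂ hw₁ hw₂ hL
    nlinarith
  have h13 : ¬ 0 < L w₁ * L w₃ := fun hL => by
    have := hfst w₁ w₃ hw₁ hw₃ hL
    nlinarith
  have h23 : ¬ 0 < L w₂ * L w₃ := fun hL => by
    have := hfst w₂ w₃ hw₂ hw₃ hL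
    nlinarith
  rcases lt_or_gt_of_ne hL₁ with a | a <;> rcases lt_or_gt_of_ne hL₂ with b | b <;>
    rcases lt_or_gt_of_ne hL₃ with c | c
  all_goals exact h12 (by nlinarith)

end

lemma LocalParam.congr_homeomorph {D X Y : Type*} [TopologicalSpace D] [Zero D]
    [TopologicalSpace X] [Zero X] [TopologicalSpace Y] [Zero Y] {f : X → ℝ} {g : Y → ℝ}
    {e : D → X} {e' : X → D} (he : LocalParam f e e') (h : X ≃ₜ Y) (h0 : h 0 = 0)
    (hfg : ∀ x, g (h x) = 0 ↔ f x = 0) : LocalParam g (h ∘ e) (e' ∘ h.symm) := by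
  have h0' : h.symm 0 = 0 := by rw [← h0, h.symm_apply_apply]
  have hg : ∀ y, g y = 0 ↔ f (h.symm y) = 0 := fun y => by rw [← hfg, h.apply_symm_apply]
  have ht : Filter.Tendsto h.symm (nhds 0) (nhds 0) := by
    have := h.symm.continuous.tendsto 0
    rwa [h0'] at this
  refine ⟨by simp [he.map_zero, h0], by simp [he.map_zero', h0'], ?_, ?_, ?_, ?_, ?_⟩
  · exact he.cont.mono fun w hw => h.continuous.continuousAt.comp hw
  · exact he.zero.mono fun w hw => (hfg _).2 hw
  · exact he.left.mono fun w hw => by simp [hw]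
  · refine (ht.eventually he.cont').mono fun y hy hy0 => ?_
    exact (hy ((hg y).1 hy0)).comp h.symm.continuous.continuousWithinAt fun z hz => (hg z).1 hz
  · exact (ht.eventually he.right).mono fun y hy hy0 => by simp [hy ((hg y).1 hy0)]

theorem NearCone.not_localParam {P N D : Type*} [NormedAddCommGroup P] [InnerProductSpace ℝ P]
    [NormedAddCommGroup N] [InnerProductSpace ℝ N] [FiniteDimensional ℝ P] [FiniteDimensional ℝ N]
    [NormedAddCommGroup D] [NormedSpace ℝ D] [FiniteDimensional ℝ D]
    {f : P × N → ℝ} {δ : ℝ} (hδ : 0 < δ) (h : NearCone f δ) (hD : 1 ≤ Module.finrank ℝ D)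
    (hdim : Module.finrank ℝ D + 1 = Module.finrank ℝ P + Module.finrank ℝ N)
    {e : D → P × N} {e' : P × N → D} : ¬ LocalParam f e e' := by
  intro he
  by_cases h1 : 2 ≤ Module.finrank ℝ P
  · have : Nontrivial P := Module.nontrivial_of_finrank_pos (R := ℝ) (by omega)
    exact h.not_localParam_of_lt hδ (by omega) he
  by_cases h2 : 2 ≤ Module.finrank ℝ N
  · have : Nontrivial N := Module.nontrivial_of_finrank_pos (R := ℝ) (by omega)
    exact h.swap.not_localParam_of_lt hδ (by omega)
      (he.congr_homeomorph (Homeomorph.prodComm P N) (by simp) (by simp))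
  · exact h.not_localParam_of_one hδ (by omega) (by omega) (by omega) he

/-- Splitting of coordinates according to a predicate. -/
def coordSplit {m : ℕ} (q : Fin m → Prop) [DecidablePred q] :
    (EuclideanSpace ℝ {i // q i} × EuclideanSpace ℝ {i // ¬ q i}) ≃ₗ[ℝ] (Fin m → ℝ) where
  toFun z i := if h : q i then z.1 ⟨i, h⟩ else z.2 ⟨i, h⟩
  invFun x := (WithLp.toLp 2 fun i => x i, WithLp.toLp 2 fun i => x i)
  map_add' z w := by
    ext i
    by_cases h : q i <;> simp [h]
  map_smul' c z := by
    ext i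
    by_cases h : q i <;> simp [h]
  left_inv z := by
    ext i
    · simp [i.2]
    · simp [i.2]
  right_inv x := by
    ext i
    by_cases h : q i <;> simp [h]

/-- A nondegenerate critical zero is not a topological manifold point of the zero set. -/
theorem not_localParam_of_nondegenerate {K D : Type*} [NormedAddCommGroup K] [NormedSpace ℝ K]
    [FiniteDimensional ℝ K] [NormedAddCommGroup D] [NormedSpace ℝ D] [FiniteDimensional ℝ D]
    {f : K → ℝ} (hf : ContDiffAt ℝ 2 f 0) (hf0 : f 0 = 0) (hf1 : fderiv ℝ f 0 = 0)
    (hf2 : ∀ z, fderiv ℝ (fderiv ℝ f) 0 z = 0 → z = 0) (hD : 1 ≤ Module.finrank ℝ D)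
    (hdim : Module.finrank ℝ D + 1 = Module.finrank ℝ K) {e : D → K} {e' : K → D} :
    ¬ LocalParam f e e' := by
  intro he
  classical
  let B : LinearMap.BilinForm ℝ K :=
    LinearMap.mk₂ ℝ (fun z w => fderiv ℝ (fderiv ℝ f) 0 z w) (by simp) (by simp) (by simp) (by simp)
  have hB : ∀ z w, B z w = fderiv ℝ (fderiv ℝ f) 0 z w := fun _ _ => rfl
  have hsymm : ∀ z w, B z w = B w z := fun z w =>
    hf.isSymmSndFDerivAt (by simp) z w
  have hassoc : ∀ z w, QuadraticMap.associated (R := ℝ) B.toQuadraticMap z w = B z w := by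
    intro z w
    rw [QuadraticMap.associated_left_inverse ℝ hsymm]
  obtain ⟨w, hw, ⟨A⟩⟩ := QuadraticForm.equivalent_one_neg_one_weighted_sum_squared
    B.toQuadraticMap (fun z hz => hf2 z (by
      ext v
      have := hz v
      rwa [hassoc] at this))
  let Φ₀ := (coordSplit fun i => w i = 1).trans A.toLinearEquiv.symm
  let Φ : (EuclideanSpace ℝ {i // w i = 1} × EuclideanSpace ℝ {i // ¬ w i = 1}) ≃L[ℝ] K :=
    Φ₀.toContinuousLinearEquiv
  have hQ : ∀ z, B (Φ z) (Φ z) = ⟪z.1, z.1⟫ - ⟪z.2, z.2⟫ := by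
    intro z
    have h1 := A.map_app (Φ z)
    have h2 : A (Φ z) = coordSplit (fun i => w i = 1) z := by
      exact A.toLinearEquiv.apply_symm_apply _
    rw [h2, QuadraticMap.weightedSumSquares_apply] at h1
    rw [← LinearMap.BilinMap.toQuadraticMap_apply, ← h1,
      ← Fintype.sum_subtype_add_sum_subtype (fun i => w i = 1)]
    rw [PiLp.inner_apply, PiLp.inner_apply, sub_eq_add_neg, ← Finset.sum_neg_distrib]
    congr 1
    · refine Finset.sum_congr rfl fun i _ => ?_
      simp [coordSplit, i.2, sq]
    · refine Finset.sum_congr rfl fun i _ => ?_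
      have hi : w i = -1 := (hw i).resolve_right i.2
      have hi' : ¬ ((-1 : ℝ) = 1) := by norm_num
      simp [coordSplit, hi, hi', sq]
  have hpol : ∀ z z', B (Φ z) (Φ z') = ⟪z.1, z'.1⟫ - ⟪z.2, z'.2⟫ := by
    intro z z'
    have h1 := hQ (z + z')
    have h2 := hQ z
    have h3 := hQ z'
    have h4 := hsymm (Φ z) (Φ z')
    simp only [map_add, LinearMap.add_apply, Prod.fst_add, Prod.snd_add, inner_add_left,
      inner_add_right] at h1
    have h5 := real_inner_comm z.1 z'.1
    have h6 := real_inner_comm z.2 z'.2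
    linarith
  -- the rescaled function is close to the standard cone
  have hd : HasFDerivAt (fderiv ℝ f) (fderiv ℝ (fderiv ℝ f) 0) 0 :=
    ((hf.fderiv_right (m := 1) (by norm_num)).differentiableAt one_ne_zero).hasFDerivAt
  have hlit := hasFDerivAt_iff_isLittleO_nhds_zero.1 hd
  simp only [zero_add, hf1, sub_zero] at hlit
  set M := ‖Φ.toContinuousLinearMap‖ with hM
  have hev : ∀ᶠ z in nhds (0 : K), DifferentiableAt ℝ f z ∧
      ‖fderiv ℝ f z - fderiv ℝ (fderiv ℝ f) 0 z‖ ≤ 1 / (16 * (M * M + 1)) * ‖z‖ :=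
    ((hf.eventually (by simp)).mono fun z hz => hz.differentiableAt two_ne_zero).and
      (hlit.def (by positivity))
  have hΦt : Filter.Tendsto Φ (nhds 0) (nhds 0) := by
    have := Φ.continuous.tendsto 0
    rwa [map_zero] at this
  obtain ⟨δ, hδ, hδ'⟩ := Metric.nhds_basis_closedBall.eventually_iff.1 (hΦt.eventually hev)
  have hcone : NearCone (fun z => 2 * f (Φ z)) δ := by
    refine ⟨by simp [hf0], fun z hz => ?_⟩
    obtain ⟨h1, h2⟩ := hδ' (x := z) (by simpa using hz)
    refine ⟨(2 : ℝ) • (fderiv ℝ f (Φ z)).comp Φ.toContinuousLinearMap, ?_, fun v => ?_⟩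
    · exact (h1.hasFDerivAt.comp z Φ.hasFDerivAt).const_mul 2
    · have h3 : ((2 : ℝ) • (fderiv ℝ f (Φ z)).comp Φ.toContinuousLinearMap) v -
          (2 * ⟪z.1, v.1⟫ - 2 * ⟪z.2, v.2⟫) =
          2 * (fderiv ℝ f (Φ z) - fderiv ℝ (fderiv ℝ f) 0 (Φ z)) (Φ v) := by
        have := hpol z v
        rw [hB] at this
        simp only [sub_apply, this]
        simp
        ring
      rw [h3, abs_mul, abs_two, ← Real.norm_eq_abs]
      have hz' : ‖Φ z‖ ≤ M * ‖z‖ := Φ.toContinuousLinearMap.le_opNorm z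
      have hv' : ‖Φ v‖ ≤ M * ‖v‖ := Φ.toContinuousLinearMap.le_opNorm v
      have hM0 : 0 ≤ M := norm_nonneg _
      calc 2 * ‖(fderiv ℝ f (Φ z) - fderiv ℝ (fderiv ℝ f) 0 (Φ z)) (Φ v)‖
          ≤ 2 * (‖fderiv ℝ f (Φ z) - fderiv ℝ (fderiv ℝ f) 0 (Φ z)‖ * ‖Φ v‖) := by
            gcongr
            exact ContinuousLinearMap.le_opNorm _ _
        _ ≤ 2 * ((1 / (16 * (M * M + 1)) * (M * ‖z‖)) * (M * ‖v‖)) := by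
            gcongr
            exact h2.trans (by gcongr)
        _ = 1 / 8 * ((M * M) / (M * M + 1)) * (‖z‖ * ‖v‖) := by field_simp; ring
        _ ≤ 1 / 8 * 1 * (‖z‖ * ‖v‖) := by
            gcongr
            rw [div_le_one (by positivity)]
            linarith
        _ = _ := by ring
  refine hcone.not_localParam hδ hD ?_
    (he.congr_homeomorph Φ.symm.toHomeomorph (by simp) (fun x => by simp))
  exact hdim.trans (Φ.toLinearEquiv.finrank_eq.symm.trans Module.finrank_prod)

section Charts

open Filter Topology

/-- A parametrization of the zero set of a submersion by the kernel of its differential. -/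
lemma ContDiffAt.exists_ker_chart {E F : Type*} [NormedAddCommGroup E] [NormedSpace ℝ E]
    [FiniteDimensional ℝ E] [NormedAddCommGroup F] [NormedSpace ℝ F] [FiniteDimensional ℝ F]
    {f : E → F} {a : E} (hf : ContDiffAt ℝ 2 f a) (hfa : f a = 0)
    (hsurj : (fderiv ℝ f a).range = ⊤) :
    ∃ (ψ : (fderiv ℝ f a).ker → E) (π : E → (fderiv ℝ f a).ker), ψ 0 = a ∧ π a = 0 ∧
      ContDiffAt ℝ 2 ψ 0 ∧ fderiv ℝ ψ 0 = (fderiv ℝ f a).ker.subtypeL ∧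
      (∀ᶠ z in 𝓝 0, ContinuousAt ψ z) ∧ (∀ᶠ x in 𝓝 a, ContinuousAt π x) ∧
      (∀ᶠ z in 𝓝 0, f (ψ z) = 0) ∧ (∀ᶠ z in 𝓝 0, π (ψ z) = z) ∧
      ∀ᶠ x in 𝓝 a, f x = 0 → ψ (π x) = x := by
  have := FiniteDimensional.complete ℝ E
  have := FiniteDimensional.complete ℝ F
  have hs : HasStrictFDerivAt f (fderiv ℝ f a) a := hf.hasStrictFDerivAt (by norm_num)
  let π' : E →L[ℝ] (fderiv ℝ f a).ker :=
    Classical.choose ((fderiv ℝ f a).ker_closedComplemented_of_finiteDimensional_range)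
  have hπ' : ∀ z : (fderiv ℝ f a).ker, π' z = z := Classical.choose_spec
    ((fderiv ℝ f a).ker_closedComplemented_of_finiteDimensional_range)
  let Φ := hs.implicitToOpenPartialHomeomorph f _ hsurj
  have hΦ : ∀ x, Φ x = (f x, π' (x - a)) := fun x => rfl
  have ha : a ∈ Φ.source := hs.mem_implicitToOpenPartialHomeomorph_source hsurj
  have ht : ((0 : F), (0 : (fderiv ℝ f a).ker)) ∈ Φ.target := by
    have := hs.mem_implicitToOpenPartialHomeomorph_target hsurj
    rwa [hfa] at this
  have hsym : Φ.symm (0, 0) = a := by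
    have : Φ a = (0, 0) := by simp [hΦ, hfa]
    rw [← this, Φ.left_inv ha]
  have hin : ContDiffAt ℝ 2 (fun z : (fderiv ℝ f a).ker => ((0 : F), z)) 0 :=
    (contDiff_const.prodMk contDiff_id).contDiffAt
  have hcont : Tendsto (fun z : (fderiv ℝ f a).ker => ((0 : F), z)) (𝓝 0) (𝓝 (0, 0)) :=
    hin.continuousAt
  have htar : ∀ᶠ z : (fderiv ℝ f a).ker in 𝓝 0, ((0 : F), z) ∈ Φ.target :=
    hcont.eventually (Φ.open_target.mem_nhds ht)
  have hsrc : ∀ᶠ x in 𝓝 a, x ∈ Φ.source := Φ.open_source.mem_nhds ha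
  have hΦd : ContDiffAt ℝ 2 Φ a :=
    hf.prodMk (π'.contDiff.contDiffAt.comp a (contDiffAt_id.sub contDiffAt_const))
  have hker : ∀ v, fderiv ℝ f a v = 0 → π' v = 0 → v = 0 := by
    intro v h1 h2
    have := hπ' ⟨v, h1⟩
    rw [h2] at this
    exact congrArg Subtype.val this.symm
  have hstar : HasFDerivAt Φ ((fderiv ℝ f a).prod π') a :=
    hs.hasFDerivAt.prodMk (π'.hasFDerivAt.comp a ((hasFDerivAt_id a).sub_const a))
  have hinj : Function.Injective ((fderiv ℝ f a).prod π') := by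
    rw [injective_iff_map_eq_zero]
    intro v hv
    exact hker v (congrArg Prod.fst hv) (congrArg Prod.snd hv)
  have hsurj' : Function.Surjective ((fderiv ℝ f a).prod π') := by
    rintro ⟨u, z⟩
    obtain ⟨v, hv⟩ : u ∈ (fderiv ℝ f a).range := hsurj ▸ Submodule.mem_top
    refine ⟨v + (z - π' v : (fderiv ℝ f a).ker), ?_⟩
    have h3 : fderiv ℝ f a ((z - π' v : (fderiv ℝ f a).ker) : E) = 0 := (z - π' v).2
    refine Prod.ext ?_ ?_
    · simp only [map_add, ContinuousLinearMap.prod_apply, Prod.fst_add]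
      rw [h3, add_zero]; exact hv
    · simp only [map_add, ContinuousLinearMap.prod_apply, Prod.snd_add]
      rw [hπ']; abel
  let A : E ≃L[ℝ] F × (fderiv ℝ f a).ker :=
    (LinearEquiv.ofBijective ((fderiv ℝ f a).prod π').toLinearMap
      ⟨hinj, hsurj'⟩).toContinuousLinearEquiv
  have hA : (A.toContinuousLinearMap : E →L[ℝ] F × (fderiv ℝ f a).ker) =
    (fderiv ℝ f a).prod π' := by ext v <;> rfl
  have hsd : ContDiffAt ℝ 2 Φ.symm (0, 0) := by
    refine Φ.contDiffAt_symm ht (f₀' := A) ?_ ?_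
    · rw [hsym]; exact hA ▸ hstar
    · rw [hsym]; exact hΦd
  have hψd : ContDiffAt ℝ 2 (fun z : (fderiv ℝ f a).ker => Φ.symm ((0 : F), z)) 0 :=
    ContDiffAt.comp (0 : (fderiv ℝ f a).ker) (g := Φ.symm) hsd hin
  refine ⟨fun z => Φ.symm (0, z), fun x => π' (x - a), hsym, by simp, hψd, ?_, ?_, ?_, ?_, ?_, ?_⟩
  · have := hs.to_implicitFunction hsurj
    rw [hfa] at this
    exact this.hasFDerivAt.fderiv
  · filter_upwards [htar] with z hz
    exact ContinuousAt.comp (f := fun z : (fderiv ℝ f a).ker => ((0 : F), z))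
      (Φ.continuousAt_symm hz) (by fun_prop)
  · exact Eventually.of_forall fun x => by fun_prop
  · filter_upwards [htar] with z hz
    have := Φ.right_inv hz
    rw [hΦ] at this
    exact congrArg Prod.fst this
  · filter_upwards [htar] with z hz
    have := Φ.right_inv hz
    rw [hΦ] at this
    exact congrArg Prod.snd this
  · filter_upwards [hsrc] with x hx hfx
    have := Φ.left_inv hx
    rwa [hΦ, hfx] at this

lemma fderiv_fderiv_comp_of_critical {K E : Type*} [NormedAddCommGroup K] [NormedSpace ℝ K]
    [NormedAddCommGroup E] [NormedSpace ℝ E] {h : E → ℝ} {ψ : K → E} {a : K}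
    (hh : ContDiffAt ℝ 2 h (ψ a)) (hψ : ContDiffAt ℝ 2 ψ a) (h0 : fderiv ℝ h (ψ a) = 0)
    (z z' : K) :
    fderiv ℝ (fderiv ℝ (h ∘ ψ)) a z z' =
      fderiv ℝ (fderiv ℝ h) (ψ a) (fderiv ℝ ψ a z) (fderiv ℝ ψ a z') := by
  have e1 : fderiv ℝ (h ∘ ψ) =ᶠ[𝓝 a] fun z => (fderiv ℝ h (ψ z)).comp (fderiv ℝ ψ z) := by
    have h1 : ∀ᶠ x in 𝓝 (ψ a), DifferentiableAt ℝ h x :=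
      (hh.eventually (by simp)).mono fun x hx => hx.differentiableAt (by norm_num)
    filter_upwards [hψ.continuousAt.eventually h1, hψ.eventually (by simp)] with z h2 h3
    exact fderiv_comp z h2 (h3.differentiableAt (by norm_num))
  rw [e1.fderiv_eq]
  have d1 : HasFDerivAt (fun z => fderiv ℝ h (ψ z))
      ((fderiv ℝ (fderiv ℝ h) (ψ a)).comp (fderiv ℝ ψ a)) a :=
    HasFDerivAt.comp a (g := fderiv ℝ h)
      ((hh.fderiv_right (m := 1) (by norm_num)).differentiableAt (by norm_num)).hasFDerivAt
      (hψ.differentiableAt (by norm_num)).hasFDerivAt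
  have d2 : HasFDerivAt (fderiv ℝ ψ) (fderiv ℝ (fderiv ℝ ψ) a) a :=
    ((hψ.fderiv_right (m := 1) (by norm_num)).differentiableAt (by norm_num)).hasFDerivAt
  rw [(d1.clm_comp d2).fderiv]
  simp [h0]

end Charts

section Obstruction

open Filter Topology

variable {E F : Type*} [NormedAddCommGroup E] [InnerProductSpace ℝ E] [FiniteDimensional ℝ E]
  [NormedAddCommGroup F] [InnerProductSpace ℝ F] [FiniteDimensional ℝ F]

/-- A zero at which the map is a submersion cannot be matched, by a local homeomorphism of zero
sets, with a zero at which the map has corank one and nondegenerate transverse Hessian. -/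
theorem false_of_homeomorph_nondegenerate {g₁ g₂ : E → F} {y x₀ : E}
    (hdim : Module.finrank ℝ F < Module.finrank ℝ E)
    (h1 : ContDiffAt ℝ 2 g₁ y) (h10 : g₁ y = 0) (h1s : (fderiv ℝ g₁ y).range = ⊤)
    (h2 : ContDiffAt ℝ 2 g₂ x₀) (h20 : g₂ x₀ = 0) {w : F} (hw : ‖w‖ = 1)
    (hw0 : ∀ v, ⟪w, fderiv ℝ g₂ x₀ v⟫ = 0)
    (hw1 : ∀ u, ⟪w, u⟫ = 0 → ∃ v, fderiv ℝ g₂ x₀ v = u)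
    (hnd : ∀ z, fderiv ℝ g₂ x₀ z = 0 → (∀ z', fderiv ℝ g₂ x₀ z' = 0 →
      fderiv ℝ (fderiv ℝ fun x => ⟪w, g₂ x⟫) x₀ z z' = 0) → z = 0)
    {s t : E → E} (hs0 : s x₀ = y) (ht0 : t y = x₀)
    (hs : ∀ᶠ x in 𝓝 x₀, ContinuousAt s x) (ht : ∀ᶠ x in 𝓝 y, ContinuousAt t x)
    (hts : ∀ᶠ x in 𝓝 x₀, t (s x) = x) (hst : ∀ᶠ x in 𝓝 y, s (t x) = x)
    (hz : ∀ᶠ x in 𝓝 x₀, g₂ x = 0 ↔ g₁ (s x) = 0) : False := by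
  let W : Submodule ℝ F := (ℝ ∙ w)ᗮ
  let P : F →L[ℝ] W := W.orthogonalProjectionOnto
  have hPw : ∀ u : F, P u = 0 → ⟪w, u⟫ = 0 → u = 0 := by
    intro u hu hwu
    have h3 : u ∈ W := Submodule.mem_orthogonal_singleton_iff_inner_right.2 hwu
    have h4 : P u = ⟨u, h3⟩ := W.orthogonalProjectionOnto_mem_subspace_eq_self ⟨u, h3⟩
    rw [hu] at h4
    exact congrArg Subtype.val h4.symm
  let G : E → W := fun x => P (g₂ x)
  have hG : ContDiffAt ℝ 2 G x₀ := P.contDiff.contDiffAt.comp x₀ h2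
  have hG0 : G x₀ = 0 := by simp [G, h20]
  have hG' : fderiv ℝ G x₀ = P.comp (fderiv ℝ g₂ x₀) :=
    (P.hasFDerivAt.comp x₀ (h2.differentiableAt (by norm_num)).hasFDerivAt).fderiv
  have hGr : (fderiv ℝ G x₀).range = ⊤ := by
    rw [Submodule.eq_top_iff']
    intro u
    obtain ⟨v, hv⟩ := hw1 u (Submodule.mem_orthogonal_singleton_iff_inner_right.1 u.2)
    refine ⟨v, ?_⟩
    change fderiv ℝ G x₀ v = u
    rw [hG', ContinuousLinearMap.comp_apply, hv]
    exact W.orthogonalProjectionOnto_mem_subspace_eq_self u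
  have hGk : ∀ z, fderiv ℝ G x₀ z = 0 → fderiv ℝ g₂ x₀ z = 0 := by
    intro z hz
    rw [hG'] at hz
    exact hPw _ hz (hw0 z)
  obtain ⟨ψ₁, π₁, hψ₁, hπ₁, -, -, cψ₁, cπ₁, z₁, l₁, r₁⟩ := h1.exists_ker_chart h10 h1s
  obtain ⟨ψ₂, π₂, hψ₂, hπ₂, dψ₂, dψ₂', cψ₂, cπ₂, z₂, l₂, r₂⟩ := hG.exists_ker_chart hG0 hGr
  let h : E → ℝ := fun x => ⟪w, g₂ x⟫
  have hh : ContDiffAt ℝ 2 h (ψ₂ 0) := by rw [hψ₂]; exact contDiffAt_const.inner ℝ h2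
  have hh' : fderiv ℝ h (ψ₂ 0) = 0 := by
    rw [hψ₂]
    ext v
    have := ((hasFDerivAt_const w x₀).inner ℝ (h2.differentiableAt (by norm_num)).hasFDerivAt)
    rw [show fderiv ℝ h x₀ = _ from this.fderiv]
    simp [fderivInnerCLM_apply, hw0]
  have tψ₁ : Tendsto ψ₁ (𝓝 0) (𝓝 y) := by
    have := cψ₁.self_of_nhds.tendsto; rwa [hψ₁] at this
  have tψ₂ : Tendsto ψ₂ (𝓝 0) (𝓝 x₀) := by
    have := cψ₂.self_of_nhds.tendsto; rwa [hψ₂] at this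
  have ts : Tendsto s (𝓝 x₀) (𝓝 y) := by
    have := hs.self_of_nhds.tendsto; rwa [hs0] at this
  have tt : Tendsto t (𝓝 y) (𝓝 x₀) := by
    have := ht.self_of_nhds.tendsto; rwa [ht0] at this
  have hLP : LocalParam (h ∘ ψ₂) (fun v => π₂ (t (ψ₁ v))) (fun z => π₁ (s (ψ₂ z))) := by
    refine ⟨by simp [hψ₁, ht0, hπ₂], by simp [hψ₂, hs0, hπ₁], ?_, ?_, ?_, ?_, ?_⟩
    · filter_upwards [cψ₁, tψ₁.eventually ht, (tt.comp tψ₁).eventually cπ₂] with v a b c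
      exact ContinuousAt.comp (f := fun v => t (ψ₁ v)) c (ContinuousAt.comp b a)
    · filter_upwards [z₁, tψ₁.eventually hst, (tt.comp tψ₁).eventually hz,
        (tt.comp tψ₁).eventually r₂] with v a b c d
      simp only [Function.comp_apply] at c d
      rw [b] at c
      have e := c.2 a
      simp only [Function.comp_apply, h]
      rw [d (by simp [G, e]), e, inner_zero_right]
    · filter_upwards [z₁, tψ₁.eventually hst, (tt.comp tψ₁).eventually hz,
        (tt.comp tψ₁).eventually r₂, l₁] with v a b c d l
      simp only [Function.comp_apply] at c d
      rw [b] at c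
      have e := c.2 a
      rw [d (by simp [G, e]), b, l]
    · filter_upwards [cψ₂, tψ₂.eventually hs, (ts.comp tψ₂).eventually cπ₁] with z a b c _
      exact (ContinuousAt.comp (f := fun v => s (ψ₂ v)) c
        (ContinuousAt.comp b a)).continuousWithinAt
    · filter_upwards [z₂, l₂, tψ₂.eventually hts, tψ₂.eventually hz,
        (ts.comp tψ₂).eventually r₁] with z a b c d e hfz
      have h0 : g₂ (ψ₂ z) = 0 := hPw _ a hfz
      simp only [Function.comp_apply] at e
      rw [e (d.1 h0), c, b]
  have hr1 := (fderiv ℝ g₁ y).toLinearMap.finrank_range_add_finrank_ker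
  have hr2 := (fderiv ℝ G x₀).toLinearMap.finrank_range_add_finrank_ker
  have hWd : Module.finrank ℝ W + 1 = Module.finrank ℝ F := by
    have h5 := Submodule.finrank_add_finrank_orthogonal (ℝ ∙ w)
    have h6 : Module.finrank ℝ (ℝ ∙ w) = 1 := finrank_span_singleton (by
      rintro rfl; simp at hw)
    rw [h6] at h5
    change 1 + Module.finrank ℝ W = _ at h5
    omega
  rw [show LinearMap.range (fderiv ℝ g₁ y).toLinearMap = ⊤ from h1s, finrank_top] at hr1
  rw [show LinearMap.range (fderiv ℝ G x₀).toLinearMap = ⊤ from hGr, finrank_top] at hr2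
  refine not_localParam_of_nondegenerate (hh.comp (0 : (fderiv ℝ G x₀).ker) dψ₂) ?_ ?_ ?_ ?_ ?_ hLP
  · simp [h, hψ₂, h20]
  · rw [fderiv_comp _ (hh.differentiableAt (by norm_num)) (dψ₂.differentiableAt (by norm_num)), hh']
    simp
  · intro z hz
    have := hnd z (hGk z z.2) fun z' hz' => by
      have h7 : fderiv ℝ G x₀ z' = 0 := by rw [hG']; simp [hz']
      have h8 := fderiv_fderiv_comp_of_critical hh dψ₂ hh' z ⟨z', h7⟩
      rw [hz, dψ₂', hψ₂] at h8
      exact h8.symm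
    exact Subtype.ext this
  · change 1 ≤ Module.finrank ℝ (LinearMap.ker (fderiv ℝ g₁ y).toLinearMap)
    omega
  · change Module.finrank ℝ (LinearMap.ker (fderiv ℝ g₁ y).toLinearMap) + 1 = 
      Module.finrank ℝ (LinearMap.ker (fderiv ℝ G x₀).toLinearMap)
    omega

end Obstruction

section Flow

open Set NNReal

variable {E : Type*} [NormedAddCommGroup E] [NormedSpace ℝ E]

/-- `γ` is an integral curve on `[0, 1]` of the time-dependent vector field `X`. -/
def IsUnitCurve (X : ℝ → E → E) (γ : ℝ → E) : Prop :=
  ∀ t ∈ Icc (0 : ℝ) 1, HasDerivWithinAt γ (X t (γ t)) (Icc 0 1) t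

lemma HasDerivWithinAt.Ici_of_Icc {γ : ℝ → E} {v : E} {t : ℝ} (ht : t ∈ Ico (0 : ℝ) 1)
    (h : HasDerivWithinAt γ v (Icc 0 1) t) : HasDerivWithinAt γ v (Ici t) t :=
  h.mono_of_mem_nhdsWithin (Filter.mem_of_superset (Icc_mem_nhdsGE ht.2)
    (Icc_subset_Icc_left ht.1))

lemma IsUnitCurve.dist_le {X : ℝ → E → E} {K : ℝ≥0}
    (hX : ∀ t ∈ Icc (0 : ℝ) 1, LipschitzWith K (X t)) {γ γ' : ℝ → E}
    (h : IsUnitCurve X γ) (h' : IsUnitCurve X γ') {t : ℝ} (ht : t ∈ Icc (0 : ℝ) 1) :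
    dist (γ t) (γ' t) ≤ dist (γ 0) (γ' 0) * Real.exp K := by
  have := dist_le_of_trajectories_ODE_of_mem (v := X) (s := fun _ => univ) (K := K)
    (f := γ) (g := γ') (a := 0) (b := 1) (δ := dist (γ 0) (γ' 0))
    (fun t ht => (hX t ⟨ht.1, ht.2.le⟩).lipschitzOnWith)
    (fun t ht => (h t ht).continuousWithinAt)
    (fun t ht => (h t ⟨ht.1, ht.2.le⟩).Ici_of_Icc ht) (fun _ _ => trivial)
    (fun t ht => (h' t ht).continuousWithinAt)
    (fun t ht => (h' t ⟨ht.1, ht.2.le⟩).Ici_of_Icc ht) (fun _ _ => trivial) le_rfl t ht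
  refine this.trans (mul_le_mul_of_nonneg_left (Real.exp_le_exp.2 ?_) dist_nonneg)
  have : (0 : ℝ) ≤ K := K.2
  nlinarith [ht.1, ht.2]

lemma IsUnitCurve.reverse {X : ℝ → E → E} {γ : ℝ → E} (h : IsUnitCurve X γ) :
    IsUnitCurve (fun t x => -X (1 - t) x) fun t => γ (1 - t) := by
  intro t ht
  have h1 : HasDerivWithinAt (fun t : ℝ => 1 - t) (-1) (Icc 0 1) t :=
    ((hasDerivAt_id t).const_sub 1).hasDerivWithinAt
  have := (h (1 - t) ⟨by linarith [ht.2], by linarith [ht.1]⟩).scomp t h1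
    (fun s hs => ⟨by linarith [hs.2], by linarith [hs.1]⟩)
  simpa [Function.comp_def] using this

lemma exists_isUnitCurve [CompleteSpace E] {X : ℝ → E → E} {K L : ℝ≥0}
    (hX : ∀ t ∈ Icc (0 : ℝ) 1, LipschitzWith K (X t))
    (hc : ∀ x, ContinuousOn (fun t => X t x) (Icc 0 1))
    (hL : ∀ t ∈ Icc (0 : ℝ) 1, ∀ x, ‖X t x‖ ≤ L) (x : E) :
    ∃ γ, γ 0 = x ∧ IsUnitCurve X γ := by
  have hP : IsPicardLindelof X (tmin := 0) (tmax := 1) ⟨0, by simp⟩ x L 0 L K :=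
    { lipschitzOnWith := fun t ht => (hX t ht).lipschitzOnWith
      continuousOn := fun x _ => hc x
      norm_le := fun t ht x _ => hL t ht x
      mul_max_le := by simp }
  obtain ⟨γ, h0, h1⟩ := hP.exists_eq_forall_mem_Icc_hasDerivWithinAt₀
  exact ⟨γ, h0, h1⟩

theorem exists_homeomorph_of_isUnitCurve [CompleteSpace E] {X : ℝ → E → E} {K L : ℝ≥0}
    (hX : ∀ t ∈ Icc (0 : ℝ) 1, LipschitzWith K (X t))
    (hc : ∀ x, ContinuousOn (fun t => X t x) (Icc 0 1))
    (hL : ∀ t ∈ Icc (0 : ℝ) 1, ∀ x, ‖X t x‖ ≤ L) :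
    ∃ σ : E ≃ₜ E, ∀ x, ∃ γ, γ 0 = x ∧ γ 1 = σ x ∧ IsUnitCurve X γ := by
  have hmem : ∀ t ∈ Icc (0 : ℝ) 1, 1 - t ∈ Icc (0 : ℝ) 1 :=
    fun t ht => ⟨by linarith [ht.2], by linarith [ht.1]⟩
  have hX' : ∀ t ∈ Icc (0 : ℝ) 1, LipschitzWith K fun x => -X (1 - t) x := fun t ht =>
    (hX _ (hmem t ht)).neg
  have hc' : ∀ x, ContinuousOn (fun t => -X (1 - t) x) (Icc 0 1) := fun x =>
    ((hc x).comp (by fun_prop) hmem).neg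
  choose γ h0 hγ using exists_isUnitCurve hX hc hL
  choose η k0 hη using exists_isUnitCurve hX' hc' (L := L) fun t ht x => by
    rw [norm_neg]; exact hL _ (hmem t ht) x
  have hcont : ∀ {Y : ℝ → E → E} {δ : E → ℝ → E}
      (_ : ∀ t ∈ Icc (0 : ℝ) 1, LipschitzWith K (Y t)) (_ : ∀ x, δ x 0 = x)
      (_ : ∀ x, IsUnitCurve Y (δ x)), Continuous fun x => δ x 1 := by
    intro Y δ hY hδ0 hδ
    refine (LipschitzWith.of_dist_le_mul (K := ⟨Real.exp K, (Real.exp_pos _).le⟩)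
      fun x y => ?_).continuous
    have := (hδ x).dist_le hY (hδ y) (t := 1) (by simp)
    rw [hδ0, hδ0] at this
    rw [mul_comm]
    exact this
  refine ⟨{ toFun := fun x => γ x 1, invFun := fun x => η x 1, left_inv := fun x => ?_,
            right_inv := fun x => ?_, continuous_toFun := hcont hX h0 hγ,
            continuous_invFun := hcont hX' k0 hη }, fun x => ⟨γ x, h0 x, rfl, hγ x⟩⟩
  · have := (hη (γ x 1)).dist_le hX' (hγ x).reverse (t := 1) (by simp)
    simp only [k0, sub_zero, dist_self, zero_mul, sub_self, h0] at this
    exact dist_le_zero.1 this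
  · have h1 : IsUnitCurve X fun t => η x (1 - t) := by
      simpa using (hη x).reverse
    have := (hγ (η x 1)).dist_le hX h1 (t := 1) (by simp)
    simp only [k0, sub_zero, dist_self, zero_mul, sub_self, h0] at this
    exact dist_le_zero.1 this

lemma eq_zero_iff_of_norm_deriv_le {u u' : ℝ → E} {C : ℝ}
    (hu : ∀ t ∈ Icc (0 : ℝ) 1, HasDerivWithinAt u (u' t) (Icc 0 1) t)
    (hC : ∀ t ∈ Icc (0 : ℝ) 1, ‖u' t‖ ≤ C * ‖u t‖) : u 0 = 0 ↔ u 1 = 0 := by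
  have key : ∀ {v v' : ℝ → E}, (∀ t ∈ Icc (0 : ℝ) 1, HasDerivWithinAt v (v' t) (Icc 0 1) t) →
      (∀ t ∈ Icc (0 : ℝ) 1, ‖v' t‖ ≤ C * ‖v t‖) → v 0 = 0 → v 1 = 0 := by
    intro v v' hv hvC h0
    exact eq_zero_of_abs_deriv_le_mul_abs_self_of_eq_zero_right (K := C)
      (fun t ht => (hv t ht).continuousWithinAt)
      (fun t ht => (hv t ⟨ht.1, ht.2.le⟩).Ici_of_Icc ht) h0
      (fun t ht => hvC t ⟨ht.1, ht.2.le⟩) 1 (by simp)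
  have hmem : ∀ t ∈ Icc (0 : ℝ) 1, 1 - t ∈ Icc (0 : ℝ) 1 :=
    fun t ht => ⟨by linarith [ht.2], by linarith [ht.1]⟩
  refine ⟨key hu hC, fun h1 => ?_⟩
  have := IsUnitCurve.reverse (X := fun t _ => u' t) hu
  have := key (v := fun t => u (1 - t)) (v' := fun t => -u' (1 - t)) this
    (fun t ht => by rw [norm_neg]; exact hC _ (hmem t ht)) (by simpa using h1)
  simpa using this

end Flow

section Flatness

open Metric Set

variable {E F : Type*} [NormedAddCommGroup E] [NormedSpace ℝ E] [NormedAddCommGroup F]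
  [NormedSpace ℝ F]

lemma norm_iteratedFDeriv_le_of_flat_at {h : E → F} (hh : ContDiff ℝ ∞ h) {s : Set E}
    (hs : Convex ℝ s) {k : ℕ} {C : ℝ} (hC : ∀ x ∈ s, ‖iteratedFDeriv ℝ k h x‖ ≤ C) {z : E}
    (hz : z ∈ s) (hflat : ∀ j < k, iteratedFDeriv ℝ j h z = 0) :
    ∀ i ≤ k, ∀ x ∈ s, ‖iteratedFDeriv ℝ (k - i) h x‖ ≤ C * ‖x - z‖ ^ i := by
  intro i
  induction i with
  | zero => intro _ x hx; simpa using hC x hx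
  | succ i ih =>
    intro hi x hx
    have hC0 : 0 ≤ C := (norm_nonneg _).trans (hC x hx)
    have hseg : segment ℝ z x ⊆ s := hs.segment_subset hz hx
    have hd : ∀ y, DifferentiableAt ℝ (iteratedFDeriv ℝ (k - (i + 1)) h) y := fun y =>
      (hh.differentiable_iteratedFDeriv (WithTop.coe_lt_coe.2 (ENat.natCast_lt_top _))) y
    have := (convex_segment z x).norm_image_sub_le_of_norm_fderiv_le (𝕜 := ℝ)
      (f := iteratedFDeriv ℝ (k - (i + 1)) h) (C := C * ‖x - z‖ ^ i) (fun y _ => hd y) ?_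
      (left_mem_segment ℝ z x) (right_mem_segment ℝ z x)
    · rw [hflat _ (by omega), sub_zero] at this
      rwa [pow_succ, ← mul_assoc]
    · intro y hy
      rw [norm_fderiv_iteratedFDeriv, show k - (i + 1) + 1 = k - i by omega]
      refine (ih (by omega) y (hseg hy)).trans ?_
      gcongr
      obtain ⟨t, ht, rfl⟩ := (segment_eq_image' ℝ z x ▸ hy : y ∈ _)
      simp only [add_sub_cancel_left, norm_smul, Real.norm_eq_abs, abs_of_nonneg ht.1]
      exact mul_le_of_le_one_left (norm_nonneg _) ht.2

/-- A smooth map vanishing to order `k` on `S` is, with its first derivative, `O(d(·, S) ^ k)`. -/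
lemma exists_norm_le_of_flat [FiniteDimensional ℝ E] {h : E → F} (hh : ContDiff ℝ ∞ h) {S : Set E}
    (hS : IsClosed S) (h0 : (0 : E) ∈ S) {k : ℕ} {r : ℝ} (hr : 0 < r) (hr1 : r ≤ 1)
    (hflat : ∀ j ≤ k, ∀ z ∈ S, ‖z‖ ≤ 2 * r → iteratedFDeriv ℝ j h z = 0) :
    ∃ C, 0 ≤ C ∧ ∀ x, ‖x‖ ≤ r → ‖h x‖ ≤ C * infDist x S ^ k ∧
      ‖fderiv ℝ h x‖ ≤ C * infDist x S ^ k := by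
  have := FiniteDimensional.proper_real E
  obtain ⟨C, hC⟩ := (isCompact_closedBall (0 : E) (2 * r)).exists_bound_of_continuousOn
    (hh.continuous_iteratedFDeriv (m := k + 1) (by exact_mod_cast le_top)).continuousOn
  have hC0 : 0 ≤ C := (norm_nonneg _).trans (hC 0 (by simp [hr.le]))
  refine ⟨C, hC0, fun x hx => ?_⟩
  obtain ⟨z, hzS, hz⟩ := hS.exists_infDist_eq_dist ⟨0, h0⟩ x
  have hd : infDist x S ≤ ‖x‖ := by simpa using infDist_le_dist_of_mem (x := x) h0
  have hd0 := infDist_nonneg (x := x) (s := S)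
  rw [dist_eq_norm] at hz
  have hzn : ‖z‖ ≤ 2 * r := by
    have : ‖z‖ ≤ ‖x‖ + ‖x - z‖ := by rw [norm_sub_rev]; simpa using norm_add_le x (z - x)
    linarith
  have key := norm_iteratedFDeriv_le_of_flat_at hh (convex_closedBall (0 : E) (2 * r)) hC
    (z := z) (by simpa using hzn) (fun j hj => hflat j (by omega) z hzS hzn)
  have hxm : x ∈ closedBall (0 : E) (2 * r) := by simp; linarith
  constructor
  · have := key (k + 1) le_rfl x hxm
    rw [Nat.sub_self, norm_iteratedFDeriv_zero, ← hz] at this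
    refine this.trans (mul_le_mul_of_nonneg_left ?_ hC0)
    exact pow_le_pow_of_le_one hd0 (by linarith) (by omega)
  · have := key k (by omega) x hxm
    rwa [Nat.add_sub_cancel_left, norm_iteratedFDeriv_one, ← hz] at this

end Flatness

section Quotient

open Metric Set

variable {E G : Type*} [NormedAddCommGroup E] [NormedSpace ℝ E] [NormedAddCommGroup G]
  [NormedSpace ℝ G]

/-- A quotient `N / D`, where `D` vanishes at most like `d(·, S) ^ m` and `N` is of order
`d(·, S) ^ (2 m + 2)`, is globally Lipschitz. -/
lemma lipschitzWith_inv_smul {S : Set E} (hS : IsClosed S) (h0 : (0 : E) ∈ S) {r c A : ℝ}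
    (hr1 : r ≤ 1) (hc : 0 < c) (hA : 0 ≤ A) {m : ℕ} {N : E → G} {D : E → ℝ}
    (hN : Differentiable ℝ N) (hD : Differentiable ℝ D)
    (hsupp : ∀ x, r / 2 < ‖x‖ → N x = 0) (hr : 0 < r)
    (hD1 : ∀ x, ‖x‖ ≤ r → c * infDist x S ^ m ≤ D x)
    (hD2 : ∀ x, ‖x‖ ≤ r → ‖fderiv ℝ D x‖ ≤ A)
    (hN1 : ∀ x, ‖x‖ ≤ r → ‖N x‖ ≤ A * infDist x S ^ (2 * m + 2))
    (hN2 : ∀ x, ‖x‖ ≤ r → ‖fderiv ℝ N x‖ ≤ A * infDist x S ^ (2 * m + 2)) :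
    LipschitzWith ⟨A / c + A ^ 2 / c ^ 2, by positivity⟩ (fun x => (D x)⁻¹ • N x) ∧
      ∀ x, ‖(D x)⁻¹ • N x‖ ≤ A / c * infDist x S ^ 2 := by
  have hd0 : ∀ x, 0 ≤ infDist x S := fun x => infDist_nonneg
  have hd1 : ∀ x, ‖x‖ ≤ r → infDist x S ≤ 1 := fun x hx => by
    have : infDist x S ≤ ‖x‖ := by simpa using infDist_le_dist_of_mem (x := x) h0
    linarith
  have hdp : ∀ x, x ∉ S → 0 < infDist x S := fun x hx =>
    (hS.notMem_iff_infDist_pos ⟨0, h0⟩).1 hx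
  have hbound : ∀ x, ‖(D x)⁻¹ • N x‖ ≤ A / c * infDist x S ^ 2 := by
    intro x
    rcases le_or_gt ‖x‖ r with hx | hx
    · rcases eq_or_ne (infDist x S) 0 with h | h
      · have : N x = 0 := by
          have := hN1 x hx
          rw [h, zero_pow (by omega), mul_zero] at this
          exact norm_le_zero_iff.1 this
        simp [this, h]
      · have hdx := lt_of_le_of_ne (hd0 x) h.symm
        have hDx : 0 < D x := lt_of_lt_of_le (by positivity) (hD1 x hx)
        rw [norm_smul, norm_inv, Real.norm_of_nonneg hDx.le, inv_mul_le_iff₀ hDx]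
        calc ‖N x‖ ≤ A * infDist x S ^ (2 * m + 2) := hN1 x hx
          _ ≤ A * infDist x S ^ (m + 2) := by
            gcongr A * ?_
            exact pow_le_pow_of_le_one (hd0 x) (hd1 x hx) (by omega)
          _ = c * infDist x S ^ m * (A / c * infDist x S ^ 2) := by field_simp; ring
          _ ≤ _ := by gcongr; exact hD1 x hx
    · rw [hsupp x (by linarith), smul_zero, norm_zero]
      positivity
  refine ⟨?_, hbound⟩
  have hderiv : ∀ x, ∃ L : E →L[ℝ] G, HasFDerivAt (fun x => (D x)⁻¹ • N x) L x ∧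
      ‖L‖ ≤ A / c + A ^ 2 / c ^ 2 := by
    intro x
    rcases le_or_gt ‖x‖ (r / 2) with hx | hx
    · have hx : ‖x‖ ≤ r := by linarith
      by_cases hxS : x ∈ S
      · refine ⟨0, ?_, by rw [norm_zero]; positivity⟩
        rw [hasFDerivAt_iff_isLittleO_nhds_zero]
        have hx0 : (D x)⁻¹ • N x = 0 := by
          have := hbound x
          rw [infDist_zero_of_mem hxS] at this
          simpa using this
        rw [hx0]
        simp only [sub_zero, zero_apply]
        have h2 : (fun v : E => (D (x + v))⁻¹ • N (x + v)) =O[nhds 0] fun v => ‖v‖ ^ 2 := by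
          refine Asymptotics.IsBigO.of_bound (A / c) (Filter.Eventually.of_forall fun v => ?_)
          refine (hbound (x + v)).trans ?_
          rw [norm_pow, norm_norm]
          gcongr
          · exact hd0 _
          · simpa using infDist_le_dist_of_mem (x := x + v) hxS
        exact h2.trans_isLittleO (Asymptotics.isLittleO_norm_pow_id (by norm_num))
      · have hdx := hdp x hxS
        have hDx : 0 < D x := lt_of_lt_of_le (by positivity) (hD1 x hx)
        have h1 : HasFDerivAt (fun x => (D x)⁻¹) (-(D x ^ 2)⁻¹ • fderiv ℝ D x) x :=
          (hasDerivAt_inv hDx.ne').comp_hasFDerivAt x (hD x).hasFDerivAt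
        refine ⟨_, h1.smul (hN x).hasFDerivAt, ?_⟩
        refine (norm_add_le _ _).trans (add_le_add ?_ ?_)
        · rw [norm_smul, norm_inv, Real.norm_of_nonneg hDx.le, inv_mul_le_iff₀ hDx]
          calc ‖fderiv ℝ N x‖ ≤ A * infDist x S ^ (2 * m + 2) := hN2 x hx
            _ ≤ A * infDist x S ^ m := by
              gcongr A * ?_
              exact pow_le_pow_of_le_one (hd0 x) (hd1 x hx) (by omega)
            _ = c * infDist x S ^ m * (A / c) := by field_simp
            _ ≤ _ := by gcongr; exact hD1 x hx
        · rw [ContinuousLinearMap.norm_smulRight_apply, norm_smul, norm_neg, norm_inv, norm_pow,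
            Real.norm_of_nonneg hDx.le, mul_assoc, inv_mul_le_iff₀ (by positivity)]
          calc ‖fderiv ℝ D x‖ * ‖N x‖ ≤ A * (A * infDist x S ^ (2 * m + 2)) := by
                gcongr
                exacts [hD2 x hx, hN1 x hx]
            _ ≤ A * (A * infDist x S ^ (2 * m)) := by
              gcongr A * (A * ?_)
              exact pow_le_pow_of_le_one (hd0 x) (hd1 x hx) (by omega)
            _ = (c * infDist x S ^ m) ^ 2 * (A ^ 2 / c ^ 2) := by field_simp; ring
            _ ≤ _ := by gcongr; exact hD1 x hx
    · refine ⟨0, ?_, by rw [norm_zero]; positivity⟩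
      refine (hasFDerivAt_const (0 : G) x).congr_of_eventuallyEq ?_
      filter_upwards [(isOpen_lt continuous_const continuous_norm).mem_nhds hx] with y hy
      rw [hsupp y hy, smul_zero]
  refine lipschitzWith_of_nnnorm_fderiv_le (𝕜 := ℝ) (fun x => (hderiv x).choose_spec.1.differentiableAt)
    fun x => ?_
  rw [(hderiv x).choose_spec.1.fderiv]
  exact (hderiv x).choose_spec.2

end Quotient

section Determinacy

open Metric Set NNReal

variable {E F : Type*} [NormedAddCommGroup E] [InnerProductSpace ℝ E] [FiniteDimensional ℝ E]
  [NormedAddCommGroup F] [InnerProductSpace ℝ F] [FiniteDimensional ℝ F]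

/-- Homotopy method: if `q (Dφ) + ‖φ‖²` dominates a power of the distance to `S`, where
`q` measures the surjectivity of a linear map, then a perturbation of `φ` flat to high order on
`S` does not change the zero set, up to a homeomorphism fixing `S`. -/
theorem exists_homeomorph_of_elliptic {q : (E →L[ℝ] F) → ℝ} {B : (E →L[ℝ] F) → (F →L[ℝ] E)}
    (hq : ContDiff ℝ ∞ q) (hB : ContDiff ℝ ∞ B) (hqB : ∀ M v, M (B M v) = q M • v)
    {φ h : E → F} (hφ : ContDiff ℝ ∞ φ) (hh : ContDiff ℝ ∞ h) {S : Set E} (hS : IsClosed S)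
    (h0 : (0 : E) ∈ S) {c r₀ : ℝ} (hc : 0 < c) (hr₀ : 0 < r₀) {m : ℕ}
    (hell : ∀ x, ‖x‖ ≤ r₀ → c * infDist x S ^ m ≤ q (fderiv ℝ φ x) + ‖φ x‖ ^ 2)
    (hflat : ∀ j ≤ 2 * m + 2, ∀ z ∈ S, ‖z‖ ≤ r₀ → iteratedFDeriv ℝ j h z = 0) :
    ∃ σ : E ≃ₜ E, (∀ x ∈ S, σ x = x) ∧ ∃ ρ > 0, ∀ x, ‖x‖ < ρ →
      (φ x = 0 ↔ φ (σ x) - h (σ x) = 0) := by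
  have hd0 : ∀ x, 0 ≤ infDist x S := fun x => infDist_nonneg
  have hdx : ∀ x, infDist x S ≤ ‖x‖ := fun x => by
    simpa using infDist_le_dist_of_mem (x := x) h0
  set r₁ : ℝ := min (r₀ / 2) 1 with hr₁def
  have hr₁ : 0 < r₁ := by positivity
  have hr₁1 : r₁ ≤ 1 := min_le_right _ _
  have hr₁0 : 2 * r₁ ≤ r₀ := by linarith [min_le_left (r₀ / 2) 1]
  obtain ⟨C, hC0, hC⟩ := exists_norm_le_of_flat hh hS h0 hr₁ hr₁1
    (fun j hj z hz hzn => hflat j hj z hz (hzn.trans hr₁0))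
  let Φ : ℝ × E → F := fun y => φ y.2 - y.1 • h y.2
  let M : ℝ × E → E →L[ℝ] F := fun y => fderiv ℝ φ y.2 - y.1 • fderiv ℝ h y.2
  let D : ℝ × E → ℝ := fun y => q (M y) + ‖Φ y‖ ^ 2
  have hΦ : ContDiff ℝ ∞ Φ :=
    (hφ.comp contDiff_snd).sub (contDiff_fst.smul (hh.comp contDiff_snd))
  have hM : ContDiff ℝ ∞ M :=
    ((hφ.fderiv_right (m := ∞) (by simp)).comp contDiff_snd).sub
      (contDiff_fst.smul ((hh.fderiv_right (m := ∞) (by simp)).comp contDiff_snd))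
  have hD : ContDiff ℝ ∞ D := (hq.comp hM).add (hΦ.norm_sq ℝ)
  let T : Set (ℝ × E) := Icc 0 1 ×ˢ closedBall 0 r₁
  have hT : IsCompact T := isCompact_Icc.prod (isCompact_closedBall _ _)
  obtain ⟨R₁, hR₁⟩ := hT.exists_bound_of_continuousOn hM.continuous.continuousOn
  obtain ⟨R₂, hR₂⟩ := hT.exists_bound_of_continuousOn hΦ.continuous.continuousOn
  have hT0 : ((0 : ℝ), (0 : E)) ∈ T := by simp [T, hr₁.le]
  have hR₂0 : 0 ≤ R₂ := (norm_nonneg _).trans (hR₂ _ hT0)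
  let Q : (E →L[ℝ] F) × F → ℝ := fun y => q y.1 + ‖y.2‖ ^ 2
  have hQ : ContDiff ℝ ∞ Q := (hq.comp contDiff_fst).add (contDiff_snd.norm_sq ℝ)
  have : ProperSpace ((E →L[ℝ] F) × F) := FiniteDimensional.proper ℝ _
  obtain ⟨C', hC'⟩ := (isCompact_closedBall (0 : (E →L[ℝ] F) × F)
    (max R₁ R₂)).exists_bound_of_continuousOn
    (hQ.continuous_fderiv (by simp)).continuousOn
  have hC'0 : 0 ≤ C' := (norm_nonneg _).trans
    (hC' 0 (by simp [hR₂0]))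
  have hDdiff : ∀ t ∈ Icc (0 : ℝ) 1, ∀ x, ‖x‖ ≤ r₁ →
      D (0, x) - D (t, x) ≤ C' * C * infDist x S ^ (2 * m + 2) := by
    intro t ht x hx
    have hmem : ∀ t ∈ Icc (0 : ℝ) 1, (M (t, x), Φ (t, x)) ∈
        closedBall (0 : (E →L[ℝ] F) × F) (max R₁ R₂) := by
      intro t ht
      have : (t, x) ∈ T := ⟨ht, by simpa using hx⟩
      rw [mem_closedBall_zero_iff, Prod.norm_def]
      exact max_le_max (hR₁ _ this) (hR₂ _ this)
    have h1 := (convex_closedBall (0 : (E →L[ℝ] F) × F) (max R₁ R₂)).norm_image_sub_le_of_norm_fderiv_le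
      (𝕜 := ℝ) (f := Q) (fun y _ => hQ.differentiable (by simp) y) hC' (hmem t ht)
      (hmem 0 (by simp))
    have h2 : ‖(M (0, x), Φ (0, x)) - (M (t, x), Φ (t, x))‖ ≤ C * infDist x S ^ (2 * m + 2) := by
      have e1 : (M (0, x), Φ (0, x)) - (M (t, x), Φ (t, x)) =
        (t • fderiv ℝ h x, t • h x) := by simp [M, Φ]
      rw [e1, Prod.norm_def]
      refine max_le ?_ ?_
      · rw [norm_smul, Real.norm_of_nonneg ht.1]
        exact (mul_le_of_le_one_left (norm_nonneg _) ht.2).trans (hC x hx).2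
      · rw [norm_smul, Real.norm_of_nonneg ht.1]
        exact (mul_le_of_le_one_left (norm_nonneg _) ht.2).trans (hC x hx).1
    calc D (0, x) - D (t, x) ≤ ‖Q (M (0, x), Φ (0, x)) - Q (M (t, x), Φ (t, x))‖ := le_abs_self _
      _ ≤ C' * ‖(M (0, x), Φ (0, x)) - (M (t, x), Φ (t, x))‖ := h1
      _ ≤ C' * (C * infDist x S ^ (2 * m + 2)) := by gcongr
      _ = _ := by ring
  set r : ℝ := min r₁ (c / (2 * (C' * C + 1))) with hrdef
  have hr : 0 < r := by positivity
  have hrr₁ : r ≤ r₁ := min_le_left _ _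
  have hrC : C' * C * r ≤ c / 2 := by
    have h1 : r ≤ c / (2 * (C' * C + 1)) := min_le_right _ _
    rw [le_div_iff₀ (by positivity)] at h1
    nlinarith [hr, mul_nonneg hC'0 hC0]
  have hDlow : ∀ t ∈ Icc (0 : ℝ) 1, ∀ x, ‖x‖ ≤ r → c / 2 * infDist x S ^ m ≤ D (t, x) := by
    intro t ht x hx
    have h1 := hDdiff t ht x (hx.trans hrr₁)
    have h2 : c * infDist x S ^ m ≤ D (0, x) := by
      have := hell x (by linarith)
      simpa [D, M, Φ] using this
    have h3 : C' * C * infDist x S ^ (2 * m + 2) ≤ c / 2 * infDist x S ^ m := by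
      have h4 : infDist x S ^ (2 * m + 2) ≤ r * infDist x S ^ m := by
        calc infDist x S ^ (2 * m + 2) ≤ infDist x S ^ (m + 1) :=
              pow_le_pow_of_le_one (hd0 x) (by linarith [hdx x]) (by omega)
          _ = infDist x S * infDist x S ^ m := by ring
          _ ≤ _ := by
            gcongr
            · exact pow_nonneg (hd0 x) _
            · linarith [hdx x]
      calc _ ≤ C' * C * (r * infDist x S ^ m) := by gcongr
        _ = C' * C * r * infDist x S ^ m := by ring
        _ ≤ _ := mul_le_mul_of_nonneg_right hrC (pow_nonneg (hd0 x) _)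
    linarith
  let χ : ContDiffBump (0 : E) := ⟨r / 4, r / 2, by positivity, by linarith⟩
  let L : ℝ × E → F →L[ℝ] E := fun y => χ y.2 • B (M y)
  have hL : ContDiff ℝ ∞ L := (χ.contDiff.comp contDiff_snd).smul (hB.comp hM)
  obtain ⟨A₁, hA₁⟩ := hT.exists_bound_of_continuousOn hL.continuous.continuousOn
  obtain ⟨A₂, hA₂⟩ := hT.exists_bound_of_continuousOn
    (hL.continuous_fderiv (by simp)).continuousOn
  obtain ⟨A₃, hA₃⟩ := hT.exists_bound_of_continuousOn
    (hD.continuous_fderiv (by simp)).continuousOn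
  have hA₁0 : 0 ≤ A₁ := (norm_nonneg _).trans (hA₁ _ hT0)
  have hA₂0 : 0 ≤ A₂ := (norm_nonneg _).trans (hA₂ _ hT0)
  have hA₃0 : 0 ≤ A₃ := (norm_nonneg _).trans (hA₃ _ hT0)
  set A : ℝ := (A₁ + A₂) * C + A₃ with hAdef
  have hA0 : 0 ≤ A := by positivity
  let N : ℝ → E → E := fun t x => L (t, x) (h x)
  have hin : ∀ (t : ℝ) (x : E), HasFDerivAt (fun x : E => (t, x)) (ContinuousLinearMap.inr ℝ ℝ E) x :=
    fun t x => (hasFDerivAt_const t x).prodMk (hasFDerivAt_id x)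
  have hinr : ‖ContinuousLinearMap.inr ℝ ℝ E‖ ≤ 1 :=
    ContinuousLinearMap.opNorm_le_bound _ zero_le_one fun x => by simp
  have hNd : ∀ t x, HasFDerivAt (N t) ((L (t, x)).comp (fderiv ℝ h x) +
      ((fderiv ℝ L (t, x)).comp (ContinuousLinearMap.inr ℝ ℝ E)).flip (h x)) x := fun t x =>
    (((hL.differentiable (by simp) (t, x)).hasFDerivAt.comp x (hin t x))).clm_apply
      (hh.differentiable (by simp) x).hasFDerivAt
  have hDd : ∀ t x, HasFDerivAt (fun x => D (t, x))
      ((fderiv ℝ D (t, x)).comp (ContinuousLinearMap.inr ℝ ℝ E)) x := fun t x =>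
    (hD.differentiable (by simp) (t, x)).hasFDerivAt.comp x (hin t x)
  have hTm : ∀ t ∈ Icc (0 : ℝ) 1, ∀ x, ‖x‖ ≤ r → (t, x) ∈ T := fun t ht x hx =>
    ⟨ht, by simpa using hx.trans hrr₁⟩
  have hsupp : ∀ t x, r / 2 < ‖x‖ → N t x = 0 := by
    intro t x hx
    have : χ x = 0 := χ.zero_of_le_dist (by simpa [χ] using hx.le)
    simp [N, L, this]
  have hXl := fun t (ht : t ∈ Icc (0 : ℝ) 1) => lipschitzWith_inv_smul hS h0 (r := r) (c := c / 2)
    (A := A) (by linarith) (by positivity) hA0 (m := m) (N := N t) (D := fun x => D (t, x))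
    (fun x => (hNd t x).differentiableAt) (fun x => (hDd t x).differentiableAt)
    (hsupp t) hr (hDlow t ht)
    (fun x hx => by
      rw [(hDd t x).fderiv]
      refine (ContinuousLinearMap.opNorm_comp_le _ _).trans ?_
      calc _ ≤ A₃ * 1 := by gcongr; exact hA₃ _ (hTm t ht x hx)
        _ ≤ A := by rw [hAdef]; nlinarith [mul_nonneg (add_nonneg hA₁0 hA₂0) hC0])
    (fun x hx => by
      calc ‖N t x‖ ≤ ‖L (t, x)‖ * ‖h x‖ := ContinuousLinearMap.le_opNorm _ _
        _ ≤ A₁ * (C * infDist x S ^ (2 * m + 2)) := by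
          gcongr
          exacts [hA₁ _ (hTm t ht x hx), (hC x (hx.trans hrr₁)).1]
        _ = A₁ * C * infDist x S ^ (2 * m + 2) := by ring
        _ ≤ _ := mul_le_mul_of_nonneg_right (by rw [hAdef]; nlinarith [mul_nonneg hA₂0 hC0])
          (pow_nonneg (hd0 x) _))
    (fun x hx => by
      rw [(hNd t x).fderiv]
      calc _ ≤ ‖L (t, x)‖ * ‖fderiv ℝ h x‖ + ‖fderiv ℝ L (t, x)‖ * 1 * ‖h x‖ := by
            refine (norm_add_le _ _).trans (add_le_add (ContinuousLinearMap.opNorm_comp_le _ _) ?_)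
            refine (ContinuousLinearMap.le_opNorm _ _).trans ?_
            gcongr
            rw [ContinuousLinearMap.opNorm_flip]
            refine (ContinuousLinearMap.opNorm_comp_le _ _).trans ?_
            gcongr
        _ ≤ A₁ * (C * infDist x S ^ (2 * m + 2)) + A₂ * 1 * (C * infDist x S ^ (2 * m + 2)) := by
          gcongr
          exacts [hA₁ _ (hTm t ht x hx), (hC x (hx.trans hrr₁)).2, hA₂ _ (hTm t ht x hx),
            (hC x (hx.trans hrr₁)).1]
        _ = (A₁ + A₂) * C * infDist x S ^ (2 * m + 2) := by ring
        _ ≤ _ := mul_le_mul_of_nonneg_right (by rw [hAdef]; linarith) (pow_nonneg (hd0 x) _))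
  let X : ℝ → E → E := fun t x => (D (t, x))⁻¹ • N t x
  have hh0 : ∀ x, ‖x‖ ≤ r → infDist x S = 0 → h x = 0 := by
    intro x hx hdx
    have := (hC x (hx.trans hrr₁)).1
    rw [hdx, zero_pow (by omega), mul_zero] at this
    exact norm_le_zero_iff.1 this
  have hX0 : ∀ t, ∀ x ∈ S, X t x = 0 := by
    intro t x hx
    rcases le_or_gt ‖x‖ (r / 2) with hxr | hxr
    · simp [X, N, hh0 x (by linarith) (infDist_zero_of_mem hx)]
    · simp [X, hsupp t x hxr]
  have hXb : ∀ t ∈ Icc (0 : ℝ) 1, ∀ x, ‖X t x‖ ≤ (⟨A / (c / 2), by positivity⟩ : ℝ≥0) := by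
    intro t ht x
    rcases le_or_gt ‖x‖ (r / 2) with hxr | hxr
    · refine ((hXl t ht).2 x).trans ?_
      change A / (c / 2) * infDist x S ^ 2 ≤ A / (c / 2)
      refine mul_le_of_le_one_right (by positivity) (pow_le_one₀ (hd0 x) ?_)
      linarith [hdx x]
    · simp only [X, hsupp t x hxr, smul_zero, norm_zero]
      positivity
  have hXc : ∀ x, ContinuousOn (fun t => X t x) (Icc 0 1) := by
    intro x
    rcases le_or_gt ‖x‖ (r / 2) with hxr | hxr
    · by_cases hxS : x ∈ S
      · simp only [hX0 _ x hxS]; exact continuousOn_const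
      · have hdp := (hS.notMem_iff_infDist_pos ⟨0, h0⟩).1 hxS
        have c1 : Continuous fun t : ℝ => D (t, x) := hD.continuous.comp (by fun_prop)
        have c2 : Continuous fun t : ℝ => L (t, x) := hL.continuous.comp (by fun_prop)
        refine (c1.continuousOn.inv₀ fun t ht => ?_).smul (c2.clm_apply continuous_const).continuousOn
        exact (lt_of_lt_of_le (by positivity) (hDlow t ht x (by linarith))).ne'
    · simp only [X, hsupp _ x hxr, smul_zero]; exact continuousOn_const
  obtain ⟨σ, hσ⟩ := exists_homeomorph_of_isUnitCurve (fun t ht => (hXl t ht).1) hXc hXb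
  have hconst : ∀ z ∈ S, IsUnitCurve X fun _ => z := fun z hz t _ => by
    rw [hX0 t z hz]; exact hasDerivWithinAt_const _ _ _
  refine ⟨σ, fun z hz => ?_, ?_⟩
  · obtain ⟨γ, γ0, γ1, hγ⟩ := hσ z
    have := hγ.dist_le (fun t ht => (hXl t ht).1) (hconst z hz) (t := 1) (by simp)
    rw [γ0, dist_self, zero_mul, γ1] at this
    exact dist_le_zero.1 this
  set K : ℝ≥0 := ⟨A / (c / 2) + A ^ 2 / (c / 2) ^ 2, by positivity⟩
  refine ⟨r / 4 * Real.exp (-K), by positivity, fun x hx => ?_⟩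
  obtain ⟨γ, γ0, γ1, hγ⟩ := hσ x
  have hγr : ∀ t ∈ Icc (0 : ℝ) 1, ‖γ t‖ ≤ r / 4 := by
    intro t ht
    have := hγ.dist_le (fun t ht => (hXl t ht).1) (hconst 0 h0) ht
    rw [γ0, dist_zero_right, dist_zero_right] at this
    refine this.trans ?_
    calc ‖x‖ * Real.exp K ≤ r / 4 * Real.exp (-K) * Real.exp K := by gcongr
      _ = r / 4 := by rw [mul_assoc, ← Real.exp_add]; simp
  have hu : ∀ t ∈ Icc (0 : ℝ) 1, HasDerivWithinAt (fun t => Φ (t, γ t))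
      (M (t, γ t) (X t (γ t)) - h (γ t)) (Icc 0 1) t := by
    intro t ht
    have e1 := (hφ.differentiable (by simp) (γ t)).hasFDerivAt.comp_hasDerivWithinAt t (hγ t ht)
    have e2 := (hh.differentiable (by simp) (γ t)).hasFDerivAt.comp_hasDerivWithinAt t (hγ t ht)
    refine (e1.sub ((hasDerivWithinAt_id t _).smul e2)).congr_deriv ?_
    simp only [M, X, map_smul, sub_apply, smul_apply, one_smul, id, Function.comp_apply]
    module
  have hub : ∀ t ∈ Icc (0 : ℝ) 1, ‖M (t, γ t) (X t (γ t)) - h (γ t)‖ ≤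
      R₂ * (C / (c / 2)) * ‖Φ (t, γ t)‖ := by
    intro t ht
    have hγt := hγr t ht
    have hlow := hDlow t ht (γ t) (by linarith)
    have hDn : 0 ≤ D (t, γ t) := le_trans (by have := hd0 (γ t); positivity) hlow
    rcases hDn.eq_or_lt with hz | hpos
    · have hd : infDist (γ t) S = 0 := by
        by_contra hne
        have := lt_of_le_of_ne (hd0 (γ t)) (Ne.symm hne)
        have : 0 < c / 2 * infDist (γ t) S ^ m := by positivity
        linarith
      have hhz := hh0 (γ t) (by linarith) hd
      simp only [X, N, hhz, map_zero, smul_zero, sub_zero, norm_zero]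
      positivity
    · have hχ : χ (γ t) = 1 := χ.one_of_mem_closedBall (by simpa [χ] using hγt)
      have e1 : M (t, γ t) (X t (γ t)) - h (γ t) =
          -((D (t, γ t))⁻¹ * ‖Φ (t, γ t)‖ ^ 2) • h (γ t) := by
        have : M (t, γ t) (X t (γ t)) = ((D (t, γ t))⁻¹ * q (M (t, γ t))) • h (γ t) := by
          simp only [X, N, L, hχ, one_smul, map_smul, hqB, smul_smul]
        rw [this]
        nth_rw 2 [← one_smul ℝ (h (γ t))]
        rw [← sub_smul]
        congr 1
        have : q (M (t, γ t)) = D (t, γ t) - ‖Φ (t, γ t)‖ ^ 2 := by simp [D]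
        rw [this]
        field_simp
        ring
      rw [e1, norm_smul, norm_neg, norm_mul, norm_inv, Real.norm_of_nonneg hDn, norm_pow, norm_norm,
        mul_assoc, inv_mul_le_iff₀ hpos]
      have hdm : infDist (γ t) S ^ (2 * m + 2) ≤ infDist (γ t) S ^ m :=
        pow_le_pow_of_le_one (hd0 _) (by linarith [hdx (γ t)]) (by omega)
      calc ‖Φ (t, γ t)‖ ^ 2 * ‖h (γ t)‖
          ≤ ‖Φ (t, γ t)‖ ^ 2 * (C * infDist (γ t) S ^ m) := by
            gcongr
            exact ((hC _ (by linarith)).1).trans (by gcongr)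
        _ = (c / 2 * infDist (γ t) S ^ m) * (‖Φ (t, γ t)‖ * (C / (c / 2)) * ‖Φ (t, γ t)‖) := by
          field_simp
        _ ≤ D (t, γ t) * (R₂ * (C / (c / 2)) * ‖Φ (t, γ t)‖) := by
          gcongr
          exact hR₂ _ (hTm t ht _ (by linarith))
  have := eq_zero_iff_of_norm_deriv_le hu hub
  simpa [Φ, γ0, γ1] using this

end Determinacy

section Minors

variable {n p : ℕ}

/-- The square submatrix of a linear map with columns `ι`. -/
noncomputable def minorMatrix (ι : Fin p → Fin n)
    (M : EuclideanSpace ℝ (Fin n) →L[ℝ] EuclideanSpace ℝ (Fin p)) : Matrix (Fin p) (Fin p) ℝ :=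
  Matrix.of fun j k => M (EuclideanSpace.single (ι k) 1) j

/-- The sum of the squares of all maximal minors. -/
noncomputable def minorSq (M : EuclideanSpace ℝ (Fin n) →L[ℝ] EuclideanSpace ℝ (Fin p)) : ℝ :=
  ∑ ι : Fin p → Fin n, (minorMatrix ι M).det ^ 2

/-- A right inverse of `M` up to the factor `minorSq M`. -/
noncomputable def minorInv (M : EuclideanSpace ℝ (Fin n) →L[ℝ] EuclideanSpace ℝ (Fin p)) :
    EuclideanSpace ℝ (Fin p) →L[ℝ] EuclideanSpace ℝ (Fin n) :=
  ∑ ι : Fin p → Fin n, ∑ k, ∑ j, ((minorMatrix ι M).det * (minorMatrix ι M).adjugate k j) •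
    (EuclideanSpace.proj j : EuclideanSpace ℝ (Fin p) →L[ℝ] ℝ).smulRight
      (EuclideanSpace.single (ι k) (1 : ℝ))

lemma contDiff_matrix_det {X : Type*} [NormedAddCommGroup X] [NormedSpace ℝ X]
    {A : X → Matrix (Fin p) (Fin p) ℝ} (hA : ∀ i j, ContDiff ℝ ∞ fun x => A x i j) :
    ContDiff ℝ ∞ fun x => (A x).det := by
  simp only [Matrix.det_apply']
  exact ContDiff.sum fun σ _ => contDiff_const.mul (contDiff_prod fun i _ => hA _ _)

lemma contDiff_matrix_adjugate {X : Type*} [NormedAddCommGroup X] [NormedSpace ℝ X]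
    {A : X → Matrix (Fin p) (Fin p) ℝ} (hA : ∀ i j, ContDiff ℝ ∞ fun x => A x i j) (k j : Fin p) :
    ContDiff ℝ ∞ fun x => (A x).adjugate k j := by
  simp only [Matrix.adjugate_apply]
  refine contDiff_matrix_det fun i l => ?_
  simp only [Matrix.updateRow_apply]
  split_ifs
  · exact contDiff_const
  · exact hA i l

lemma contDiff_minorMatrix (ι : Fin p → Fin n) (j k : Fin p) :
    ContDiff ℝ ∞ fun M : EuclideanSpace ℝ (Fin n) →L[ℝ] EuclideanSpace ℝ (Fin p) =>
      minorMatrix ι M j k := by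
  have : ContDiff ℝ ∞ fun M : EuclideanSpace ℝ (Fin n) →L[ℝ] EuclideanSpace ℝ (Fin p) =>
      (EuclideanSpace.proj j : EuclideanSpace ℝ (Fin p) →L[ℝ] ℝ)
        (M (EuclideanSpace.single (ι k) 1)) :=
    (ContinuousLinearMap.contDiff _).comp (contDiff_id.clm_apply contDiff_const)
  exact this

lemma contDiff_minorSq : ContDiff ℝ ∞ (minorSq (n := n) (p := p)) :=
  ContDiff.sum fun ι _ => (contDiff_matrix_det fun _ _ => contDiff_minorMatrix ι _ _).pow 2

lemma contDiff_minorInv : ContDiff ℝ ∞ (minorInv (n := n) (p := p)) :=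
  ContDiff.sum fun ι _ => ContDiff.sum fun k _ => ContDiff.sum fun j _ =>
    ((contDiff_matrix_det fun _ _ => contDiff_minorMatrix ι _ _).mul
      (contDiff_matrix_adjugate (fun _ _ => contDiff_minorMatrix ι _ _) k j)).smul contDiff_const

lemma apply_minorInv (M : EuclideanSpace ℝ (Fin n) →L[ℝ] EuclideanSpace ℝ (Fin p))
    (v : EuclideanSpace ℝ (Fin p)) : M (minorInv M v) = minorSq M • v := by
  ext i
  have key : ∀ ι : Fin p → Fin n, ∑ k, ∑ j,
      (minorMatrix ι M).det * (minorMatrix ι M).adjugate k j * v j *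
        minorMatrix ι M i k = (minorMatrix ι M).det ^ 2 * v i := by
    intro ι
    have h1 := congrFun (congrArg (fun A => Matrix.mulVec A v.ofLp)
      (Matrix.mul_adjugate (minorMatrix ι M))) i
    simp only [Matrix.smul_mulVec, Matrix.one_mulVec, Pi.smul_apply, smul_eq_mul] at h1
    rw [sq, mul_assoc, ← h1, Finset.sum_comm, Matrix.mulVec, dotProduct, Finset.mul_sum]
    refine Finset.sum_congr rfl fun j _ => ?_
    rw [Matrix.mul_apply, Finset.sum_mul, Finset.mul_sum]
    refine Finset.sum_congr rfl fun k _ => by ring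
  simp only [minorInv, minorSq, sum_apply, map_sum, WithLp.ofLp_sum,
    Finset.sum_apply, PiLp.smul_apply, smul_eq_mul, Finset.sum_mul, ← key]
  refine Finset.sum_congr rfl fun ι _ => Finset.sum_congr rfl fun k _ =>
    Finset.sum_congr rfl fun j _ => ?_
  simp [minorMatrix]
  ring

end Minors

section Extension

open Filter Topology Metric

lemma exists_contDiff_eventuallyEq {E F : Type*} [NormedAddCommGroup E] [InnerProductSpace ℝ E]
    [FiniteDimensional ℝ E] [NormedAddCommGroup F] [NormedSpace ℝ F] {f : E → F} {U : Set E}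
    (hU : U ∈ 𝓝 0) (hf : ContDiffOn ℝ ∞ f U) :
    ∃ f' : E → F, ContDiff ℝ ∞ f' ∧ f' =ᶠ[𝓝 0] f := by
  obtain ⟨r, hr, hrU⟩ := Metric.mem_nhds_iff.1 hU
  let χ : ContDiffBump (0 : E) := ⟨r / 4, r / 2, by positivity, by linarith⟩
  refine ⟨fun x => χ x • f x, contDiff_iff_contDiffAt.2 fun x => ?_, ?_⟩
  · by_cases hx : ‖x‖ < r
    · have hxU : U ∈ 𝓝 x :=
        mem_of_superset (isOpen_ball.mem_nhds (mem_ball_zero_iff.2 hx)) hrU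
      exact χ.contDiff.contDiffAt.smul (hf.contDiffAt hxU)
    · refine (contDiffAt_const (c := 0)).congr_of_eventuallyEq ?_
      have hx' : r / 2 < ‖x‖ := by linarith
      filter_upwards [(isOpen_lt continuous_const continuous_norm).mem_nhds hx'] with y hy
      rw [χ.zero_of_le_dist (by simpa [χ] using hy.le), zero_smul]
  · filter_upwards [χ.eventuallyEq_one] with x hx
    simp [hx]

end Extension

section Sufficiency

open Filter Topology Metric Set

variable {n p : ℕ}

lemma IKElliptic.exists_minorSq_lower_bound {S : Set (EuclideanSpace ℝ (Fin n))} (h0S : 0 ∈ S)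
    {φ : EuclideanSpace ℝ (Fin n) → EuclideanSpace ℝ (Fin p)} (h : IKElliptic n p S φ) :
    ∃ c > 0, ∃ m : ℕ, ∀ᶠ x in 𝓝 0, c * infDist x S ^ m ≤ minorSq (fderiv ℝ φ x) + ‖φ x‖ ^ 2 := by
  classical
  obtain ⟨U, hU, a, b, ha, hb, C, hC, α, hα, hell⟩ := h
  let R : EuclideanSpace ℝ (Fin n) → ℝ := fun x => ∑ j, a j x ^ 2 + ∑ ι, b ι x ^ 2
  have hR : ContinuousAt R 0 :=
    (tendsto_finsetSum _ fun j _ => (((ha j).contDiffAt hU).continuousAt.pow 2)).add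
      (tendsto_finsetSum _ fun ι _ => (((hb ι).contDiffAt hU).continuousAt.pow 2))
  have hR0 : 0 ≤ R 0 := by positivity
  refine ⟨C ^ 2 / (2 * (R 0 + 1)), by positivity, 2 * ⌈α⌉₊, ?_⟩
  filter_upwards [hU, hR.eventually (gt_mem_nhds (lt_add_one (R 0))),
    ball_mem_nhds (0 : EuclideanSpace ℝ (Fin n)) one_pos] with x hxU hxR hx1
  have hd0 : 0 ≤ infDist x S := infDist_nonneg
  have hd1 : infDist x S ≤ 1 := by
    have : infDist x S ≤ ‖x‖ := by simpa using infDist_le_dist_of_mem (x := x) h0S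
    linarith [mem_ball_zero_iff.1 hx1]
  have h1 : C * infDist x S ^ ⌈α⌉₊ ≤ _ := le_trans (by
    gcongr
    rw [← Real.rpow_natCast]
    exact Real.rpow_le_rpow_of_exponent_ge' hd0 hd1 hα.le (Nat.le_ceil α)) (hell x hxU)
  have h2 := pow_le_pow_left₀ (by positivity) h1 2
  rw [sq_abs] at h2
  set A := ∑ j, a j x * φ x j
  have hB : (∑ ι : Fin p → Fin n, if StrictMono ι then b ι x * kGen n p φ ι x else 0) =
      ∑ ι : Fin p → Fin n, (if StrictMono ι then b ι x else 0) * kGen n p φ ι x :=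
    Finset.sum_congr rfl fun ι _ => by split_ifs <;> simp
  rw [hB] at h2
  set B := ∑ ι : Fin p → Fin n, (if StrictMono ι then b ι x else 0) * kGen n p φ ι x
  have hA2 : A ^ 2 ≤ (∑ j, a j x ^ 2) * ‖φ x‖ ^ 2 := by
    rw [EuclideanSpace.norm_sq_eq]
    simpa using Finset.sum_mul_sq_le_sq_mul_sq Finset.univ (fun j => a j x) (fun j => φ x j)
  have hB2 : B ^ 2 ≤ (∑ ι, b ι x ^ 2) * minorSq (fderiv ℝ φ x) := by
    refine (Finset.sum_mul_sq_le_sq_mul_sq Finset.univ _ _).trans ?_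
    have : minorSq (fderiv ℝ φ x) = ∑ ι, kGen n p φ ι x ^ 2 := rfl
    rw [this]
    refine mul_le_mul_of_nonneg_right (Finset.sum_le_sum fun ι _ => ?_)
      (Finset.sum_nonneg fun _ _ => sq_nonneg _)
    split_ifs
    · exact le_rfl
    · simpa using sq_nonneg (b ι x)
  have hq0 : 0 ≤ minorSq (fderiv ℝ φ x) := Finset.sum_nonneg fun _ _ => sq_nonneg _
  have hRle : ∑ j, a j x ^ 2 ≤ R 0 + 1 ∧ ∑ ι, b ι x ^ 2 ≤ R 0 + 1 := by
    have e1 : 0 ≤ ∑ j, a j x ^ 2 := Finset.sum_nonneg fun _ _ => sq_nonneg _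
    have e2 : 0 ≤ ∑ ι, b ι x ^ 2 := Finset.sum_nonneg fun _ _ => sq_nonneg _
    simp only [R] at hxR ⊢
    constructor <;> linarith
  have h3 : C ^ 2 * infDist x S ^ (2 * ⌈α⌉₊) ≤
      2 * (R 0 + 1) * (minorSq (fderiv ℝ φ x) + ‖φ x‖ ^ 2) := by
    have e1 := hA2.trans (mul_le_mul_of_nonneg_right hRle.1 (sq_nonneg ‖φ x‖))
    have e2 := hB2.trans (mul_le_mul_of_nonneg_right hRle.2 hq0)
    calc _ = (C * infDist x S ^ ⌈α⌉₊) ^ 2 := by ring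
      _ ≤ (A + B) ^ 2 := h2
      _ ≤ 2 * (A ^ 2 + B ^ 2) := by nlinarith [sq_nonneg (A - B)]
      _ ≤ _ := by linarith
  rw [div_mul_eq_mul_div, div_le_iff₀ (by positivity)]
  linarith

theorem IKElliptic.finitelySVDetermined {S : Set (EuclideanSpace ℝ (Fin n))} (hS : IsClosed S)
    (h0S : 0 ∈ S) {φ : EuclideanSpace ℝ (Fin n) → EuclideanSpace ℝ (Fin p)}
    {U : Set (EuclideanSpace ℝ (Fin n))} (hU : U ∈ 𝓝 0) (hφ : ContDiffOn ℝ ∞ φ U)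
    (h : IKElliptic n p S φ) : FinitelySVDetermined n p S φ := by
  obtain ⟨c, hc, m, hm⟩ := h.exists_minorSq_lower_bound h0S
  obtain ⟨φ', hφ', hφe⟩ := exists_contDiff_eventuallyEq hU hφ
  refine ⟨2 * m + 2, by omega, fun g ⟨W, hW, hg⟩ _ ⟨W', hW', hflat⟩ => ?_⟩
  obtain ⟨g', hg', hge⟩ := exists_contDiff_eventuallyEq hW hg
  have hev : ∀ᶠ x in 𝓝 (0 : EuclideanSpace ℝ (Fin n)), x ∈ W' ∧ φ' =ᶠ[𝓝 x] φ ∧ g' =ᶠ[𝓝 x] g ∧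
      c * infDist x S ^ m ≤ minorSq (fderiv ℝ φ x) + ‖φ x‖ ^ 2 :=
    (Filter.eventually_mem_set.2 hW').and
      (hφe.eventuallyEq_nhds.and (hge.eventuallyEq_nhds.and hm))
  obtain ⟨r, hr, hball⟩ := Metric.eventually_nhds_iff_ball.1 hev
  have hrb : ∀ x : EuclideanSpace ℝ (Fin n), ‖x‖ ≤ r / 2 → x ∈ ball 0 r := fun x hx => by
    rw [mem_ball_zero_iff]; linarith
  obtain ⟨σ, hσS, ρ, hρ, hσ⟩ := exists_homeomorph_of_elliptic contDiff_minorSq contDiff_minorInv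
    apply_minorInv hφ' (hφ'.sub hg') hS h0S hc (r₀ := r / 2) (by positivity) (m := m)
    (fun x hx => by
      obtain ⟨-, h1, -, h2⟩ := hball x (hrb x hx)
      rwa [h1.fderiv_eq, h1.eq_of_nhds])
    (fun j hj z hz hzr => by
      obtain ⟨h0, h1, h2, -⟩ := hball z (hrb z hzr)
      have : (φ' - g') =ᶠ[𝓝 z] fun y => φ y - g y := h1.sub h2
      exact (this.iteratedFDeriv ℝ j).eq_of_nhds.trans (hflat j hj z ⟨hz, h0⟩))
  have hσ0 : σ 0 = 0 := hσS 0 h0S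
  let V : Set (EuclideanSpace ℝ (Fin n)) := ball 0 (min ρ r) ∩ σ ⁻¹' ball 0 r
  have hV : V ∈ 𝓝 0 := by
    refine inter_mem (ball_mem_nhds _ (by positivity)) (σ.continuous.continuousAt.preimage_mem_nhds ?_)
    rw [hσ0]
    exact ball_mem_nhds _ hr
  have hV' : σ '' V ∈ 𝓝 0 := by
    have := σ.isOpenMap.image_mem_nhds hV
    rwa [hσ0] at this
  refine ⟨V, hV, σ '' V, hV', σ, σ.symm, σ.continuous.continuousOn, σ.symm.continuous.continuousOn,
    σ.injective.injOn.bijOn_image, fun x _ => σ.symm_apply_apply x, fun x _ => σ.apply_symm_apply x,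
    hσ0, fun x hx => hσS x hx.1, ?_⟩
  have key : ∀ x ∈ V, φ x = 0 ↔ g (σ x) = 0 := by
    intro x hx
    have hx1 := mem_ball_zero_iff.1 hx.1
    have h1 := (hball x (mem_ball_zero_iff.2 (hx1.trans_le (min_le_right _ _)))).2.1.eq_of_nhds
    have h2 := (hball (σ x) hx.2).2.2.1.eq_of_nhds
    rw [← h1, ← h2, hσ x (hx1.trans_le (min_le_left _ _))]
    simp
  ext y
  constructor
  · rintro ⟨x, ⟨hx, hxV⟩, rfl⟩
    exact ⟨(key x hxV).1 hx, mem_image_of_mem _ hxV⟩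
  · rintro ⟨hy, x, hxV, rfl⟩
    exact ⟨x, ⟨(key x hxV).2 hy, hxV⟩, rfl⟩

end Sufficiency

section Transversality

open Module

variable {E : Type*} [NormedAddCommGroup E] [NormedSpace ℝ E] [FiniteDimensional ℝ E]

/-- A generic affine perturbation `f + θ (A + c)` has independent differentials at its zeros
outside the zero set of `θ`. -/
theorem exists_affine_perturbation_regular {q : ℕ} {f : Fin (q + 1) → E → ℝ}
    (hf : ∀ j, ContDiff ℝ ∞ (f j)) {θ : E → ℝ} (hθ : ContDiff ℝ ∞ θ) :
    ∃ (A : Fin (q + 1) → E →L[ℝ] ℝ) (c : Fin (q + 1) → ℝ), ∀ x, θ x ≠ 0 →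
      (∀ j, f j x + θ x * (A j x + c j) = 0) → ∀ w : Fin (q + 1) → ℝ,
        ∑ j, w j • fderiv ℝ (fun y => f j y + θ y * (A j y + c j)) x = 0 → w = 0 := by
  let s : Set (E × (Fin q → ℝ) × (Fin q → E →L[ℝ] ℝ)) := {z | θ z.1 ≠ 0}
  have hs : IsOpen s := isOpen_ne_fun (hθ.continuous.comp continuous_fst) continuous_const
  let L : Fin (q + 1) → E → E →L[ℝ] ℝ := fun j x =>
    (θ x)⁻¹ • ((f j x / θ x) • fderiv ℝ θ x - fderiv ℝ (f j) x)
  let R : Fin (q + 1) → Fin (q + 1) → (E × (Fin q → ℝ) × (Fin q → E →L[ℝ] ℝ)) → E →L[ℝ] ℝ :=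
    fun j i z => L i z.1 + Fin.insertNth (α := fun _ => E →L[ℝ] ℝ) j
      (-∑ l, z.2.1 l • z.2.2 l) z.2.2 i
  let Ψ : Fin (q + 1) → (E × (Fin q → ℝ) × (Fin q → E →L[ℝ] ℝ)) →
      (Fin (q + 1) → E →L[ℝ] ℝ) × (Fin (q + 1) → ℝ) :=
    fun j z => (fun i => R j i z, fun i => -(f i z.1 / θ z.1) - R j i z z.1)
  have hle : (1 : WithTop ℕ∞) ≤ ∞ := by exact_mod_cast le_top
  have hθ1 : ContDiffOn ℝ 1 (fun z : E × (Fin q → ℝ) × (Fin q → E →L[ℝ] ℝ) => θ z.1) s :=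
    ((hθ.of_le (by exact_mod_cast le_top)).comp contDiff_fst).contDiffOn
  have hf1 : ∀ i, ContDiffOn ℝ 1
      (fun z : E × (Fin q → ℝ) × (Fin q → E →L[ℝ] ℝ) => f i z.1) s := fun i =>
    (((hf i).of_le (by exact_mod_cast le_top)).comp contDiff_fst).contDiffOn
  have hL : ∀ i, ContDiffOn ℝ 1
      (fun z : E × (Fin q → ℝ) × (Fin q → E →L[ℝ] ℝ) => L i z.1) s := fun i =>
    (hθ1.inv fun z hz => hz).smul ((((hf1 i).div hθ1 fun z hz => hz).smul
      ((((hθ.fderiv_right (m := ∞) (by simp)).of_le hle).comp contDiff_fst).contDiffOn)).sub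
      (((((hf i).fderiv_right (m := ∞) (by simp)).of_le hle).comp contDiff_fst).contDiffOn))
  have hR : ∀ j i, ContDiffOn ℝ 1 (R j i) s := by
    intro j i
    refine (hL i).add ?_
    have hp : ∀ l, ContDiff ℝ 1
        (fun z : E × (Fin q → ℝ) × (Fin q → E →L[ℝ] ℝ) => z.2.2 l) := fun l =>
      (contDiff_apply ℝ (E →L[ℝ] ℝ) l).comp (contDiff_snd.comp contDiff_snd)
    have hw : ∀ l, ContDiff ℝ 1
        (fun z : E × (Fin q → ℝ) × (Fin q → E →L[ℝ] ℝ) => z.2.1 l) := fun l =>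
      (contDiff_apply ℝ ℝ l).comp (contDiff_fst.comp contDiff_snd)
    obtain rfl | ⟨l, rfl⟩ := j.eq_self_or_eq_succAbove i
    · simp only [Fin.insertNth_apply_same]
      exact (ContDiff.sum fun l _ => (hw l).smul (hp l)).neg.contDiffOn
    · simp only [Fin.insertNth_apply_succAbove]
      exact (hp l).contDiffOn
  have hΨ : ∀ j, ContDiffOn ℝ 1 (Ψ j) s := fun j =>
    (contDiffOn_pi.2 fun i => hR j i).prodMk (contDiffOn_pi.2 fun i =>
      ((hf1 i).div hθ1 fun z hz => hz).neg.sub ((hR j i).clm_apply contDiff_fst.contDiffOn))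
  have hV : finrank ℝ (E →L[ℝ] ℝ) = finrank ℝ E := by
    rw [← (LinearMap.toContinuousLinearMap (𝕜 := ℝ) (E := E) (F' := ℝ)).finrank_eq]
    exact Subspace.dual_finrank_eq
  have hdim : dimH (⋃ j, Ψ j '' s) <
      finrank ℝ ((Fin (q + 1) → E →L[ℝ] ℝ) × (Fin (q + 1) → ℝ)) := by
    rw [dimH_iUnion]
    refine lt_of_le_of_lt (iSup_le fun j => (hΨ j).dimH_image_le_finrank hs) ?_
    rw [Nat.cast_lt]
    simp only [finrank_prod, finrank_pi_fintype, finrank_self, hV, Finset.sum_const,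
      Finset.card_univ, Fintype.card_fin, smul_eq_mul]
    nlinarith
  obtain ⟨⟨A, c⟩, hAc⟩ := (dense_compl_of_dimH_lt_finrank hdim).nonempty
  refine ⟨A, c, fun x hx h0 w hw => ?_⟩
  by_contra hw0
  obtain ⟨j, hj⟩ := Function.ne_iff.1 hw0
  rw [Pi.zero_apply] at hj
  refine hAc (Set.mem_iUnion.2 ⟨j, ⟨x, fun l => w (j.succAbove l) / w j,
    fun l => A (j.succAbove l) - L (j.succAbove l) x⟩, hx, ?_⟩)
  have hD : ∀ i, fderiv ℝ (fun y => f i y + θ y * (A i y + c i)) x = θ x • (A i - L i x) := by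
    intro i
    have h1 : HasFDerivAt (fun y => f i y + θ y * (A i y + c i))
        (fderiv ℝ (f i) x + (θ x • A i + (A i x + c i) • fderiv ℝ θ x)) x :=
      (((hf i).differentiable (by simp)) x).hasFDerivAt.add
        (((hθ.differentiable (by simp)) x).hasFDerivAt.mul ((A i).hasFDerivAt.add_const (c i)))
    rw [h1.fderiv]
    have h2 : A i x + c i = -(f i x / θ x) := by
      field_simp
      linarith [h0 i]
    rw [h2]
    simp only [L]
    rw [smul_sub, smul_inv_smul₀ hx]
    module
  simp only [hD] at hw
  have hw' : ∑ i, w i • (A i - L i x) = 0 := by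
    have : θ x • ∑ i, w i • (A i - L i x) = 0 := by
      rw [Finset.smul_sum, ← hw]
      exact Finset.sum_congr rfl fun i _ => smul_comm _ _ _
    exact (smul_eq_zero.1 this).resolve_left hx
  rw [Fin.sum_univ_succAbove _ j] at hw'
  have hA : ∀ i, R j i (x, fun l => w (j.succAbove l) / w j,
      fun l => A (j.succAbove l) - L (j.succAbove l) x) = A i := by
    intro i
    simp only [R]
    obtain rfl | ⟨l, rfl⟩ := j.eq_self_or_eq_succAbove i
    · rw [Fin.insertNth_apply_same]
      have : A i - L i x =
          -∑ l, (w (i.succAbove l) / w i) • (A (i.succAbove l) - L (i.succAbove l) x) := by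
        rw [← smul_right_injective _ hj |>.eq_iff, smul_neg, Finset.smul_sum]
        simp only [smul_smul, mul_div_cancel₀ _ hj]
        exact eq_neg_of_add_eq_zero_left hw'
      rw [← this]
      abel
    · rw [Fin.insertNth_apply_succAbove]
      abel
  refine Prod.ext (funext hA) (funext fun i => ?_)
  simp only [Ψ, hA]
  field_simp
  linarith [h0 i]

end Transversality

section Clean

variable {E F : Type*} [NormedAddCommGroup E] [NormedSpace ℝ E] [NormedAddCommGroup F]
  [NormedSpace ℝ F]

lemma iteratedFDeriv_pow_eq_zero {f : E → ℝ} (hf : ContDiff ℝ ∞ f) {x : E} (hx : f x = 0)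
    {j k : ℕ} (hj : j < k) : iteratedFDeriv ℝ j (fun y => f y ^ k) x = 0 := by
  induction k generalizing j with
  | zero => omega
  | succ k ih =>
    rw [← norm_le_zero_iff]
    simp only [pow_succ']
    refine (norm_iteratedFDeriv_mul_le (N := ∞) hf (hf.pow k) x
      (by exact_mod_cast le_top)).trans (le_of_eq (Finset.sum_eq_zero fun i hi => ?_))
    rcases Nat.eq_zero_or_pos i with rfl | hi0
    · simp [hx]
    · have := Finset.mem_range.1 hi
      rw [ih (by omega), norm_zero, mul_zero]

lemma iteratedFDeriv_pow_smul_eq_zero {f : E → ℝ} (hf : ContDiff ℝ ∞ f) {h : E → F}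
    (hh : ContDiff ℝ ∞ h) {x : E} (hx : f x = 0) {j k : ℕ} (hj : j < k) :
    iteratedFDeriv ℝ j (fun y => f y ^ k • h y) x = 0 := by
  rw [← norm_le_zero_iff]
  refine (norm_iteratedFDeriv_smul_le (N := ∞) (hf.pow k) hh x
    (by exact_mod_cast le_top)).trans (le_of_eq (Finset.sum_eq_zero fun i hi => ?_))
  have := Finset.mem_range.1 hi
  rw [iteratedFDeriv_pow_eq_zero hf hx (by omega), norm_zero, mul_zero, zero_mul]

/-- Every map has a perturbation that is flat to order `k` on `S` and submersive at its zeros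
outside `S`. -/
theorem exists_perturbation_regular {n p : ℕ} (hp : 1 ≤ p) {S : Set (EuclideanSpace ℝ (Fin n))}
    (hS : IsClosed S) {φ : EuclideanSpace ℝ (Fin n) → EuclideanSpace ℝ (Fin p)}
    (hφ : ContDiff ℝ ∞ φ) (k : ℕ) :
    ∃ g : EuclideanSpace ℝ (Fin n) → EuclideanSpace ℝ (Fin p), ContDiff ℝ ∞ g ∧
      (∀ j ≤ k, ∀ x ∈ S, iteratedFDeriv ℝ j (fun y => φ y - g y) x = 0) ∧
      ∀ x, x ∉ S → g x = 0 → (fderiv ℝ g x).range = ⊤ := by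
  obtain ⟨q, rfl⟩ : ∃ q, p = q + 1 := ⟨p - 1, by omega⟩
  obtain ⟨f, hfS, hf, -⟩ := hS.isOpen_compl.exists_contDiff_support_eq (n := ⊤)
  have hfS' : ∀ x, f x = 0 ↔ x ∈ S := fun x => by
    rw [← not_iff_not, ← Set.mem_compl_iff, ← hfS, Function.mem_support]
  have hcomp : ∀ {g : EuclideanSpace ℝ (Fin n) → EuclideanSpace ℝ (Fin (q + 1))},
      ContDiff ℝ ∞ g ↔ ∀ i, ContDiff ℝ ∞ fun x => g x i := fun {g} => contDiff_euclidean
  obtain ⟨A, c, hAc⟩ := exists_affine_perturbation_regular (fun j => hcomp.1 hφ j) (hf.pow (k + 1))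
  let h : EuclideanSpace ℝ (Fin n) → EuclideanSpace ℝ (Fin (q + 1)) :=
    fun x => WithLp.toLp 2 fun j => -(A j x + c j)
  have hh : ContDiff ℝ ∞ h := hcomp.2 fun j => ((A j).contDiff.add contDiff_const).neg
  let g : EuclideanSpace ℝ (Fin n) → EuclideanSpace ℝ (Fin (q + 1)) :=
    fun x => φ x - f x ^ (k + 1) • h x
  have hg : ContDiff ℝ ∞ g := hφ.sub ((hf.pow (k + 1)).smul hh)
  have hgj : ∀ j x, g x j = φ x j + f x ^ (k + 1) * (A j x + c j) := fun j x => by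
    simp [g, h]
    ring
  refine ⟨g, hg, fun j hj x hx => ?_, fun x hx hx0 => ?_⟩
  · simp only [g, sub_sub_cancel]
    exact iteratedFDeriv_pow_smul_eq_zero hf hh ((hfS' x).2 hx) (by omega)
  · by_contra hr
    obtain ⟨l, hl0, hl⟩ := Submodule.exists_le_ker_of_lt_top _ (lt_top_iff_ne_top.2 hr)
    have hls : ∀ u, l u = ∑ j, l (EuclideanSpace.single j 1) * u j := by
      intro u
      conv_lhs => rw [← (EuclideanSpace.basisFun (Fin (q + 1)) ℝ).sum_repr u]
      simp [map_sum, mul_comm]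
    have hw := hAc x (pow_ne_zero _ (mt (hfS' x).1 hx)) (fun j => by rw [← hgj, hx0]; rfl)
      (fun j => l (EuclideanSpace.single j 1)) ?_
    · refine hl0 (LinearMap.ext fun u => ?_)
      rw [hls]
      simp [funext_iff] at hw
      simp [hw]
    · ext v
      have h1 : l (fderiv ℝ g x v) = 0 := hl ⟨v, rfl⟩
      rw [hls] at h1
      simp only [sum_apply, smul_apply, smul_eq_mul,
        zero_apply]
      rw [← h1]
      refine Finset.sum_congr rfl fun j _ => ?_
      congr 1
      have h2 := (EuclideanSpace.proj j : EuclideanSpace ℝ (Fin (q + 1)) →L[ℝ] ℝ).hasFDerivAt.comp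
        x ((hg.differentiable (by simp)) x).hasFDerivAt
      have h3 : (fun y => φ y j + f y ^ (k + 1) * (A j y + c j)) =
        (EuclideanSpace.proj j : EuclideanSpace ℝ (Fin (q + 1)) →L[ℝ] ℝ) ∘ g :=
        funext fun y => (hgj j y).symm
      rw [h3, h2.fderiv]
      rfl

end Clean

section SmallMinors

variable {n p : ℕ}

lemma abs_det_minorMatrix_le {M : EuclideanSpace ℝ (Fin n) →L[ℝ] EuclideanSpace ℝ (Fin p)} {c : ℝ}
    (hc : 0 ≤ c) (h : ∀ ι : Fin p → Fin n, StrictMono ι → |(minorMatrix ι M).det| ≤ c)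
    (ι : Fin p → Fin n) : |(minorMatrix ι M).det| ≤ c := by
  by_cases hι : Function.Injective ι
  · have h1 : StrictMono (ι ∘ Tuple.sort ι) :=
      (Tuple.monotone_sort ι).strictMono_of_injective (hι.comp (Tuple.sort ι).injective)
    have h2 := h _ h1
    have h3 : minorMatrix (ι ∘ Tuple.sort ι) M =
        (minorMatrix ι M).submatrix (Equiv.refl _) (Tuple.sort ι) := rfl
    rwa [h3, Matrix.abs_det_submatrix_equiv_equiv] at h2
  · obtain ⟨a, b, hab, hne⟩ : ∃ a b, ι a = ι b ∧ a ≠ b := by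
      simpa [Function.Injective] using hι
    rw [Matrix.det_zero_of_column_eq hne fun k => by simp [minorMatrix, hab], abs_zero]
    exact hc

/-- If all maximal minors are small, some unit covector is nearly annihilated. -/
lemma exists_unit_inner_le_of_minors (hp : 1 ≤ p)
    {M : EuclideanSpace ℝ (Fin n) →L[ℝ] EuclideanSpace ℝ (Fin p)} {δ : ℝ} (hδ : 0 < δ)
    (h : ∀ ι : Fin p → Fin n, StrictMono ι → |(minorMatrix ι M).det| ≤ δ ^ p) :
    ∃ w : EuclideanSpace ℝ (Fin p), ‖w‖ = 1 ∧ ∀ v, |⟪w, M v⟫| ≤ (n + 1) * δ * ‖v‖ := by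
  by_contra! hcon
  set s : ℝ := (n + 1) * δ with hs
  have hs0 : 0 < s := by positivity
  set T := ContinuousLinearMap.adjoint M with hT
  have hT1 : ∀ w, s * ‖w‖ ≤ ‖T w‖ := by
    intro w
    rcases eq_or_ne w 0 with rfl | hw
    · simp
    have hw' : 0 < ‖w‖ := norm_pos_iff.2 hw
    obtain ⟨v, hv⟩ := hcon (‖w‖⁻¹ • w) (by rw [norm_smul, norm_inv, norm_norm, inv_mul_cancel₀ hw'.ne'])
    rw [inner_smul_left, ← ContinuousLinearMap.adjoint_inner_left] at hv
    have h1 := abs_real_inner_le_norm (T w) v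
    simp only [conj_trivial, abs_mul, abs_inv, abs_norm] at hv
    have hv0 : 0 < ‖v‖ := by
      by_contra! h0
      have : v = 0 := norm_le_zero_iff.1 h0
      simp [this] at hv
    have h2 : s * ‖v‖ < ‖w‖⁻¹ * (‖T w‖ * ‖v‖) := hv.trans_le (by gcongr)
    rw [← mul_assoc] at h2
    have h3 := lt_of_mul_lt_mul_right h2 hv0.le
    rw [inv_mul_eq_div, lt_div_iff₀ hw'] at h3
    exact h3.le
  have hTT : ∀ w, ⟪w, M (T w)⟫ = ‖T w‖ ^ 2 := fun w => by
    rw [← ContinuousLinearMap.adjoint_inner_left, real_inner_self_eq_norm_sq]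
  have hinj : Function.Injective (M.toLinearMap ∘ₗ T.toLinearMap) := by
    rw [← LinearMap.ker_eq_bot, LinearMap.ker_eq_bot']
    intro w hw
    have h1 := hTT w
    have h2 : M (T w) = 0 := hw
    rw [h2, inner_zero_right] at h1
    have h3 : ‖T w‖ = 0 := by simpa using h1.symm
    have h4 := hT1 w
    rw [h3] at h4
    exact norm_le_zero_iff.1 (by nlinarith [norm_nonneg w])
  have hR : ∀ u, ∃ v, M v = u ∧ ‖v‖ ≤ ‖u‖ / s := by
    intro u
    obtain ⟨w, hw⟩ := LinearMap.injective_iff_surjective.1 hinj u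
    have hw' : M (T w) = u := hw
    refine ⟨T w, hw, ?_⟩
    have h1 := hTT w
    have h2 := real_inner_le_norm w u
    rw [← hw', h1, hw'] at h2
    have h3 := hT1 w
    rw [le_div_iff₀ hs0]
    rcases (norm_nonneg (T w)).eq_or_lt with h0 | h0
    · rw [← h0, zero_mul]
      exact norm_nonneg _
    · have : ‖T w‖ * (‖T w‖ * s) ≤ ‖T w‖ * ‖u‖ := by nlinarith [norm_nonneg u, norm_nonneg w]
      exact le_of_mul_le_mul_left this h0
  choose R hR1 hR2 using fun k : Fin p => hR (EuclideanSpace.single k 1)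
  have hexp : (1 : ℝ) = ∑ ι : Fin p → Fin n, (∏ k, R k (ι k)) * (minorMatrix ι M).det := by
    have h1 : (1 : Matrix (Fin p) (Fin p) ℝ) =
        Matrix.of fun k => ∑ l, R k l • fun j => M (EuclideanSpace.single l 1) j := by
      ext k j
      have h2 : R k = ∑ l, R k l • EuclideanSpace.single l (1 : ℝ) := by
        conv_lhs => rw [← (EuclideanSpace.basisFun (Fin n) ℝ).sum_repr (R k)]
        simp
      have h3 := congrArg (fun z : EuclideanSpace ℝ (Fin p) => z j) (hR1 k)
      simp only at h3
      rw [h2, map_sum] at h3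
      simp only [map_smul, WithLp.ofLp_sum, Finset.sum_apply, PiLp.smul_apply, smul_eq_mul] at h3
      simp [Matrix.one_apply, h3, eq_comm]
    rw [← Matrix.det_one (n := Fin p) (R := ℝ), h1]
    have h4 := (Matrix.detRowAlternating (n := Fin p) (R := ℝ)).toMultilinearMap.map_sum
      (fun k (l : Fin n) => R k l • fun j => M (EuclideanSpace.single l 1) j)
    refine Eq.trans h4 (Finset.sum_congr rfl fun ι _ => ?_)
    rw [MultilinearMap.map_smul_univ, smul_eq_mul]
    congr 1
    rw [← Matrix.det_transpose]
    rfl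
  have hle : (1 : ℝ) ≤ (n : ℝ) ^ p * ((1 / s) ^ p * δ ^ p) := by
    calc (1 : ℝ) = |∑ ι : Fin p → Fin n, (∏ k, R k (ι k)) * (minorMatrix ι M).det| := by
          rw [← hexp, abs_one]
      _ ≤ ∑ ι : Fin p → Fin n, |(∏ k, R k (ι k)) * (minorMatrix ι M).det| :=
          Finset.abs_sum_le_sum_abs _ _
      _ ≤ ∑ ι : Fin p → Fin n, (1 / s) ^ p * δ ^ p := by
          refine Finset.sum_le_sum fun ι _ => ?_
          rw [abs_mul]
          refine mul_le_mul ?_ (abs_det_minorMatrix_le (by positivity) h ι) (abs_nonneg _)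
            (by positivity)
          rw [Finset.abs_prod]
          calc ∏ k, |R k (ι k)| ≤ ∏ _k : Fin p, (1 / s) := by
                refine Finset.prod_le_prod (fun _ _ => abs_nonneg _) fun k _ => ?_
                refine (PiLp.norm_apply_le _ _).trans ((hR2 k).trans ?_)
                simp
            _ = (1 / s) ^ p := by simp
      _ = _ := by simp
  have hlt : (n : ℝ) ^ p * ((1 / s) ^ p * δ ^ p) < 1 := by
    rw [← mul_pow, ← mul_pow]
    refine pow_lt_one₀ (by positivity) ?_ (by omega)
    rw [hs]
    field_simp
    linarith
  linarith

end SmallMinors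

section Degenerate

open Filter Topology Metric

variable {n p : ℕ}

/-- If the ideal is not elliptic, there are points arbitrarily close to `0` at which `φ` and some
covector of its differential are small compared with any power of the distance to `S`. -/
lemma exists_degenerate_point (hp : 1 ≤ p) {S : Set (EuclideanSpace ℝ (Fin n))} (h0S : 0 ∈ S)
    {φ φ' : EuclideanSpace ℝ (Fin n) → EuclideanSpace ℝ (Fin p)} (hφ' : ContDiff ℝ ∞ φ')
    (hφ : φ' =ᶠ[𝓝 0] φ) (hell : ¬ IKElliptic n p S φ) {ε η : ℝ} (hε : 0 < ε) (hη : 0 < η)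
    {m : ℕ} (hm : 1 ≤ m) :
    ∃ x, ‖x‖ < ε ∧ 0 < infDist x S ∧ ‖φ' x‖ ≤ η * infDist x S ^ m ∧
      ∃ w : EuclideanSpace ℝ (Fin p), ‖w‖ = 1 ∧
        ∀ v, |⟪w, fderiv ℝ φ' x v⟫| ≤ η * infDist x S ^ m * ‖v‖ := by
  classical
  set e : ℝ := min (η / (n + 1)) 1 with he
  have he0 : 0 < e := lt_min (by positivity) one_pos
  have hee : (n + 1) * e ≤ η := by
    have := min_le_left (η / ((n : ℝ) + 1)) 1
    rw [le_div_iff₀ (by positivity)] at this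
    rw [he]
    linarith
  have heη : e ≤ η := le_trans (le_mul_of_one_le_left he0.le (by simp)) hee
  by_contra! hcon
  refine hell ⟨ball 0 (min ε 1) ∩ {x | φ' =ᶠ[𝓝 x] φ},
    inter_mem (ball_mem_nhds _ (by positivity)) hφ.eventuallyEq_nhds, fun j x => φ' x j,
    fun ι x => (minorMatrix ι (fderiv ℝ φ' x)).det,
    fun j => (contDiff_euclidean.1 hφ' j).contDiffOn,
    fun ι => (contDiff_matrix_det fun i k => (contDiff_minorMatrix ι i k).comp
      (hφ'.fderiv_right (m := ∞) (by simp))).contDiffOn, (e ^ p) ^ 2, by positivity,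
    ((2 * (m * p) : ℕ) : ℝ), by exact_mod_cast (by positivity), fun x ⟨hx, hxe⟩ => ?_⟩
  have hk : ∀ ι, kGen n p φ ι x = (minorMatrix ι (fderiv ℝ φ' x)).det := fun ι => by
    rw [Filter.EventuallyEq.fderiv_eq hxe]
    rfl
  rw [mem_ball_zero_iff, lt_min_iff] at hx
  have hd0 : 0 ≤ infDist x S := infDist_nonneg
  have hd1 : infDist x S ≤ 1 := by
    have : infDist x S ≤ ‖x‖ := by simpa using infDist_le_dist_of_mem (x := x) h0S
    linarith
  rcases hd0.eq_or_lt with hd | hd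
  · rw [← hd, Real.rpow_natCast, zero_pow (by positivity), mul_zero]
    exact abs_nonneg _
  set δ := e * infDist x S ^ m with hδ
  have hδ0 : 0 < δ := by positivity
  have hδ1 : δ ≤ 1 := mul_le_one₀ (min_le_right _ _) (by positivity) (pow_le_one₀ hd0 hd1)
  have hδp : (e ^ p) ^ 2 * infDist x S ^ (((2 * (m * p) : ℕ) : ℝ)) = (δ ^ p) ^ 2 := by
    rw [Real.rpow_natCast, hδ]
    ring
  rw [hδp]
  simp only [hk, show φ x = φ' x from (Filter.EventuallyEq.eq_of_nhds hxe).symm]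
  refine le_trans ?_ (le_abs_self _)
  by_contra! hlt
  have hφsq : ∑ j, φ' x j * φ' x j = ‖φ' x‖ ^ 2 := by
    rw [EuclideanSpace.norm_sq_eq]
    simp [sq]
  have hs0 : ∀ ι : Fin p → Fin n, 0 ≤ if StrictMono ι then
      (minorMatrix ι (fderiv ℝ φ' x)).det * (minorMatrix ι (fderiv ℝ φ' x)).det else 0 :=
    fun ι => by split_ifs <;> [exact mul_self_nonneg _; exact le_rfl]
  rw [hφsq] at hlt
  have h1 : ‖φ' x‖ ≤ δ ^ p := by
    refine (sq_le_sq₀ (norm_nonneg _) (by positivity)).1 ?_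
    have := Finset.sum_nonneg fun ι (_ : ι ∈ Finset.univ) => hs0 ι
    linarith
  have h2 : ∀ ι : Fin p → Fin n, StrictMono ι →
      |(minorMatrix ι (fderiv ℝ φ' x)).det| ≤ δ ^ p := by
    intro ι hι
    refine (sq_le_sq₀ (abs_nonneg _) (by positivity)).1 ?_
    have := Finset.single_le_sum (fun ι _ => hs0 ι) (Finset.mem_univ ι)
    rw [if_pos hι] at this
    rw [sq_abs, sq]
    nlinarith [sq_nonneg ‖φ' x‖]
  obtain ⟨w, hw, hwv⟩ := exists_unit_inner_le_of_minors hp hδ0 h2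
  obtain ⟨v, hv⟩ := hcon x hx.1 hd (h1.trans ((pow_le_of_le_one hδ0.le hδ1 (by omega)).trans
    (by rw [hδ]; gcongr))) w hw
  refine absurd (hwv v) (not_le.2 (lt_of_le_of_lt ?_ hv))
  rw [hδ, ← mul_assoc]
  gcongr

end Degenerate

section Degeneration

open Filter Topology Metric Module

variable {E F : Type*} [NormedAddCommGroup E] [InnerProductSpace ℝ E]
  [NormedAddCommGroup F] [InnerProductSpace ℝ F]

/-- `x₀` is a zero of `g` of corank one with nondegenerate transverse Hessian. -/
def IsDegenerateZero (g : E → F) (x₀ : E) : Prop :=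
  g x₀ = 0 ∧ ∃ w : F, ‖w‖ = 1 ∧ (∀ v, ⟪w, fderiv ℝ g x₀ v⟫ = 0) ∧
    (∀ u, ⟪w, u⟫ = 0 → ∃ v, fderiv ℝ g x₀ v = u) ∧
    ∀ z, fderiv ℝ g x₀ z = 0 → (∀ z', fderiv ℝ g x₀ z' = 0 →
      fderiv ℝ (fderiv ℝ fun x => ⟪w, g x⟫) x₀ z z' = 0) → z = 0

lemma IsDegenerateZero.congr {g g' : E → F} {x₀ : E} (h : IsDegenerateZero g x₀)
    (hg : g' =ᶠ[𝓝 x₀] g) : IsDegenerateZero g' x₀ := by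
  obtain ⟨h0, w, hw⟩ := h
  have h1 : (fun x => ⟪w, g' x⟫) =ᶠ[𝓝 x₀] fun x => ⟪w, g x⟫ := hg.fun_comp fun u => ⟪w, u⟫
  refine ⟨hg.eq_of_nhds.trans h0, w, ?_⟩
  rwa [hg.fderiv_eq, h1.fderiv.fderiv_eq]

lemma exists_pos_forall_apply_add_smul_eq_zero {V : Type*} [AddCommGroup V] [Module ℝ V]
    [FiniteDimensional ℝ V] (T : V →ₗ[ℝ] V) {ε : ℝ} (hε : 0 < ε) :
    ∃ s, 0 < s ∧ s ≤ ε ∧ ∀ v, T v + s • v = 0 → v = 0 := by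
  have hfin : {s : ℝ | Module.End.HasEigenvalue T (-s)}.Finite :=
    (Module.End.finite_hasEigenvalue T).preimage neg_injective.injOn
  obtain ⟨s, hs, hs'⟩ := ((Set.Ioc_infinite hε).sdiff hfin).nonempty
  refine ⟨s, hs.1, hs.2, fun v hv => ?_⟩
  by_contra hv0
  refine hs' (Module.End.hasEigenvalue_of_hasEigenvector (x := v)
    ⟨Module.End.mem_eigenspace_iff.2 ?_, hv0⟩)
  rw [neg_smul]
  exact eq_neg_of_add_eq_zero_left hv

/-- A small perturbation of a linear map into `w^⊥` is onto `w^⊥`. -/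
lemma exists_small_onto_perturbation [FiniteDimensional ℝ E] [FiniteDimensional ℝ F]
    {D : E →ₗ[ℝ] F} (hD : Function.Surjective D) (N : E →L[ℝ] F) {w : F}
    (hw : ‖w‖ = 1) (hN : ∀ v, ⟪w, N v⟫ = 0) {ε : ℝ} (hε : 0 < ε) :
    ∃ B : E →L[ℝ] F, ‖B‖ ≤ ε ∧ (∀ v, ⟪w, B v⟫ = 0) ∧ ∀ u, ⟪w, u⟫ = 0 → ∃ v, (N + B) v = u := by
  obtain ⟨C, hC⟩ := D.exists_rightInverse_of_surjective (LinearMap.range_eq_top.2 hD)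
  let D' : E →L[ℝ] F := LinearMap.toContinuousLinearMap D
  let B₀ : E →L[ℝ] F := D' - ((innerSL ℝ w : F →L[ℝ] ℝ).comp D').smulRight w
  have hB₀ : ∀ v, B₀ v = D v - ⟪w, D v⟫ • w := fun v => rfl
  have hww : ⟪w, w⟫ = 1 := by rw [real_inner_self_eq_norm_sq, hw, one_pow]
  obtain ⟨s, hs0, hsε, hs⟩ := exists_pos_forall_apply_add_smul_eq_zero (N.toLinearMap ∘ₗ C)
    (ε := ε / (‖B₀‖ + 1)) (by positivity)
  have hwB : ∀ v, ⟪w, B₀ v⟫ = 0 := fun v => by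
    rw [hB₀, inner_sub_right, inner_smul_right, hww, mul_one, sub_self]
  refine ⟨s • B₀, ?_, fun v => ?_, fun u hu => ?_⟩
  · rw [norm_smul, Real.norm_of_nonneg hs0.le]
    rw [le_div_iff₀ (by positivity)] at hsε
    nlinarith [norm_nonneg B₀]
  · rw [smul_apply, inner_smul_right, hwB, mul_zero]
  · have hinj : Function.Injective (N.toLinearMap ∘ₗ C + s • (LinearMap.id : F →ₗ[ℝ] F)) := by
      rw [← LinearMap.ker_eq_bot, LinearMap.ker_eq_bot']
      exact fun v hv => hs v hv
    obtain ⟨v, hv⟩ := LinearMap.injective_iff_surjective.1 hinj u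
    have hv' : N (C v) + s • v = u := hv
    have h1 : ⟪w, v⟫ = 0 := by
      have := congrArg (fun z => ⟪w, z⟫) hv'
      simp only [inner_add_right, hN, inner_smul_right, zero_add, hu] at this
      exact (mul_eq_zero.1 this).resolve_left hs0.ne'
    refine ⟨C v, ?_⟩
    have h2 : D (C v) = v := LinearMap.congr_fun hC v
    rw [← hv', add_apply, smul_apply, hB₀, h2, h1, zero_smul, sub_zero]

/-- Adding a generic small multiple of the inner product makes a bilinear form nondegenerate on a
given subspace. -/
lemma exists_small_nondegenerate [FiniteDimensional ℝ E] (H : E →L[ℝ] E →L[ℝ] ℝ)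
    (K : Submodule ℝ E) {ε : ℝ} (hε : 0 < ε) :
    ∃ t, 0 < t ∧ t ≤ ε ∧ ∀ z ∈ K, (∀ z' ∈ K, H z z' + 2 * t * ⟪z, z'⟫ = 0) → z = 0 := by
  let T : E →L[ℝ] E := ((InnerProductSpace.toDual ℝ E).symm.toContinuousLinearEquiv.toContinuousLinearMap).comp H
  have hT : ∀ z z', ⟪T z, z'⟫ = H z z' := fun z z' =>
    InnerProductSpace.toDual_symm_apply
  let P : K →ₗ[ℝ] K := (K.orthogonalProjectionOnto.toLinearMap ∘ₗ T.toLinearMap) ∘ₗ K.subtype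
  obtain ⟨s, hs0, hsε, hs⟩ := exists_pos_forall_apply_add_smul_eq_zero P
    (ε := 2 * ε) (by positivity)
  refine ⟨s / 2, by positivity, by linarith, fun z hz h => ?_⟩
  have := hs ⟨z, hz⟩ ?_
  · exact congrArg Subtype.val this
  · refine ext_inner_right ℝ fun z' => ?_
    have h1 := h z' z'.2
    rw [inner_zero_left, inner_add_left, inner_smul_left]
    have h2 : ⟪P ⟨z, hz⟩, z'⟫ = H z z' := by
      rw [← hT]
      exact Submodule.inner_orthogonalProjectionOnto_eq_of_mem_right z' (T z)
    rw [h2, ← h1]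
    simp only [conj_trivial, Submodule.coe_inner]
    ring

/-- The quadratic modification of `φ` at `x₀` has a degenerate zero there. -/
lemma isDegenerateZero_quadratic {φ : E → F} (hφ : ContDiff ℝ ∞ φ) {x₀ : E} {w : F}
    (hw : ‖w‖ = 1) {L : E →L[ℝ] F} {t : ℝ} (h1 : ∀ v, ⟪w, (fderiv ℝ φ x₀ + L) v⟫ = 0)
    (h2 : ∀ u, ⟪w, u⟫ = 0 → ∃ v, (fderiv ℝ φ x₀ + L) v = u)
    (h3 : ∀ z ∈ (fderiv ℝ φ x₀ + L).ker, (∀ z' ∈ (fderiv ℝ φ x₀ + L).ker,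
      fderiv ℝ (fderiv ℝ fun x => ⟪w, φ x⟫) x₀ z z' + 2 * t * ⟪z, z'⟫ = 0) → z = 0) :
    IsDegenerateZero
      (fun y => φ y + (-φ x₀ + L (y - x₀) + (t * ‖y - x₀‖ ^ 2) • w)) x₀ := by
  have hsq : ∀ y, HasFDerivAt (fun y => t * ‖y - x₀‖ ^ 2) ((2 * t) • innerSL ℝ (y - x₀)) y := by
    intro y
    refine ((((hasFDerivAt_id y).sub_const x₀).norm_sq).const_mul t).congr_fderiv ?_
    ext v
    simp
    ring
  have hφd : Differentiable ℝ φ := hφ.differentiable (by simp)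
  have hD : fderiv ℝ (fun y => φ y + (-φ x₀ + L (y - x₀) + (t * ‖y - x₀‖ ^ 2) • w)) x₀ =
      fderiv ℝ φ x₀ + L := by
    have := (hφd x₀).hasFDerivAt.add (((L.hasFDerivAt.comp x₀
      (f := fun y => y - x₀) ((hasFDerivAt_id x₀).sub_const x₀)).const_add (-φ x₀)).add ((hsq x₀).smul_const w))
    refine HasFDerivAt.fderiv (f := fun y => φ y + (-φ x₀ + L (y - x₀) + (t * ‖y - x₀‖ ^ 2) • w))
      (this.congr_fderiv ?_)
    ext v
    simp
  have hww : ⟪w, w⟫ = 1 := by rw [real_inner_self_eq_norm_sq, hw, one_pow]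
  have hψ : ContDiff ℝ ∞ fun x => ⟪w, φ x⟫ := contDiff_const.inner ℝ hφ
  let Q : E →L[ℝ] E →L[ℝ] ℝ := innerSL ℝ
  have hH : fderiv ℝ (fderiv ℝ fun y =>
      ⟪w, φ y + (-φ x₀ + L (y - x₀) + (t * ‖y - x₀‖ ^ 2) • w)⟫) x₀ =
      fderiv ℝ (fderiv ℝ fun x => ⟪w, φ x⟫) x₀ + (2 * t) • Q := by
    have e1 : (fun y => ⟪w, φ y + (-φ x₀ + L (y - x₀) + (t * ‖y - x₀‖ ^ 2) • w)⟫) =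
        fun y => ⟪w, φ y⟫ + (⟪w, -φ x₀⟫ + (innerSL ℝ w).comp L (y - x₀) + t * ‖y - x₀‖ ^ 2) := by
      ext y
      simp [inner_add_right, inner_smul_right, hw]
    have e2 : fderiv ℝ (fun y => ⟪w, φ y⟫ + (⟪w, -φ x₀⟫ + (innerSL ℝ w).comp L (y - x₀) +
        t * ‖y - x₀‖ ^ 2)) = fun y => fderiv ℝ (fun x => ⟪w, φ x⟫) y +
          ((innerSL ℝ w).comp L + (2 * t) • Q (y - x₀)) := by
      ext1 y
      have := (hψ.differentiable (by simp) y).hasFDerivAt.add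
        (((((innerSL ℝ w).comp L).hasFDerivAt.comp y (f := fun y => y - x₀)
          ((hasFDerivAt_id y).sub_const x₀)).const_add ⟪w, -φ x₀⟫).add (hsq y))
      exact this.fderiv
    rw [e1, e2]
    have := (((hψ.fderiv_right (m := ∞) (by simp)).differentiable (by simp)) x₀).hasFDerivAt.add
      (((Q.hasFDerivAt.comp x₀ (f := fun y => y - x₀)
        ((hasFDerivAt_id x₀).sub_const x₀)).const_smul (2 * t)).const_add ((innerSL ℝ w).comp L))
    exact this.fderiv
  refine ⟨by simp, w, hw, ?_⟩
  rw [hD, hH]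
  refine ⟨h1, h2, fun z hz h => h3 z hz fun z' hz' => ?_⟩
  exact h z' hz'

end Degeneration

section Bump

open Filter Topology Metric Module

/-- Localised quadratic polynomials, with derivatives controlled by the coefficients. -/
lemma exists_localized_quadratic (E F : Type*) [NormedAddCommGroup E] [InnerProductSpace ℝ E]
    [FiniteDimensional ℝ E] [NormedAddCommGroup F] [InnerProductSpace ℝ F] :
    ∃ M : ℕ → ℝ, (∀ j, 0 ≤ M j) ∧ ∀ (x₀ : E) (r : ℝ) (a w : F) (L : E →L[ℝ] F) (t : ℝ),
      0 < r → r ≤ 1 → ‖w‖ = 1 → ∃ h : E → F, ContDiff ℝ ∞ h ∧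
        (∀ y, r ≤ ‖y - x₀‖ → h y = 0) ∧
        (∀ᶠ y in 𝓝 x₀, h y = a + L (y - x₀) + (t * ‖y - x₀‖ ^ 2) • w) ∧
        ∀ j y, ‖iteratedFDeriv ℝ j h y‖ ≤ (‖a‖ + ‖L‖ + |t|) * M j * r⁻¹ ^ j := by
  let χ : ContDiffBump (0 : E) := ⟨1 / 2, 1, by norm_num, by norm_num⟩
  let G : E → ℝ × E × ℝ := fun u => (χ u, χ u • u, χ u * ‖u‖ ^ 2)
  have hG : ContDiff ℝ ∞ G :=
    χ.contDiff.prodMk ((χ.contDiff.smul contDiff_id).prodMk (χ.contDiff.mul (contDiff_norm_sq ℝ)))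
  have hG0 : ∀ u, 1 ≤ ‖u‖ → G u = 0 := fun u hu => by
    have : χ u = 0 := χ.zero_of_le_dist (by simpa [χ] using hu)
    simp [G, this]
  have hGc : HasCompactSupport G :=
    HasCompactSupport.intro (isCompact_closedBall (0 : E) 1) fun u hu => hG0 u (by
      rw [mem_closedBall_zero_iff, not_le] at hu
      exact hu.le)
  have hM : ∀ j : ℕ, ∃ C, ∀ u, ‖iteratedFDeriv ℝ j G u‖ ≤ C := fun j =>
    (hGc.iteratedFDeriv j).exists_bound_of_continuous
      (hG.continuous_iteratedFDeriv (by exact_mod_cast le_top))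
  choose M hM using hM
  refine ⟨M, fun j => (norm_nonneg _).trans (hM j 0), fun x₀ r a w L t hr hr1 hw => ?_⟩
  let Λ : ℝ × E × ℝ →L[ℝ] F := (ContinuousLinearMap.fst ℝ ℝ (E × ℝ)).smulRight a +
    ((r • L).comp ((ContinuousLinearMap.fst ℝ E ℝ).comp (ContinuousLinearMap.snd ℝ ℝ (E × ℝ))) +
    ((ContinuousLinearMap.snd ℝ E ℝ).comp (ContinuousLinearMap.snd ℝ ℝ (E × ℝ))).smulRight
      ((t * r ^ 2) • w))
  have hΛ : ∀ z, Λ z = z.1 • a + (r • L z.2.1 + z.2.2 • (t * r ^ 2) • w) := fun z => rfl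
  have hΛn : ‖Λ‖ ≤ ‖a‖ + ‖L‖ + |t| := by
    refine ContinuousLinearMap.opNorm_le_bound _ (by positivity) fun z => ?_
    rw [hΛ]
    have e1 : ‖z.1‖ ≤ ‖z‖ := norm_fst_le z
    have e2 : ‖z.2.1‖ ≤ ‖z‖ := (norm_fst_le z.2).trans (norm_snd_le z)
    have e3 : ‖z.2.2‖ ≤ ‖z‖ := (norm_snd_le z.2).trans (norm_snd_le z)
    have hr2 : r ^ 2 ≤ 1 := pow_le_one₀ hr.le hr1
    calc _ ≤ ‖z.1 • a‖ + (‖r • L z.2.1‖ + ‖z.2.2 • (t * r ^ 2) • w‖) :=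
          (norm_add_le _ _).trans (by gcongr; exact norm_add_le _ _)
      _ ≤ ‖z‖ * ‖a‖ + (1 * (‖L‖ * ‖z‖) + ‖z‖ * (|t| * 1)) := by
          simp only [norm_smul, hw, Real.norm_eq_abs, abs_mul, abs_of_pos hr,
            abs_of_nonneg (sq_nonneg r), mul_one] at e1 e3 ⊢
          gcongr
          · exact (L.le_opNorm _).trans (by gcongr)
          · calc |t| * r ^ 2 ≤ |t| * 1 := by gcongr
              _ = |t| := mul_one _
      _ = _ := by ring
  let h : E → F := fun y => Λ (G (r⁻¹ • (y - x₀)))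
  have hscale : ∀ y, ‖r⁻¹ • (y - x₀)‖ = ‖y - x₀‖ / r := fun y => by
    rw [norm_smul, norm_inv, Real.norm_of_nonneg hr.le, inv_mul_eq_div]
  have hGs : ContDiff ℝ ∞ fun y => G (r⁻¹ • y) := hG.comp (contDiff_const_smul _)
  have hGt : ContDiff ℝ ∞ fun y => G (r⁻¹ • (y - x₀)) := hGs.comp (contDiff_id.sub contDiff_const)
  refine ⟨h, Λ.contDiff.comp hGt, fun y hy => ?_, ?_, fun j y => ?_⟩
  · simp only [h]
    rw [hG0 _ (by rw [hscale, one_le_div hr]; exact hy), map_zero]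
  · filter_upwards [ball_mem_nhds x₀ (half_pos hr)] with y hy
    rw [mem_ball_iff_norm] at hy
    have h1 : χ (r⁻¹ • (y - x₀)) = 1 := χ.one_of_mem_closedBall (by
      rw [mem_closedBall_zero_iff, hscale, div_le_iff₀ hr]
      simp only [χ]
      linarith)
    simp only [h, hΛ, G, h1, one_smul, one_mul, hscale, map_smul, smul_smul, add_assoc,
      mul_inv_cancel₀ hr.ne']
    rw [show (‖y - x₀‖ / r) ^ 2 * (t * r ^ 2) = t * ‖y - x₀‖ ^ 2 by field_simp]
  · have e1 : iteratedFDeriv ℝ j (fun y => G (r⁻¹ • (y - x₀))) y =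
        r⁻¹ ^ j • iteratedFDeriv ℝ j G (r⁻¹ • (y - x₀)) := by
      rw [iteratedFDeriv_comp_sub (f := fun y => G (r⁻¹ • y)) j x₀ y,
        iteratedFDeriv_comp_const_smul _ (hG.of_le (by exact_mod_cast le_top))]
    have e2 := Λ.norm_iteratedFDeriv_comp_left (x := y) (n := j) hGt.contDiffAt
      (by exact_mod_cast le_top)
    rw [e1, norm_smul, norm_pow, norm_inv, Real.norm_of_nonneg hr.le] at e2
    refine e2.trans ?_
    calc _ ≤ (‖a‖ + ‖L‖ + |t|) * (r⁻¹ ^ j * M j) := by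
          gcongr
          exact hM j _
      _ = _ := by ring

end Bump

section DegenerateStep

open Filter Topology Metric Module

variable {n p : ℕ}

lemma exists_surjective_linearMap (hpn : p ≤ n) :
    ∃ D : EuclideanSpace ℝ (Fin n) →ₗ[ℝ] EuclideanSpace ℝ (Fin p), Function.Surjective D := by
  refine ⟨(WithLp.linearEquiv 2 ℝ (Fin p → ℝ)).symm.toLinearMap ∘ₗ
    LinearMap.funLeft ℝ ℝ (Fin.castLE hpn) ∘ₗ (WithLp.linearEquiv 2 ℝ (Fin n → ℝ)).toLinearMap, ?_⟩
  exact (WithLp.linearEquiv 2 ℝ (Fin p → ℝ)).symm.surjective.comp ((LinearMap.funLeft_surjective_of_injective ℝ ℝ _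
    (Fin.castLE_injective hpn)).comp
      (WithLp.linearEquiv 2 ℝ (Fin n → ℝ)).surjective)

/-- If the ideal is not elliptic, a perturbation of arbitrarily small size supported in a small
ball away from `S` creates a degenerate zero. -/
lemma exists_degenerating_bump (hp : 1 ≤ p) (hpn : p < n) {S : Set (EuclideanSpace ℝ (Fin n))}
    (h0S : 0 ∈ S) {φ φ' : EuclideanSpace ℝ (Fin n) → EuclideanSpace ℝ (Fin p)}
    (hφ' : ContDiff ℝ ∞ φ') (hφ : φ' =ᶠ[𝓝 0] φ) (hell : ¬ IKElliptic n p S φ) (i : ℕ) {ε : ℝ}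
    (hε : 0 < ε) :
    ∃ (x : EuclideanSpace ℝ (Fin n)) (h : EuclideanSpace ℝ (Fin n) → EuclideanSpace ℝ (Fin p))
      (C : ℕ → ℝ), ‖x‖ < ε ∧ 0 < infDist x S ∧ ContDiff ℝ ∞ h ∧
      (∀ y, infDist x S / 4 ≤ ‖y - x‖ → h y = 0) ∧
      (∀ j y, ‖iteratedFDeriv ℝ j h y‖ ≤ C j) ∧ (∀ j ≤ i, C j ≤ (1 / 2) ^ i) ∧
      IsDegenerateZero (fun y => φ' y + h y) x := by
  obtain ⟨M, hM0, hM⟩ := exists_localized_quadratic (EuclideanSpace ℝ (Fin n))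
    (EuclideanSpace ℝ (Fin p))
  obtain ⟨D, hD⟩ := exists_surjective_linearMap hpn.le
  set K : ℝ := ∑ j ∈ Finset.range (i + 1), M j * 4 ^ j
  have hK0 : 0 ≤ K := Finset.sum_nonneg fun j _ => mul_nonneg (hM0 j) (by positivity)
  set η : ℝ := (1 / 2) ^ i / (4 * (K + 1)) with hη
  have hη0 : 0 < η := by positivity
  obtain ⟨x, hx, hd, hφx, w, hw, hwv⟩ := exists_degenerate_point hp h0S hφ' hφ hell
    (lt_min hε one_pos) hη0 (Nat.le_add_left 1 i)
  set d := infDist x S with hd'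
  have hd1 : d ≤ 1 := by
    have : infDist x S ≤ ‖x‖ := by simpa using infDist_le_dist_of_mem (x := x) h0S
    linarith [min_le_right ε 1]
  set δ := η * d ^ (i + 1) with hδ
  have hδ0 : 0 < δ := by positivity
  have hww : ⟪w, w⟫ = 1 := by rw [real_inner_self_eq_norm_sq, hw, one_pow]
  let L₀ : EuclideanSpace ℝ (Fin n) →L[ℝ] EuclideanSpace ℝ (Fin p) :=
    ((innerSL ℝ w : EuclideanSpace ℝ (Fin p) →L[ℝ] ℝ).comp (fderiv ℝ φ' x)).smulRight w
  have hL₀ : ∀ v, L₀ v = ⟪w, fderiv ℝ φ' x v⟫ • w := fun v => rfl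
  have hL₀n : ‖L₀‖ ≤ δ := ContinuousLinearMap.opNorm_le_bound _ hδ0.le fun v => by
    rw [hL₀, norm_smul, hw, mul_one]
    exact hwv v
  have hN : ∀ v, ⟪w, (fderiv ℝ φ' x - L₀) v⟫ = 0 := fun v => by
    rw [sub_apply, hL₀, inner_sub_right, inner_smul_right, hww, mul_one, sub_self]
  obtain ⟨B, hBn, hBw, hB⟩ := exists_small_onto_perturbation hD _ hw hN hδ0
  have hsum : fderiv ℝ φ' x + (B - L₀) = fderiv ℝ φ' x - L₀ + B := by abel
  obtain ⟨t, ht0, htδ, ht⟩ := exists_small_nondegenerate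
    (fderiv ℝ (fderiv ℝ fun x => ⟪w, φ' x⟫) x) (fderiv ℝ φ' x + (B - L₀)).ker hδ0
  have hdeg := isDegenerateZero_quadratic hφ' hw (L := B - L₀) (t := t) (x₀ := x)
    (fun v => by rw [hsum, add_apply, inner_add_right, hN, hBw, add_zero])
    (fun u hu => by rw [hsum]; exact hB u hu) ht
  obtain ⟨h, hh, hsupp, hloc, hbound⟩ := hM x (d / 4) (-φ' x) w (B - L₀) t (by positivity)
    (by linarith) hw
  refine ⟨x, h, _, hx.trans_le (min_le_left _ _), hd, hh, hsupp, hbound, fun j hj => ?_,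
    hdeg.congr ?_⟩
  · have e1 : ‖-φ' x‖ + ‖B - L₀‖ + |t| ≤ 4 * δ := by
      rw [norm_neg, abs_of_pos ht0]
      linarith [norm_sub_le B L₀]
    have e2 : M j * 4 ^ j ≤ K := Finset.single_le_sum
      (f := fun j => M j * 4 ^ j) (fun j _ => mul_nonneg (hM0 j) (by positivity))
      (Finset.mem_range.2 (by omega))
    have e3 : d ^ (i + 1) * (d / 4)⁻¹ ^ j ≤ 4 ^ j := by
      rw [inv_div, div_pow, mul_div_assoc', div_le_iff₀ (by positivity), mul_comm]
      exact mul_le_mul_of_nonneg_left (pow_le_pow_of_le_one hd.le hd1 (by omega)) (by positivity)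
    calc _ ≤ 4 * δ * M j * (d / 4)⁻¹ ^ j := by
          have := hM0 j
          gcongr
      _ = 4 * η * (M j * (d ^ (i + 1) * (d / 4)⁻¹ ^ j)) := by rw [hδ]; ring
      _ ≤ 4 * η * (M j * 4 ^ j) := by
          have := hM0 j
          gcongr
      _ ≤ 4 * η * (K + 1) := by gcongr; linarith
      _ = (1 / 2) ^ i := by rw [hη]; field_simp
  · filter_upwards [hloc] with y hy
    rw [hy]

end DegenerateStep

section DegenerateMap

open Filter Topology Metric

variable {n p : ℕ}

/-- If the ideal is not elliptic, some perturbation flat on `S` has degenerate zeros outside `S`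
accumulating at `0`. -/
theorem exists_perturbation_degenerate (hp : 1 ≤ p) (hpn : p < n)
    {S : Set (EuclideanSpace ℝ (Fin n))} (h0S : 0 ∈ S)
    {φ φ' : EuclideanSpace ℝ (Fin n) → EuclideanSpace ℝ (Fin p)}
    (hφ' : ContDiff ℝ ∞ φ') (hφ : φ' =ᶠ[𝓝 0] φ) (hell : ¬ IKElliptic n p S φ) :
    ∃ (g : EuclideanSpace ℝ (Fin n) → EuclideanSpace ℝ (Fin p))
      (x : ℕ → EuclideanSpace ℝ (Fin n)), ContDiff ℝ ∞ g ∧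
      (∀ j, ∀ z ∈ S, iteratedFDeriv ℝ j (fun y => φ' y - g y) z = 0) ∧
      Tendsto x atTop (𝓝 0) ∧ ∀ i, x i ∉ S ∧ IsDegenerateZero g (x i) := by
  choose X H C hX hd hH hsupp hbound hC hdeg using fun i (ε : {ε : ℝ // 0 < ε}) =>
    exists_degenerating_bump hp hpn h0S hφ' hφ hell i ε.2
  let e : ℕ → {ε : ℝ // 0 < ε} := fun i =>
    Nat.rec ⟨1, one_pos⟩ (fun i ε => ⟨infDist (X i ε) S / 4, by have := hd i ε; positivity⟩) i
  let x : ℕ → EuclideanSpace ℝ (Fin n) := fun i => X i (e i)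
  let h : ℕ → EuclideanSpace ℝ (Fin n) → EuclideanSpace ℝ (Fin p) := fun i => H i (e i)
  let d : ℕ → ℝ := fun i => infDist (x i) S
  have hd0 : ∀ i, 0 < d i := fun i => hd i (e i)
  have hdx : ∀ i, d i ≤ ‖x i‖ := fun i => by
    simpa using infDist_le_dist_of_mem (x := x i) h0S
  have hxs : ∀ i, ‖x (i + 1)‖ < d i / 4 := fun i => hX (i + 1) (e (i + 1))
  have hlt : ∀ i k, ‖x (i + 1 + k)‖ < d i / 4 := by
    intro i k
    induction k with
    | zero => exact hxs i
    | succ k ih =>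
      have := hxs (i + 1 + k)
      have := hdx (i + 1 + k)
      have := norm_nonneg (x (i + 1 + k))
      rw [← add_assoc]
      linarith
  have hx1 : ∀ i, ‖x i‖ ≤ (1 / 4) ^ i := by
    intro i
    induction i with
    | zero => exact (hX 0 (e 0)).le.trans (by simp [e])
    | succ i ih =>
      have := hxs i
      have := hdx i
      rw [pow_succ]
      linarith
  have hx0 : Tendsto x atTop (𝓝 0) := squeeze_zero_norm hx1
    (tendsto_pow_atTop_nhds_zero_of_lt_one (by norm_num) (by norm_num))
  have hdisj : ∀ i l, i ≠ l → ∀ y, ‖y - x i‖ < d i / 4 → h l y = 0 := by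
    intro i l hil y hy
    refine hsupp l (e l) y ?_
    change d l / 4 ≤ ‖y - x l‖
    by_contra! hy'
    have e1 : ‖x i‖ ≤ ‖y‖ + ‖y - x i‖ := by
      simpa only [sub_sub_cancel] using norm_sub_le y (y - x i)
    have e2 : ‖x l‖ ≤ ‖y‖ + ‖y - x l‖ := by
      simpa only [sub_sub_cancel] using norm_sub_le y (y - x l)
    have e3 : ‖y‖ ≤ ‖x i‖ + ‖y - x i‖ := by
      simpa only [add_sub_cancel] using norm_add_le (x i) (y - x i)
    have e4 : ‖y‖ ≤ ‖x l‖ + ‖y - x l‖ := by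
      simpa only [add_sub_cancel] using norm_add_le (x l) (y - x l)
    have := hdx i
    have := hdx l
    rcases lt_or_gt_of_ne hil with hil | hil
    · obtain ⟨k, rfl⟩ := Nat.exists_eq_add_of_le (Nat.succ_le_of_lt hil)
      have := hlt i k
      linarith
    · obtain ⟨k, rfl⟩ := Nat.exists_eq_add_of_le (Nat.succ_le_of_lt hil)
      have := hlt l k
      linarith
  have hsum : ∀ k : ℕ, (k : ℕ∞) ≤ (⊤ : ℕ∞) → Summable fun i => C i (e i) k := fun k _ => by
    refine Summable.of_norm_bounded_eventually_nat summable_geometric_two ?_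
    filter_upwards [eventually_ge_atTop k] with i hi
    rw [Real.norm_of_nonneg ((norm_nonneg _).trans (hbound i (e i) k 0))]
    exact hC i (e i) k hi
  have hb : ∀ (k i : ℕ) y, (k : ℕ∞) ≤ (⊤ : ℕ∞) → ‖iteratedFDeriv ℝ k (h i) y‖ ≤ C i (e i) k :=
    fun k i y _ => hbound i (e i) k y
  have hts : ContDiff ℝ ∞ fun y => ∑' i, h i y :=
    contDiff_tsum (fun i => hH i (e i)) hsum (fun k i y hk => hb k i y le_top)
  refine ⟨fun y => φ' y + ∑' i, h i y, x, hφ'.add hts, fun j z hz => ?_, hx0, fun i => ⟨?_, ?_⟩⟩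
  · simp only [sub_add_cancel_left]
    have : (fun y => -∑' i, h i y) = -fun y => ∑' i, h i y := rfl
    rw [this, iteratedFDeriv_neg_apply,
      iteratedFDeriv_tsum_apply (fun i => hH i (e i)) hsum hb le_top z]
    refine neg_eq_zero.2 ((tsum_congr fun i => ?_).trans tsum_zero)
    have h1 : h i =ᶠ[𝓝 z] fun _ => 0 := by
      have h2 : d i / 4 < ‖z - x i‖ := by
        have := infDist_le_dist_of_mem (x := x i) hz
        rw [dist_comm, dist_eq_norm] at this
        have := hd0 i
        simp only [d] at this ⊢
        linarith
      filter_upwards [(isOpen_lt continuous_const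
        (continuous_id.sub continuous_const).norm).mem_nhds h2] with y hy
      exact hsupp i (e i) y (le_of_lt hy)
    rw [(h1.iteratedFDeriv ℝ j).eq_of_nhds]
    exact congrFun (iteratedFDeriv_fun_zero (n := j)) z
  · intro hxS
    have := hd0 i
    simp only [d, infDist_zero_of_mem hxS, lt_irrefl] at this
  · refine (hdeg i (e i)).congr ?_
    filter_upwards [ball_mem_nhds (x i) (div_pos (hd0 i) (by norm_num : (0 : ℝ) < 4))] with y hy
    rw [mem_ball_iff_norm] at hy
    rw [tsum_eq_single i fun l hl => hdisj i l hl.symm y hy]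

end DegenerateMap

section Necessity

open Filter Topology

variable {n p : ℕ} {S : Set (EuclideanSpace ℝ (Fin n))}
  {φ : EuclideanSpace ℝ (Fin n) → EuclideanSpace ℝ (Fin p)}

/-- `σ` is a local homeomorphism at `0` with inverse `τ`, fixing `S` and carrying the zeros of `φ`
to the zeros of `g`. -/
def IsLocalZeroEquiv (S : Set (EuclideanSpace ℝ (Fin n)))
    (φ g : EuclideanSpace ℝ (Fin n) → EuclideanSpace ℝ (Fin p))
    (σ τ : EuclideanSpace ℝ (Fin n) → EuclideanSpace ℝ (Fin n)) : Prop :=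
  σ 0 = 0 ∧ τ 0 = 0 ∧ ∀ᶠ x in 𝓝 0, ContinuousAt σ x ∧ ContinuousAt τ x ∧ τ (σ x) = x ∧
    σ (τ x) = x ∧ (φ x = 0 ↔ g (σ x) = 0) ∧ (x ∈ S → σ x = x)

/-- Finite determinacy, tested on globally smooth perturbations of a smooth representative. -/
theorem FinitelySVDetermined.exists_isLocalZeroEquiv (h : FinitelySVDetermined n p S φ)
    (h0S : 0 ∈ S) {φ' : EuclideanSpace ℝ (Fin n) → EuclideanSpace ℝ (Fin p)}
    (hφ : φ' =ᶠ[𝓝 0] φ) (hφ0 : φ 0 = 0) :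
    ∃ k : ℕ, ∀ g : EuclideanSpace ℝ (Fin n) → EuclideanSpace ℝ (Fin p), ContDiff ℝ ∞ g →
      (∀ j ≤ k, ∀ x ∈ S, iteratedFDeriv ℝ j (fun y => φ' y - g y) x = 0) →
      ∃ σ τ, IsLocalZeroEquiv S φ g σ τ := by
  obtain ⟨k, -, hk⟩ := h
  refine ⟨k, fun g hg hflat => ?_⟩
  have hg0 : g 0 = 0 := by
    have h0 := congrArg (fun f => f fun _ => 0) (hflat 0 (Nat.zero_le k) 0 h0S)
    simp only [iteratedFDeriv_zero_apply, zero_apply, hφ.eq_of_nhds,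
      hφ0, zero_sub, neg_eq_zero] at h0
    exact h0
  have hflat' : ∃ W ∈ 𝓝 (0 : EuclideanSpace ℝ (Fin n)), ∀ j ≤ k, ∀ x ∈ S ∩ W,
      iteratedFDeriv ℝ j (fun y => φ y - g y) x = 0 := by
    refine ⟨_, hφ.eventuallyEq_nhds, fun j hj x hx => ?_⟩
    have hx2 : φ' =ᶠ[𝓝 x] φ := hx.2
    have : (fun y => φ y - g y) =ᶠ[𝓝 x] fun y => φ' y - g y := by
      filter_upwards [hx2] with y hy
      rw [hy]
    rw [(this.iteratedFDeriv ℝ j).eq_of_nhds]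
    exact hflat j hj x hx.1
  obtain ⟨U, hU, V, hV, σ, τ, hσ, hτ, hb, hτσ, hστ, h0, hS, hz⟩ :=
    hk g ⟨Set.univ, univ_mem, hg.contDiffOn⟩ hg0 hflat'
  refine ⟨σ, τ, h0, ?_, ?_⟩
  · simpa only [h0] using hτσ 0 (mem_of_mem_nhds hU)
  · filter_upwards [eventually_mem_nhds_iff.2 hU, eventually_mem_nhds_iff.2 hV] with x hxU hxV
    have hxU' := mem_of_mem_nhds hxU
    refine ⟨hσ.continuousAt hxU, hτ.continuousAt hxV, hτσ x hxU', hστ x (mem_of_mem_nhds hxV),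
      ⟨fun hx => ?_, fun hx => ?_⟩, fun hxS => hS x ⟨hxS, hxU'⟩⟩
    · exact (hz.subset ⟨x, ⟨hx, hxU'⟩, rfl⟩).1
    · obtain ⟨x', hx', he⟩ := hz.superset ⟨hx, hb.mapsTo hxU'⟩
      rw [← hb.injOn hx'.2 hxU' he]
      exact hx'.1

/-- A map with only regular zeros outside `S` and a map with degenerate zeros outside `S`
accumulating at `0` cannot both be equivalent to `φ`. -/
theorem IsLocalZeroEquiv.false_of_degenerate (hpn : p < n)
    {g₁ g₂ : EuclideanSpace ℝ (Fin n) → EuclideanSpace ℝ (Fin p)}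
    {σ₁ τ₁ σ₂ τ₂ : EuclideanSpace ℝ (Fin n) → EuclideanSpace ℝ (Fin n)}
    (h₁ : IsLocalZeroEquiv S φ g₁ σ₁ τ₁) (h₂ : IsLocalZeroEquiv S φ g₂ σ₂ τ₂)
    (hg₁ : ContDiff ℝ ∞ g₁) (hg₂ : ContDiff ℝ ∞ g₂)
    (hreg : ∀ x, x ∉ S → g₁ x = 0 → (fderiv ℝ g₁ x).range = ⊤)
    {x : ℕ → EuclideanSpace ℝ (Fin n)} (hx : Tendsto x atTop (𝓝 0))
    (hdeg : ∀ i, x i ∉ S ∧ IsDegenerateZero g₂ (x i)) : False := by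
  obtain ⟨hσ₁, hτ₁, h₁⟩ := h₁
  obtain ⟨hσ₂, hτ₂, h₂⟩ := h₂
  have cσ₁ : Tendsto σ₁ (𝓝 0) (𝓝 0) := by simpa only [hσ₁] using h₁.self_of_nhds.1.tendsto
  have cτ₁ : Tendsto τ₁ (𝓝 0) (𝓝 0) := by simpa only [hτ₁] using h₁.self_of_nhds.2.1.tendsto
  have cτ₂ : Tendsto τ₂ (𝓝 0) (𝓝 0) := by simpa only [hτ₂] using h₂.self_of_nhds.2.1.tendsto
  have cs : Tendsto (fun z => σ₁ (τ₂ z)) (𝓝 0) (𝓝 0) := cσ₁.comp cτ₂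
  have hs : ∀ᶠ z in 𝓝 0, ContinuousAt (fun z => σ₁ (τ₂ z)) z ∧ σ₂ (τ₁ (σ₁ (τ₂ z))) = z ∧
      (g₂ z = 0 ↔ g₁ (σ₁ (τ₂ z)) = 0) := by
    filter_upwards [h₂, cτ₂.eventually h₁, cτ₂.eventually h₂] with z hz hz₁ hz₂
    refine ⟨hz₁.1.comp hz.2.1, ?_, ?_⟩
    · rw [hz₁.2.2.1, hz.2.2.2.1]
    · rw [← hz₁.2.2.2.2.1, hz₂.2.2.2.2.1, hz.2.2.2.1]
  have ht : ∀ᶠ y in 𝓝 0, ContinuousAt (fun y => σ₂ (τ₁ y)) y ∧ σ₁ (τ₂ (σ₂ (τ₁ y))) = y := by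
    filter_upwards [h₁, cτ₁.eventually h₂] with y hy hy₂
    refine ⟨hy₂.1.comp hy.2.1, ?_⟩
    rw [hy₂.2.2.1, hy.2.2.2.1]
  have hS : ∀ᶠ z in 𝓝 0, σ₁ (τ₂ z) ∈ S → z ∈ S := by
    filter_upwards [h₂, cτ₂.eventually h₁, cτ₂.eventually h₂, cs.eventually h₁]
      with z hz hz₁ hz₂ hz₃ hzS
    have e1 := hz₃.2.2.1
    rw [hz₃.2.2.2.2.2 hzS, hz₁.2.2.1] at e1
    rw [← e1] at hzS
    have e2 := hz₂.2.2.2.2.2 hzS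
    rw [hz.2.2.2.1] at e2
    rwa [e2]
  obtain ⟨i, hsi, hti, hSi⟩ := (hx.eventually (hs.eventually_nhds.and
    ((cs.eventually ht.eventually_nhds).and hS))).exists
  obtain ⟨hxS, hx0, w, hw, hw0, hw1, hnd⟩ := hdeg i
  have hy0 := hsi.self_of_nhds.2.2.1 hx0
  refine false_of_homeomorph_nondegenerate (g₁ := g₁) (g₂ := g₂) (y := σ₁ (τ₂ (x i)))
    (x₀ := x i) (by simpa using hpn) (hg₁.contDiffAt.of_le (by norm_cast)) hy0
    (hreg _ (fun h => hxS (hSi h)) hy0) (hg₂.contDiffAt.of_le (by norm_cast)) hx0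
    hw hw0 hw1 hnd (s := fun z => σ₁ (τ₂ z)) (t := fun y => σ₂ (τ₁ y)) rfl
    hsi.self_of_nhds.2.1 (hsi.mono fun _ h => h.1) (hti.mono fun _ h => h.1)
    (hsi.mono fun _ h => h.2.1) (hti.mono fun _ h => h.2) (hsi.mono fun _ h => h.2.2)

/-- Finite determinacy forces the ideal to be elliptic. -/
theorem FinitelySVDetermined.ikElliptic (hp : 1 ≤ p) (hpn : p < n) (hS : IsClosed S)
    (h0S : 0 ∈ S) {U : Set (EuclideanSpace ℝ (Fin n))} (hU : U ∈ 𝓝 0)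
    (hφ : ContDiffOn ℝ ∞ φ U) (hφ0 : φ 0 = 0) (h : FinitelySVDetermined n p S φ) :
    IKElliptic n p S φ := by
  by_contra hell
  obtain ⟨φ', hφ', he⟩ := exists_contDiff_eventuallyEq hU hφ
  obtain ⟨k, hk⟩ := h.exists_isLocalZeroEquiv h0S he hφ0
  obtain ⟨g₁, hg₁, hflat₁, hreg⟩ := exists_perturbation_regular hp hS hφ' k
  obtain ⟨g₂, x, hg₂, hflat₂, hx, hdeg⟩ :=
    exists_perturbation_degenerate hp hpn h0S hφ' he hell
  obtain ⟨σ₁, τ₁, h₁⟩ := hk g₁ hg₁ hflat₁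
  obtain ⟨σ₂, τ₂, h₂⟩ := hk g₂ hg₂ fun j _ => hflat₂ j
  exact h₁.false_of_degenerate hpn h₂ hg₁ hg₂ hreg hx hdeg

end Necessity

end

theorem finitelySVDetermined_iff_ikElliptic (n p : ℕ) (hp : 1 ≤ p) (hpn : p < n)
    (S : Set (EuclideanSpace ℝ (Fin n))) (hS : IsClosed S)
    (h0S : (0 : EuclideanSpace ℝ (Fin n)) ∈ S) (hcoh : CoherentSet n S)
    (φ : EuclideanSpace ℝ (Fin n) → EuclideanSpace ℝ (Fin p))
    (U : Set (EuclideanSpace ℝ (Fin n))) (hU : U ∈ nhds 0)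
    (hφ : ContDiffOn ℝ (⊤ : ℕ∞) φ U) (hφ0 : φ 0 = 0) :
    FinitelySVDetermined n p S φ ↔ IKElliptic n p S φ := by
  exact ⟨fun h => h.ikElliptic hp hpn hS h0S hU hφ hφ0,
    fun h => h.finitelySVDetermined hS h0S hU hφ⟩
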